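/- arXiv:1705.04587 — 2 statements merged into one kernel-verified Lean document; each statement's English description precedes it below -/
import Mathlib

section
/- Let a normal-form feasible schedule of the constructed instance with makespan W be given in which the job processed on machine 2 with start time 0 belongs to B. Then for every j ∈ {0,…,z} the job c_j (with p(c_j) = (z+j)D⁷+D⁸) is scheduled exactly in the gap between B_j and A_j on machines 2 and 3: σ(c_j) = σ(B_j) + D³ and σ(c_j) + p(c_j) = σ(A_j). -/
/-- Jobs of the instance constructed from a 3-Partition instance with parameter `z`. -/
inductive Job (z : ℕ) : Type
  | JA (i : Fin (z+1))
  | JB (i : Fin (z+1))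
  | Ja (i : Fin z)
  | Jb (i : Fin z)
  | Jc (j : Fin (z+1))
  | Jα (i : Fin z)
  | Jβ (i : Fin z)
  | Jγ (j : Fin z)
  | Jδ (j : Fin z)
  | Jl1
  | Jl2
  | Jpart (i : Fin (3*z))
  deriving DecidableEq, Fintype

/-- Processing times of the constructed jobs (`γ_j`, `δ_j` use index `j ∈ {1,…,z}`,
represented by `j.val + 1` for `j : Fin z`). -/
def pJob (z D : ℕ) (ι : Fin (3*z) → ℕ) : Job z → ℕ
  | .JA _ => D^2
  | .JB _ => D^3
  | .Ja _ => D^4 + D^6 + 3*z*D^7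
  | .Jb _ => D^5 + D^6 + 3*z*D^7
  | .Jc j => (z + j.val)*D^7 + D^8
  | .Jα _ => D^3 + D^5 + 4*z*D^7 + D^8
  | .Jβ _ => D^2 + D^4 + (4*z-1)*D^7 + D^8
  | .Jγ j => D^5 + (3*z - (j.val+1))*D^7 - D
  | .Jδ j => D^4 + (3*z - (j.val+1))*D^7
  | .Jl1 => D^3 + z*D^7 + D^8
  | .Jl2 => D^2 + 2*z*D^7 + D^8
  | .Jpart i => ι i

/-- Machine requirements of the constructed jobs. -/
def qJob (z : ℕ) : Job z → ℕ
  | .JA _ => 3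
  | .JB _ => 3
  | .Ja _ => 2
  | .Jb _ => 2
  | .Jc _ => 2
  | _ => 1

/-- Feasibility of a schedule `(σ, ρ)` on machines `{1,…,m}`: every job gets `q j`
machines among `{1,…,m}`, and jobs sharing a machine have disjoint half-open intervals. -/
def Feasible {J : Type} (m : ℕ) (p q : J → ℕ) (σ : J → ℕ) (ρ : J → Finset ℕ) : Prop :=
  (∀ j, ρ j ⊆ Finset.Icc 1 m) ∧ (∀ j, (ρ j).card = q j) ∧
  (∀ j j', j ≠ j' → (ρ j ∩ ρ j').Nonempty →
    σ j + p j ≤ σ j' ∨ σ j' + p j' ≤ σ j)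

/-- Makespan of a schedule. -/
def makespan {J : Type} [Fintype J] (p σ : J → ℕ) : ℕ :=
  Finset.univ.sup fun j => σ j + p j

/-- The target makespan `W`. -/
def Wval (z D : ℕ) : ℕ :=
  (z+1)*(D^2 + D^3 + D^8) + z*(D^4 + D^5 + D^6) + z*(7*z+1)*D^7

/-- The 3-Partition instance `ι` is a Yes-instance. -/
def IsYes (z D : ℕ) (ι : Fin (3*z) → ℕ) : Prop :=
  ∃ f : Fin (3*z) → Fin z,
    ∀ k : Fin z, ∑ i ∈ Finset.univ.filter (fun i => f i = k), ι i = D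

/-- Jobs processed on machine 1 in a normal-form schedule: `A ∪ a ∪ α ∪ {λ₁}`. -/
def M1Jobs {z : ℕ} : Job z → Prop
  | .JA _ => True
  | .Ja _ => True
  | .Jα _ => True
  | .Jl1 => True
  | _ => False

/-- Jobs processed on machine 4 in a normal-form schedule: `B ∪ b ∪ β ∪ {λ₂}`. -/
def M4Jobs {z : ℕ} : Job z → Prop
  | .JB _ => True
  | .Jb _ => True
  | .Jβ _ => True
  | .Jl2 => True
  | _ => False

/-- Jobs processed on both machines 2 and 3: `A ∪ B ∪ c`. -/
def BothM23 {z : ℕ} : Job z → Prop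
  | .JA _ => True
  | .JB _ => True
  | .Jc _ => True
  | _ => False

/-- Jobs processed on exactly one of machines 2 and 3: `a ∪ b ∪ γ ∪ δ ∪ P`. -/
def OneM23 {z : ℕ} : Job z → Prop
  | .Ja _ => True
  | .Jb _ => True
  | .Jγ _ => True
  | .Jδ _ => True
  | .Jpart _ => True
  | _ => False

/-- Normal form of a schedule of the constructed instance. -/
def NormalForm {z : ℕ} (ρ : Job z → Finset ℕ) : Prop :=
  (∀ j, 1 ∈ ρ j ↔ M1Jobs j) ∧
  (∀ j, 4 ∈ ρ j ↔ M4Jobs j) ∧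
  (∀ j, BothM23 j → 2 ∈ ρ j ∧ 3 ∈ ρ j) ∧
  (∀ j, OneM23 j → ((2 ∈ ρ j) ↔ ¬ (3 ∈ ρ j)))

/-- `cnt p σ S i` = number of jobs of `S` finishing no later than the start of `i`
(the quantity `#ᵢ S`). -/
def cnt {z : ℕ} (p σ : Job z → ℕ) (S : Finset (Job z)) (i : Job z) : ℕ :=
  (S.filter fun j => σ j + p j ≤ σ i).card

def sA (z : ℕ) : Finset (Job z) := Finset.univ.image Job.JA
def sB (z : ℕ) : Finset (Job z) := Finset.univ.image Job.JB
def sa (z : ℕ) : Finset (Job z) := Finset.univ.image Job.Ja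
def sb (z : ℕ) : Finset (Job z) := Finset.univ.image Job.Jb
def sc (z : ℕ) : Finset (Job z) := Finset.univ.image Job.Jc
def sα (z : ℕ) : Finset (Job z) := Finset.univ.image Job.Jα
def sβ (z : ℕ) : Finset (Job z) := Finset.univ.image Job.Jβ
def sγ (z : ℕ) : Finset (Job z) := Finset.univ.image Job.Jγ
def sδ (z : ℕ) : Finset (Job z) := Finset.univ.image Job.Jδ


structure Ctx (z D : ℕ) (ι : Fin (3*z) → ℕ) (σ : Job z → ℕ) (ρ : Job z → Finset ℕ) : Prop where
  hz : 0 < z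
  hsum : ∑ i, ι i = z * D
  hpos : ∀ i, 0 < ι i
  hD : 4*z*(7*z+1) < D
  feas : Feasible 4 (pJob z D ι) (qJob z) σ ρ
  mks : makespan (pJob z D ι) σ = Wval z D
  nf : NormalForm ρ

/-- completion time -/
def eT (z D : ℕ) (ι : Fin (3*z) → ℕ) (σ : Job z → ℕ) (j : Job z) : ℕ := σ j + pJob z D ι j

def fn {z k : ℕ} (e : Job z → ℕ) (f : Fin k → Job z) (t : ℕ) : Finset (Fin k) :=
  Finset.univ.filter fun i => e (f i) ≤ t

def fm {z k : ℕ} (e : Job z → ℕ) (ρ : Job z → Finset ℕ) (μ : ℕ) (f : Fin k → Job z) (t : ℕ) :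
    Finset (Fin k) :=
  Finset.univ.filter fun i => μ ∈ ρ (f i) ∧ e (f i) ≤ t

def on1 {z : ℕ} (e : Job z → ℕ) (j : Job z) (t : ℕ) : ℕ := if e j ≤ t then 1 else 0

def FF (z D : ℕ) (ι : Fin (3*z) → ℕ) (σ : Job z → ℕ) (ρ : Job z → Finset ℕ) (μ t : ℕ) : ℕ :=
  ∑ j, if μ ∈ ρ j ∧ eT z D ι σ j ≤ t then pJob z D ι j else 0

def jobEquiv (z : ℕ) : Job z ≃
    (Fin (z+1) ⊕ Fin (z+1) ⊕ Fin z ⊕ Fin z ⊕ Fin (z+1) ⊕ Fin z ⊕ Fin z ⊕ Fin z ⊕ Fin z ⊕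
      Unit ⊕ Unit ⊕ Fin (3*z)) where
  toFun
    | .JA i => .inl i
    | .JB i => .inr (.inl i)
    | .Ja i => .inr (.inr (.inl i))
    | .Jb i => .inr (.inr (.inr (.inl i)))
    | .Jc i => .inr (.inr (.inr (.inr (.inl i))))
    | .Jα i => .inr (.inr (.inr (.inr (.inr (.inl i)))))
    | .Jβ i => .inr (.inr (.inr (.inr (.inr (.inr (.inl i))))))
    | .Jγ i => .inr (.inr (.inr (.inr (.inr (.inr (.inr (.inl i)))))))
    | .Jδ i => .inr (.inr (.inr (.inr (.inr (.inr (.inr (.inr (.inl i))))))))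
    | .Jl1 => .inr (.inr (.inr (.inr (.inr (.inr (.inr (.inr (.inr (.inl ())))))))))
    | .Jl2 => .inr (.inr (.inr (.inr (.inr (.inr (.inr (.inr (.inr (.inr (.inl ()))))))))))
    | .Jpart i => .inr (.inr (.inr (.inr (.inr (.inr (.inr (.inr (.inr (.inr (.inr i))))))))))
  invFun
    | .inl i => .JA i
    | .inr (.inl i) => .JB i
    | .inr (.inr (.inl i)) => .Ja i
    | .inr (.inr (.inr (.inl i))) => .Jb i
    | .inr (.inr (.inr (.inr (.inl i)))) => .Jc i
    | .inr (.inr (.inr (.inr (.inr (.inl i))))) => .Jα i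
    | .inr (.inr (.inr (.inr (.inr (.inr (.inl i)))))) => .Jβ i
    | .inr (.inr (.inr (.inr (.inr (.inr (.inr (.inl i))))))) => .Jγ i
    | .inr (.inr (.inr (.inr (.inr (.inr (.inr (.inr (.inl i)))))))) => .Jδ i
    | .inr (.inr (.inr (.inr (.inr (.inr (.inr (.inr (.inr (.inl _))))))))) => .Jl1
    | .inr (.inr (.inr (.inr (.inr (.inr (.inr (.inr (.inr (.inr (.inl _)))))))))) => .Jl2
    | .inr (.inr (.inr (.inr (.inr (.inr (.inr (.inr (.inr (.inr (.inr i)))))))))) => .Jpart i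
  left_inv := by rintro (_|_|_|_|_|_|_|_|_|_|_|_) <;> rfl
  right_inv := by
    rintro (_|_|_|_|_|_|_|_|_|_|_|_) <;> rfl

lemma sum_job {z : ℕ} (g : Job z → ℕ) : ∑ j, g j =
    ∑ i, g (.JA i) + ∑ i, g (.JB i) + ∑ i, g (.Ja i) + ∑ i, g (.Jb i) + ∑ i, g (.Jc i)
    + ∑ i, g (.Jα i) + ∑ i, g (.Jβ i) + ∑ i, g (.Jγ i) + ∑ i, g (.Jδ i) + g .Jl1 + g .Jl2
    + ∑ i, g (.Jpart i) := by
  rw [← Equiv.sum_comp (jobEquiv z).symm]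
  simp only [Fintype.sum_sum_type, Finset.univ_unique, Finset.sum_singleton]
  simp only [jobEquiv, Equiv.coe_fn_symm_mk]
  ring

lemma pack {J : Type} (s : Finset J) (σ p : J → ℕ) (a b : ℕ) (hab : a ≤ b)
    (h1 : ∀ j ∈ s, a ≤ σ j ∧ σ j + p j ≤ b)
    (h2 : ∀ j ∈ s, ∀ j' ∈ s, j ≠ j' → σ j + p j ≤ σ j' ∨ σ j' + p j' ≤ σ j) :
    ∑ j ∈ s, p j + a ≤ b := by
  classical
  have hd : ∀ x ∈ s, ∀ y ∈ s, x ≠ y →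
      Disjoint (Finset.Ico (σ x) (σ x + p x)) (Finset.Ico (σ y) (σ y + p y)) := by
    intro x hx y hy hxy
    rw [Finset.disjoint_left]
    intro u hu hu'
    simp only [Finset.mem_Ico] at hu hu'
    rcases h2 x hx y hy hxy with h | h <;> omega
  have hc := Finset.card_biUnion hd
  have hsub : s.biUnion (fun j => Finset.Ico (σ j) (σ j + p j)) ⊆ Finset.Ico a b := by
    intro u hu
    simp only [Finset.mem_biUnion, Finset.mem_Ico] at hu ⊢
    obtain ⟨j, hj, h⟩ := hu
    have := h1 j hj
    omega
  have := Finset.card_le_card hsub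
  rw [hc] at this
  simp at this
  omega

section
variable {z D : ℕ} {ι : Fin (3*z) → ℕ} {σ : Job z → ℕ} {ρ : Job z → Finset ℕ}

lemma Ctx.Dz (h : Ctx z D ι σ ρ) : 28*z*z+4*z < D := by
  have := h.hD
  nlinarith

lemma Ctx.D1 (h : Ctx z D ι σ ρ) : 1 < D := by
  have := h.Dz; have := h.hz
  nlinarith

lemma Ctx.ppos (h : Ctx z D ι σ ρ) (j : Job z) : 0 < pJob z D ι j := by
  have hD := h.D1
  have h0 : 0 < D := by omega
  cases j with
  | Jγ j =>
    simp only [pJob]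
    have : D^1 < D^5 := Nat.pow_lt_pow_right hD (by norm_num)
    rw [pow_one] at this
    omega
  | Jpart i => exact h.hpos i
  | _ => simp only [pJob]; positivity

lemma Ctx.eW (h : Ctx z D ι σ ρ) (j : Job z) : eT z D ι σ j ≤ Wval z D := by
  rw [← h.mks]
  exact Finset.le_sup (f := fun j => σ j + pJob z D ι j) (Finset.mem_univ j)

lemma Ctx.sep (h : Ctx z D ι σ ρ) {j j' : Job z} (hne : j ≠ j') {μ : ℕ} (h1 : μ ∈ ρ j)
    (h2 : μ ∈ ρ j') : eT z D ι σ j ≤ σ j' ∨ eT z D ι σ j' ≤ σ j :=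
  h.feas.2.2 j j' hne ⟨μ, Finset.mem_inter.2 ⟨h1, h2⟩⟩

lemma Ctx.FF_le (h : Ctx z D ι σ ρ) (μ t : ℕ) : FF z D ι σ ρ μ t ≤ t := by
  unfold FF
  rw [← Finset.sum_filter]
  have := pack (Finset.univ.filter fun j => μ ∈ ρ j ∧ eT z D ι σ j ≤ t) σ (pJob z D ι) 0 t
    (by omega) (by
      intro j hj
      simp at hj
      exact ⟨by omega, hj.2⟩) (by
      intro j hj j' hj' hne
      simp at hj hj'
      exact h.sep hne hj.1 hj'.1)
  omega

lemma Ctx.noidle' (h : Ctx z D ι σ ρ) (μ : ℕ) (hW : FF z D ι σ ρ μ (Wval z D) = Wval z D)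
    (i : Job z) (hi : μ ∈ ρ i) : FF z D ι σ ρ μ (σ i) = σ i := by
  apply le_antisymm (h.FF_le μ _)
  set W := Wval z D with hWd
  have hiW : σ i ≤ W := by
    have := h.eW i
    unfold eT at this; omega
  have h2 := pack (Finset.univ.filter fun j => μ ∈ ρ j ∧ ¬ eT z D ι σ j ≤ σ i) σ (pJob z D ι)
    (σ i) W hiW (by
      intro j hj
      simp only [Finset.mem_filter, Finset.mem_univ, true_and] at hj
      refine ⟨?_, h.eW j⟩
      by_cases hji : j = i
      · rw [hji]
      · rcases h.sep hji hj.1 hi with h' | h'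
        · exact absurd h' hj.2
        · unfold eT at h'; omega) (by
      intro j hj j' hj' hne
      simp only [Finset.mem_filter, Finset.mem_univ, true_and] at hj hj'
      exact h.sep hne hj.1 hj'.1)
  have h3 : FF z D ι σ ρ μ W = FF z D ι σ ρ μ (σ i) +
      ∑ j ∈ (Finset.univ.filter fun j => μ ∈ ρ j ∧ ¬ eT z D ι σ j ≤ σ i), pJob z D ι j := by
    unfold FF
    rw [Finset.sum_filter, ← Finset.sum_add_distrib]
    apply Finset.sum_congr rfl
    intro j _
    have := h.eW j
    by_cases h1 : μ ∈ ρ j <;> by_cases h2 : eT z D ι σ j ≤ σ i <;> simp [h1, h2, hWd, this]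
  omega

-- membership facts
lemma Ctx.two_or_three (h : Ctx z D ι σ ρ) {j : Job z} (hj : BothM23 j ∨ OneM23 j) :
    2 ∈ ρ j ∨ 3 ∈ ρ j := by
  rcases hj with hj | hj
  · exact Or.inl (h.nf.2.2.1 j hj).1
  · have := h.nf.2.2.2 j hj
    tauto

lemma Ctx.none23 (h : Ctx z D ι σ ρ) {j : Job z} (hq : qJob z j = 1) {ν μ : ℕ} (hν : ν ∈ ρ j)
    (hne : μ ≠ ν) : μ ∉ ρ j := by
  intro hm
  have hc := h.feas.2.1 j
  rw [hq] at hc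
  rw [Finset.card_eq_one] at hc
  obtain ⟨x, hx⟩ := hc
  rw [hx] at hν hm
  simp at hν hm
  omega

lemma sum_fm {k : ℕ} (e : Job z → ℕ) (μ : ℕ) (f : Fin k → Job z) (t : ℕ) (g : Fin k → ℕ) :
    (∑ i, if μ ∈ ρ (f i) ∧ e (f i) ≤ t then g i else 0) = ∑ i ∈ fm e ρ μ f t, g i := by
  rw [fm, Finset.sum_filter]

lemma fm_eq_fn {k : ℕ} (e : Job z → ℕ) (μ : ℕ) (f : Fin k → Job z) (t : ℕ)
    (h : ∀ i, μ ∈ ρ (f i)) : fm e ρ μ f t = fn e f t := by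
  ext i; simp [fm, fn, h]

lemma fm_empty {k : ℕ} (e : Job z → ℕ) (μ : ℕ) (f : Fin k → Job z) (t : ℕ)
    (h : ∀ i, μ ∉ ρ (f i)) : fm e ρ μ f t = ∅ := by
  ext i; simp [fm, h]

lemma Ctx.m1 (h : Ctx z D ι σ ρ) (j : Job z) : 1 ∈ ρ j ↔ M1Jobs j := h.nf.1 j
lemma Ctx.m4 (h : Ctx z D ι σ ρ) (j : Job z) : 4 ∈ ρ j ↔ M4Jobs j := h.nf.2.1 j
lemma Ctx.mb (h : Ctx z D ι σ ρ) {μ : ℕ} (hμ : μ = 2 ∨ μ = 3) (j : Job z) (hj : BothM23 j) :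
    μ ∈ ρ j := by
  have := h.nf.2.2.1 j hj
  rcases hμ with rfl | rfl <;> tauto

lemma Ctx.FF1 (h : Ctx z D ι σ ρ) (t : ℕ) : FF z D ι σ ρ 1 t =
    (fn (eT z D ι σ) .JA t).card * D^2 + (fn (eT z D ι σ) .Ja t).card * (D^4+D^6+3*z*D^7)
    + (fn (eT z D ι σ) .Jα t).card * (D^3+D^5+4*z*D^7+D^8)
    + on1 (eT z D ι σ) .Jl1 t * (D^3+z*D^7+D^8) := by
  unfold FF
  rw [sum_job]
  simp only [h.m1, M1Jobs]
  simp [pJob, fn, on1, Finset.sum_ite]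

lemma Ctx.FF4 (h : Ctx z D ι σ ρ) (t : ℕ) : FF z D ι σ ρ 4 t =
    (fn (eT z D ι σ) .JB t).card * D^3 + (fn (eT z D ι σ) .Jb t).card * (D^5+D^6+3*z*D^7)
    + (fn (eT z D ι σ) .Jβ t).card * (D^2+D^4+(4*z-1)*D^7+D^8)
    + on1 (eT z D ι σ) .Jl2 t * (D^2+2*z*D^7+D^8) := by
  unfold FF
  rw [sum_job]
  simp only [h.m4, M4Jobs]
  simp [pJob, fn, on1, Finset.sum_ite]

def CC {z : ℕ} (e : Job z → ℕ) (t : ℕ) : ℕ := ∑ i ∈ fn e .Jc t, i.val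
def SS {z : ℕ} (e : Job z → ℕ) (ρ : Job z → Finset ℕ) (μ t : ℕ) : ℕ :=
  ∑ i ∈ fm e ρ μ .Jγ t, (i.val + 1) + ∑ i ∈ fm e ρ μ .Jδ t, (i.val + 1)

lemma Ctx.FF23 (h : Ctx z D ι σ ρ) {μ : ℕ} (hμ : μ = 2 ∨ μ = 3) (t : ℕ) :
    (FF z D ι σ ρ μ t : ℤ) =
    ((∑ i ∈ fm (eT z D ι σ) ρ μ .Jpart t, ι i : ℕ) : ℤ)
     - (fm (eT z D ι σ) ρ μ .Jγ t).card * D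
    + (fn (eT z D ι σ) .JA t).card * D^2 + (fn (eT z D ι σ) .JB t).card * D^3
    + ((fm (eT z D ι σ) ρ μ .Ja t).card + (fm (eT z D ι σ) ρ μ .Jδ t).card) * D^4
    + ((fm (eT z D ι σ) ρ μ .Jb t).card + (fm (eT z D ι σ) ρ μ .Jγ t).card) * D^5
    + ((fm (eT z D ι σ) ρ μ .Ja t).card + (fm (eT z D ι σ) ρ μ .Jb t).card) * D^6
    + (3*z*((fm (eT z D ι σ) ρ μ .Ja t).card + (fm (eT z D ι σ) ρ μ .Jb t).card
        + (fm (eT z D ι σ) ρ μ .Jγ t).card + (fm (eT z D ι σ) ρ μ .Jδ t).card)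
        - SS (eT z D ι σ) ρ μ t + z * (fn (eT z D ι σ) .Jc t).card + CC (eT z D ι σ) t) * D^7
    + (fn (eT z D ι σ) .Jc t).card * D^8 := by
  set e := eT z D ι σ with he
  unfold FF
  rw [sum_job]
  rw [← he]
  simp only [sum_fm]
  have hμ1 : μ ≠ 1 := by omega
  have hμ4 : μ ≠ 4 := by omega
  have e1 : μ ∉ ρ .Jl1 := h.none23 rfl ((h.m1 _).2 trivial) hμ1
  have e2 : μ ∉ ρ .Jl2 := h.none23 rfl ((h.m4 _).2 trivial) hμ4
  rw [fm_eq_fn e μ .JA t (fun i => h.mb hμ _ trivial),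
    fm_eq_fn e μ .JB t (fun i => h.mb hμ _ trivial),
    fm_eq_fn e μ .Jc t (fun i => h.mb hμ _ trivial),
    fm_empty e μ .Jα t (fun i => h.none23 rfl ((h.m1 _).2 trivial) hμ1),
    fm_empty e μ .Jβ t (fun i => h.none23 rfl ((h.m4 _).2 trivial) hμ4)]
  have g1 : ((∑ i ∈ fm e ρ μ .Jγ t, pJob z D ι (.Jγ i) : ℕ) : ℤ) =
      (fm e ρ μ .Jγ t).card * (D^5 + 3*z*D^7 - D)
        - ((∑ i ∈ fm e ρ μ .Jγ t, (i.val + 1) : ℕ) : ℤ) * D^7 := by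
    have : ∀ i ∈ fm e ρ μ .Jγ t, ((pJob z D ι (.Jγ i) : ℕ) : ℤ)
        = (D^5 + 3*z*D^7 - D) - ((i.val + 1 : ℕ):ℤ) * D^7 := by
      intro i _
      have hi := i.isLt
      have hDD : D ≤ D^5 := Nat.le_self_pow (by norm_num) D
      simp only [pJob]
      rw [Nat.cast_sub (by omega)]
      push_cast [Nat.cast_sub (show i.val + 1 ≤ 3*z by omega)]
      ring
    push_cast [Finset.sum_congr rfl this]
    rw [Finset.sum_sub_distrib, ← Finset.sum_mul]
    simp
    ring
  have g2 : ((∑ i ∈ fm e ρ μ .Jδ t, pJob z D ι (.Jδ i) : ℕ) : ℤ) =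
      (fm e ρ μ .Jδ t).card * (D^4 + 3*z*D^7)
        - ((∑ i ∈ fm e ρ μ .Jδ t, (i.val + 1) : ℕ) : ℤ) * D^7 := by
    have : ∀ i ∈ fm e ρ μ .Jδ t, ((pJob z D ι (.Jδ i) : ℕ) : ℤ)
        = (D^4 + 3*z*D^7) - ((i.val + 1 : ℕ):ℤ) * D^7 := by
      intro i _
      have hi := i.isLt
      simp only [pJob]
      push_cast [Nat.cast_sub (show i.val + 1 ≤ 3*z by omega)]
      ring
    push_cast [Finset.sum_congr rfl this]
    rw [Finset.sum_sub_distrib, ← Finset.sum_mul]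
    simp
  have g3 : ∑ i ∈ fn e .Jc t, pJob z D ι (.Jc i) =
      (fn e .Jc t).card * (z*D^7 + D^8) + (CC e t) * D^7 := by
    unfold CC
    rw [Finset.sum_mul, Finset.card_eq_sum_ones, Finset.sum_mul, ← Finset.sum_add_distrib]
    apply Finset.sum_congr rfl
    intro i _
    simp only [pJob]; ring
  rw [g3]
  rw [Nat.cast_add, Nat.cast_add, Nat.cast_add, Nat.cast_add, Nat.cast_add, Nat.cast_add,
    Nat.cast_add, Nat.cast_add, Nat.cast_add, Nat.cast_add, Nat.cast_add, g1, g2]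
  unfold SS
  simp only [pJob, e1, e2, false_and, if_false, Finset.sum_const, Finset.card_empty, smul_eq_mul]
  push_cast
  ring
end

section
variable {z D : ℕ} {ι : Fin (3*z) → ℕ} {σ : Job z → ℕ} {ρ : Job z → Finset ℕ}

lemma Ctx.split (h : Ctx z D ι σ ρ) {k : ℕ} (e : Job z → ℕ) (f : Fin k → Job z)
    (hf : ∀ i, OneM23 (f i)) (t : ℕ) (g : Fin k → ℕ) :
    ∑ i ∈ fm e ρ 2 f t, g i + ∑ i ∈ fm e ρ 3 f t, g i = ∑ i ∈ fn e f t, g i := by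
  simp only [fm, fn, Finset.sum_filter]
  rw [← Finset.sum_add_distrib]
  apply Finset.sum_congr rfl
  intro i _
  have := h.nf.2.2.2 (f i) (hf i)
  by_cases h3 : 3 ∈ ρ (f i) <;> by_cases h2 : 2 ∈ ρ (f i) <;> simp [h2, h3] <;> tauto

lemma Ctx.splitc (h : Ctx z D ι σ ρ) {k : ℕ} (e : Job z → ℕ) (f : Fin k → Job z)
    (hf : ∀ i, OneM23 (f i)) (t : ℕ) :
    (fm e ρ 2 f t).card + (fm e ρ 3 f t).card = (fn e f t).card := by
  have := h.split e f hf t (fun _ => 1)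
  simpa using this

lemma Ctx.fnW (h : Ctx z D ι σ ρ) {k : ℕ} (f : Fin k → Job z) :
    fn (eT z D ι σ) f (Wval z D) = Finset.univ := by
  ext i; simp [fn, h.eW]

lemma sum_val (n : ℕ) : 2 * ∑ i : Fin (n+1), i.val = n * (n+1) := by
  rw [Fin.sum_univ_eq_sum_range (fun i => i)]
  have := Finset.sum_range_id_mul_two (n+1)
  simp at this
  linarith

lemma sum_val1 (n : ℕ) : 2 * ∑ i : Fin n, (i.val + 1) = n * (n+1) := by
  rw [Fin.sum_univ_eq_sum_range (fun i => i + 1)]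
  induction n with
  | zero => simp
  | succ n ih => rw [Finset.sum_range_succ, mul_add, ih]; ring

lemma Ctx.load1 (h : Ctx z D ι σ ρ) : FF z D ι σ ρ 1 (Wval z D) = Wval z D := by
  rw [h.FF1]
  simp only [h.fnW, on1, h.eW, if_true, Finset.card_univ, Fintype.card_fin]
  unfold Wval
  ring

lemma Ctx.load4 (h : Ctx z D ι σ ρ) : FF z D ι σ ρ 4 (Wval z D) = Wval z D := by
  rw [h.FF4]
  simp only [h.fnW, on1, h.eW, if_true, Finset.card_univ, Fintype.card_fin]
  unfold Wval
  obtain ⟨y, rfl⟩ : ∃ y, z = y + 1 := ⟨z - 1, by have := h.hz; omega⟩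
  have : 4 * (y+1) - 1 = 4 * y + 3 := by omega
  rw [this]
  ring

lemma Ctx.load23 (h : Ctx z D ι σ ρ) :
    FF z D ι σ ρ 2 (Wval z D) = Wval z D ∧ FF z D ι σ ρ 3 (Wval z D) = Wval z D := by
  have l2 := h.FF_le 2 (Wval z D)
  have l3 := h.FF_le 3 (Wval z D)
  have f2 := h.FF23 (Or.inl rfl) (Wval z D)
  have f3 := h.FF23 (Or.inr rfl) (Wval z D)
  suffices (FF z D ι σ ρ 2 (Wval z D) : ℤ) + FF z D ι σ ρ 3 (Wval z D) = 2 * Wval z D by omega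
  set e := eT z D ι σ with he
  set W := Wval z D with hW
  have ca := h.splitc e .Ja (fun _ => trivial) W
  have cb := h.splitc e .Jb (fun _ => trivial) W
  have cg := h.splitc e .Jγ (fun _ => trivial) W
  have cd := h.splitc e .Jδ (fun _ => trivial) W
  have sp := h.split e .Jpart (fun _ => trivial) W ι
  have sg := h.split e .Jγ (fun _ => trivial) W (fun i => i.val + 1)
  have sd := h.split e .Jδ (fun _ => trivial) W (fun i => i.val + 1)
  have hS : SS e ρ 2 W + SS e ρ 3 W = z * (z+1) := by
    have := sum_val1 z
    rw [he, hW, h.fnW] at sg sd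
    rw [← hW, ← he] at sg sd
    unfold SS
    omega
  have hC : 2 * CC e W = z * (z+1) := by
    rw [CC, he, hW, h.fnW, sum_val]
  rw [he, hW, h.fnW] at ca cb cg cd sp
  rw [h.hsum] at sp
  simp only [Finset.card_univ, Fintype.card_fin] at ca cb cg cd
  rw [← hW, ← he] at ca cb cg cd sp
  have cA : (fn e .JA W).card = z + 1 := by rw [he, hW, h.fnW]; simp
  have cB : (fn e .JB W).card = z + 1 := by rw [he, hW, h.fnW]; simp
  have cc : (fn e .Jc W).card = z + 1 := by rw [he, hW, h.fnW]; simp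
  rw [cA, cB, cc] at f2 f3
  rw [f2, f3]
  have hW' : (W : ℤ) = (z+1)*(D^2 + D^3 + D^8) + z*(D^4 + D^5 + D^6) + z*(7*z+1)*D^7 := by
    rw [hW, Wval]; push_cast; ring
  rw [hW']
  zify at ca cb cg cd sp hS hC
  push_cast
  linear_combination sp - D * cg + (D^4+D^6+3*z*D^7) * ca + (D^5+D^6+3*z*D^7) * cb
    + (D^5+3*z*D^7) * cg + (D^4+3*z*D^7) * cd - D^7 * hS + D^7 * hC

lemma Ctx.noidle (h : Ctx z D ι σ ρ) (i : Job z) {μ : ℕ} (hi : μ ∈ ρ i) :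
    FF z D ι σ ρ μ (σ i) = σ i := by
  apply h.noidle' μ _ i hi
  have := h.feas.1 i hi
  rw [Finset.mem_Icc] at this
  have h4 : μ = 1 ∨ μ = 2 ∨ μ = 3 ∨ μ = 4 := by omega
  rcases h4 with rfl | rfl | rfl | rfl
  · exact h.load1
  · exact h.load23.1
  · exact h.load23.2
  · exact h.load4

lemma digit1 (M x y : ℤ) (hx : |x| < M) (h : x + y * M = 0) : x = 0 ∧ y = 0 := by
  have : M ∣ x := ⟨-y, by linarith⟩
  have hx0 := Int.eq_zero_of_abs_lt_dvd this hx
  subst hx0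
  refine ⟨rfl, ?_⟩
  rcases mul_eq_zero.1 (by linarith : y * M = 0) with h | h
  · exact h
  · simp [h] at hx

lemma digits (D x0 x2 x3 x4 x5 x6 x7 x8 : ℤ) (h0 : |x0| < D^2) (h2 : |x2| < D) (h3 : |x3| < D)
    (h4 : |x4| < D) (h5 : |x5| < D) (h6 : |x6| < D) (h7 : |x7| < D)
    (h : x0 + x2*D^2 + x3*D^3 + x4*D^4 + x5*D^5 + x6*D^6 + x7*D^7 + x8*D^8 = 0) :
    x0 = 0 ∧ x2 = 0 ∧ x3 = 0 ∧ x4 = 0 ∧ x5 = 0 ∧ x6 = 0 ∧ x7 = 0 ∧ x8 = 0 := by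
  obtain ⟨a0, h⟩ := digit1 (D^2) x0 (x2 + x3*D + x4*D^2 + x5*D^3 + x6*D^4 + x7*D^5 + x8*D^6) h0
    (by linarith)
  obtain ⟨a2, h⟩ := digit1 D x2 (x3 + x4*D + x5*D^2 + x6*D^3 + x7*D^4 + x8*D^5) h2
    (by linarith)
  obtain ⟨a3, h⟩ := digit1 D x3 (x4 + x5*D + x6*D^2 + x7*D^3 + x8*D^4) h3 (by linarith)
  obtain ⟨a4, h⟩ := digit1 D x4 (x5 + x6*D + x7*D^2 + x8*D^3) h4 (by linarith)
  obtain ⟨a5, h⟩ := digit1 D x5 (x6 + x7*D + x8*D^2) h5 (by linarith)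
  obtain ⟨a6, h⟩ := digit1 D x6 (x7 + x8*D) h6 (by linarith)
  obtain ⟨a7, a8⟩ := digit1 D x7 x8 h7 (by linarith)
  exact ⟨a0, a2, a3, a4, a5, a6, a7, a8⟩

lemma card_fn_le {k : ℕ} (e : Job z → ℕ) (f : Fin k → Job z) (t : ℕ) : (fn e f t).card ≤ k := by
  simpa using Finset.card_le_univ (fn e f t)
lemma card_fm_le {k : ℕ} (e : Job z → ℕ) (μ : ℕ) (f : Fin k → Job z) (t : ℕ) :
    (fm e ρ μ f t).card ≤ k := by
  simpa using Finset.card_le_univ (fm e ρ μ f t)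

lemma SS_le (e : Job z → ℕ) (μ t : ℕ) :
    SS e ρ μ t ≤ z * ((fm e ρ μ .Jγ t).card + (fm e ρ μ .Jδ t).card) := by
  have := Finset.sum_le_card_nsmul (fm e ρ μ .Jγ t) (fun i => i.val + 1) z (fun i _ => i.isLt)
  have := Finset.sum_le_card_nsmul (fm e ρ μ .Jδ t) (fun i => i.val + 1) z (fun i _ => i.isLt)
  simp only [smul_eq_mul] at *
  unfold SS
  nlinarith

lemma CC_le (e : Job z → ℕ) (t : ℕ) : CC e t ≤ z * (z + 1) := by
  have := Finset.sum_le_card_nsmul (fn e .Jc t) (fun i => i.val) z (fun i _ => by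
    have := i.isLt; omega)
  have h2 := card_fn_le e .Jc t
  simp only [smul_eq_mul] at *
  unfold CC
  nlinarith

lemma on1_le (e : Job z → ℕ) (j : Job z) (t : ℕ) : on1 e j t ≤ 1 := by
  unfold on1; split <;> omega

/-- coefficient at `D^7` on machines 2,3 -/
lemma coef7 (z a b g d S nc C : ℤ) (hz : 0 < z) (ha : 0 ≤ a) (ha' : a ≤ z) (hb : 0 ≤ b)
    (hb' : b ≤ z) (hg : 0 ≤ g) (hg' : g ≤ z) (hd : 0 ≤ d) (hd' : d ≤ z)
    (hS : 0 ≤ S) (hS' : S ≤ z * (g + d)) (hn : 0 ≤ nc) (hn' : nc ≤ z + 1) (hC : 0 ≤ C)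
    (hC' : C ≤ z * (z+1)) :
    0 ≤ 3*z*(a+b+g+d) - S + z*nc + C ∧ 3*z*(a+b+g+d) - S + z*nc + C ≤ 14*z*z + 2*z := by
  constructor
  · nlinarith [mul_nonneg hz.le ha, mul_nonneg hz.le hb, mul_nonneg hz.le hg, mul_nonneg hz.le hd,
      mul_nonneg hz.le hn]
  · nlinarith [mul_le_mul_of_nonneg_left ha' hz.le, mul_le_mul_of_nonneg_left hb' hz.le,
      mul_le_mul_of_nonneg_left hg' hz.le, mul_le_mul_of_nonneg_left hd' hz.le,
      mul_le_mul_of_nonneg_left hn' hz.le]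

structure Sync1 (z : ℕ) (e : Job z → ℕ) (ρ : Job z → Finset ℕ) (μ t : ℕ) : Prop where
  hB : (fn e .JB t).card = (fn e .Jc t).card
  hα : (fn e .Jα t).card + on1 e .Jl1 t = (fn e .Jc t).card
  h4 : (fn e .Ja t).card = (fm e ρ μ .Ja t).card + (fm e ρ μ .Jδ t).card
  h5 : (fn e .Jα t).card = (fm e ρ μ .Jb t).card + (fm e ρ μ .Jγ t).card
  h6 : (fn e .Ja t).card = (fm e ρ μ .Ja t).card + (fm e ρ μ .Jb t).card
  hS : SS e ρ μ t = CC e t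

structure Sync4 (z : ℕ) (e : Job z → ℕ) (ρ : Job z → Finset ℕ) (μ t : ℕ) : Prop where
  hA : (fn e .JA t).card = (fn e .Jc t).card
  hβ : (fn e .Jβ t).card + on1 e .Jl2 t = (fn e .Jc t).card
  h4 : (fn e .Jβ t).card = (fm e ρ μ .Ja t).card + (fm e ρ μ .Jδ t).card
  h5 : (fn e .Jb t).card = (fm e ρ μ .Jb t).card + (fm e ρ μ .Jγ t).card
  h6 : (fn e .Jb t).card = (fm e ρ μ .Ja t).card + (fm e ρ μ .Jb t).card
  hS : SS e ρ μ t + z * on1 e .Jl2 t = CC e t + (fn e .Jβ t).card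

lemma Ctx.part_le (h : Ctx z D ι σ ρ) (e : Job z → ℕ) (μ t : ℕ) :
    ∑ i ∈ fm e ρ μ .Jpart t, ι i ≤ z * D := by
  rw [← h.hsum]
  exact Finset.sum_le_univ_sum_of_nonneg (fun _ => Nat.zero_le _)

lemma low_bound (z D P g : ℤ) (hz : 0 < z) (hD : 28*z*z+4*z < D) (hP : 0 ≤ P) (hP' : P ≤ z * D)
    (hg : 0 ≤ g) (hg' : g ≤ z) : |P - g * D| < D^2 ∧ |P - g*D| ≤ z * D := by
  have hzD : z < D := by nlinarith
  have h2 : |P - g*D| ≤ z * D := by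
    rw [abs_le]
    constructor <;> nlinarith
  refine ⟨lt_of_le_of_lt h2 ?_, h2⟩
  nlinarith

lemma absb (M x y : ℤ) (hx : 0 ≤ x) (hx' : x < M) (hy : 0 ≤ y) (hy' : y < M) : |x - y| < M := by
  rw [abs_lt]; constructor <;> linarith

lemma arith1 (z D P nA nB nc am bm gm dm na nα l S C : ℤ) (hz : 0 < z) (hD : 28*z*z+4*z < D)
    (hP : 0 ≤ P) (hP' : P ≤ z * D) (hB : 0 ≤ nB) (hB' : nB ≤ z+1) (hn : 0 ≤ nc) (hn' : nc ≤ z + 1)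
    (ha : 0 ≤ am) (ha' : am ≤ z) (hb : 0 ≤ bm) (hb' : bm ≤ z) (hg : 0 ≤ gm) (hg' : gm ≤ z)
    (hd : 0 ≤ dm) (hd' : dm ≤ z) (hna : 0 ≤ na) (hna' : na ≤ z) (hα : 0 ≤ nα) (hα' : nα ≤ z)
    (hl : 0 ≤ l) (hl' : l ≤ 1)
    (hS : 0 ≤ S) (hS' : S ≤ z * (gm + dm)) (hC : 0 ≤ C) (hC' : C ≤ z * (z+1))
    (h : nA * D^2 + na * (D^4+D^6+3*z*D^7) + nα * (D^3+D^5+4*z*D^7+D^8) + l * (D^3+z*D^7+D^8) =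
      P - gm * D + nA * D^2 + nB * D^3 + (am + dm) * D^4 + (bm + gm) * D^5 + (am + bm) * D^6
      + (3*z*(am+bm+gm+dm) - S + z*nc + C) * D^7 + nc * D^8) :
    nB = nc ∧ nα + l = nc ∧ na = am + dm ∧ nα = bm + gm ∧ na = am + bm ∧ S = C := by
  have hzD : 14 * z < D := by nlinarith
  have hzz : (0:ℤ) ≤ z * z := by positivity
  have c7 := coef7 z am bm gm dm S nc C hz ha ha' hb hb' hg hg' hd hd' hS hS' hn hn' hC hC'
  have c1 : (0:ℤ) ≤ 3*z*na + 4*z*nα + z*l ∧ (3*z*na + 4*z*nα + z*l : ℤ) ≤ 7*z*z+z := by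
    constructor
    · positivity
    · linarith [mul_le_mul_of_nonneg_left hna' hz.le, mul_le_mul_of_nonneg_left hα' hz.le,
        mul_le_mul_of_nonneg_left hl' hz.le]
  obtain ⟨_, _, e3, e4, e5, e6, e7, e8⟩ := digits D (P - gm * D) 0 (nB - (nα + l)) (am + dm - na)
    (bm + gm - nα) (am + bm - na)
    ((3*z*(am+bm+gm+dm) - S + z*nc + C) - (3*z*na + 4*z*nα + z*l)) (nc - (nα + l))
    (low_bound z D P gm hz hD hP hP' hg hg').1 (by rw [abs_zero]; linarith)
    (by apply absb <;> linarith)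
    (by apply absb <;> linarith) (by apply absb <;> linarith) (by apply absb <;> linarith)
    (by apply absb <;> linarith)
    (by linear_combination -h)
  refine ⟨by linarith, by linarith, by linarith, by linarith, by linarith, ?_⟩
  linear_combination -e7 + 3*z*(e6) + 3*z*(e5+e4-e6) + z * e8

lemma arith4 (z D P nA nB nc am bm gm dm nb nβ l S C : ℤ) (hz : 0 < z) (hD : 28*z*z+4*z < D)
    (hP : 0 ≤ P) (hP' : P ≤ z * D) (hA : 0 ≤ nA) (hA' : nA ≤ z+1) (hn : 0 ≤ nc) (hn' : nc ≤ z + 1)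
    (ha : 0 ≤ am) (ha' : am ≤ z) (hb : 0 ≤ bm) (hb' : bm ≤ z) (hg : 0 ≤ gm) (hg' : gm ≤ z)
    (hd : 0 ≤ dm) (hd' : dm ≤ z) (hnb : 0 ≤ nb) (hnb' : nb ≤ z) (hβ : 0 ≤ nβ) (hβ' : nβ ≤ z)
    (hl : 0 ≤ l) (hl' : l ≤ 1)
    (hS : 0 ≤ S) (hS' : S ≤ z * (gm + dm)) (hC : 0 ≤ C) (hC' : C ≤ z * (z+1))
    (h : nB * D^3 + nb * (D^5+D^6+3*z*D^7) + nβ * (D^2+D^4+(4*z-1)*D^7+D^8)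
        + l * (D^2+2*z*D^7+D^8) =
      P - gm * D + nA * D^2 + nB * D^3 + (am + dm) * D^4 + (bm + gm) * D^5 + (am + bm) * D^6
      + (3*z*(am+bm+gm+dm) - S + z*nc + C) * D^7 + nc * D^8) :
    nA = nc ∧ nβ + l = nc ∧ nβ = am + dm ∧ nb = bm + gm ∧ nb = am + bm ∧ S + z * l = C + nβ := by
  have hzD : 14 * z < D := by nlinarith
  have hzz : (0:ℤ) ≤ z * z := by positivity
  have c7 := coef7 z am bm gm dm S nc C hz ha ha' hb hb' hg hg' hd hd' hS hS' hn hn' hC hC'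
  have c1 : (0:ℤ) ≤ 3*z*nb + (4*z-1)*nβ + 2*z*l ∧
      (3*z*nb + (4*z-1)*nβ + 2*z*l : ℤ) ≤ 7*z*z+2*z := by
    have : (0:ℤ) ≤ (4*z-1)*nβ := mul_nonneg (by linarith) hβ
    constructor
    · positivity
    · linarith [mul_le_mul_of_nonneg_left hnb' hz.le, mul_le_mul_of_nonneg_left hβ' hz.le,
        mul_le_mul_of_nonneg_left hl' hz.le]
  obtain ⟨_, e3, _, e4, e5, e6, e7, e8⟩ := digits D (P - gm * D) (nA - (nβ + l)) 0 (am + dm - nβ)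
    (bm + gm - nb) (am + bm - nb)
    ((3*z*(am+bm+gm+dm) - S + z*nc + C) - (3*z*nb + (4*z-1)*nβ + 2*z*l)) (nc - (nβ + l))
    (low_bound z D P gm hz hD hP hP' hg hg').1
    (by apply absb <;> linarith) (by rw [abs_zero]; linarith)
    (by apply absb <;> linarith) (by apply absb <;> linarith) (by apply absb <;> linarith)
    (by apply absb <;> linarith)
    (by linear_combination -h)
  refine ⟨by linarith, by linarith, by linarith, by linarith, by linarith, ?_⟩
  linear_combination -e7 + 3*z*(e6) + 3*z*(e5+e4-e6) + z * e8

lemma arithc (z D nA nB nc C P am bm gm dm S P' am' bm' gm' dm' S' : ℤ)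
    (hz : 0 < z) (hD : 28*z*z+4*z < D) (hn : 0 ≤ nc) (hn' : nc ≤ z + 1)
    (hC : 0 ≤ C) (hC' : C ≤ z * (z+1)) (hP : 0 ≤ P) (hP' : P ≤ z * D)
    (ha : 0 ≤ am) (ha' : am ≤ z) (hb : 0 ≤ bm) (hb' : bm ≤ z) (hg : 0 ≤ gm) (hg' : gm ≤ z)
    (hd : 0 ≤ dm) (hd' : dm ≤ z) (hS : 0 ≤ S) (hS' : S ≤ z * (gm + dm))
    (kP : 0 ≤ P') (kP' : P' ≤ z * D)
    (ka : 0 ≤ am') (ka' : am' ≤ z) (kb : 0 ≤ bm') (kb' : bm' ≤ z) (kg : 0 ≤ gm') (kg' : gm' ≤ z)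
    (kd : 0 ≤ dm') (kd' : dm' ≤ z) (kS : 0 ≤ S') (kS' : S' ≤ z * (gm' + dm'))
    (h : P - gm * D + nA * D^2 + nB * D^3 + (am + dm) * D^4 + (bm + gm) * D^5 + (am + bm) * D^6
      + (3*z*(am+bm+gm+dm) - S + z*nc + C) * D^7 + nc * D^8 =
      P' - gm' * D + nA * D^2 + nB * D^3 + (am' + dm') * D^4 + (bm' + gm') * D^5
      + (am' + bm') * D^6 + (3*z*(am'+bm'+gm'+dm') - S' + z*nc + C) * D^7 + nc * D^8) :
    am + bm = am' + bm' := by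
  have hzD : 14 * z < D := by nlinarith
  have hzz : (0:ℤ) ≤ z * z := by positivity
  have c7 := coef7 z am bm gm dm S nc C hz ha ha' hb hb' hg hg' hd hd' hS hS' hn hn' hC hC'
  have c7' := coef7 z am' bm' gm' dm' S' nc C hz ka ka' kb kb' kg kg' kd kd' kS kS' hn hn' hC hC'
  have l1 := (low_bound z D P gm hz hD hP hP' hg hg').2
  have l2 := (low_bound z D P' gm' hz hD kP kP' kg kg').2
  have := digits D ((P - gm * D) - (P' - gm' * D)) 0 0 (am + dm - (am' + dm'))
    (bm + gm - (bm' + gm')) (am + bm - (am' + bm'))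
    ((3*z*(am+bm+gm+dm) - S + z*nc + C) - (3*z*(am'+bm'+gm'+dm') - S' + z*nc + C)) 0
    (by
      refine lt_of_le_of_lt (abs_sub _ _) ?_
      nlinarith) (by rw [abs_zero]; linarith) (by rw [abs_zero]; linarith)
    (by apply absb <;> linarith) (by apply absb <;> linarith) (by apply absb <;> linarith)
    (by apply absb <;> linarith)
    (by linear_combination h)
  linarith [this.2.2.2.2.2.1]

lemma Ctx.sync1 (h : Ctx z D ι σ ρ) {μ : ℕ} (hμ : μ = 2 ∨ μ = 3) {t : ℕ}
    (h1 : FF z D ι σ ρ 1 t = t) (h2 : FF z D ι σ ρ μ t = t) : Sync1 z (eT z D ι σ) ρ μ t := by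
  rw [h.FF1] at h1
  have h2' := h.FF23 hμ t
  rw [h2] at h2'
  have h1' := congrArg (Nat.cast (R := ℤ)) h1
  simp only [Nat.cast_add, Nat.cast_mul, Nat.cast_pow, Nat.cast_ofNat] at h1'
  obtain ⟨e1, e2, e3, e4, e5, e6⟩ := arith1 z D _ _ _ _ _ _ _ _ _ _ _ _ _
    (by exact_mod_cast h.hz) (by exact_mod_cast h.Dz)
    (Int.natCast_nonneg _) (by exact_mod_cast h.part_le _ μ t)
    (Int.natCast_nonneg _) (by exact_mod_cast card_fn_le _ _ _)
    (Int.natCast_nonneg _) (by exact_mod_cast card_fn_le _ _ _)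
    (Int.natCast_nonneg _) (by exact_mod_cast card_fm_le _ _ _ _)
    (Int.natCast_nonneg _) (by exact_mod_cast card_fm_le _ _ _ _)
    (Int.natCast_nonneg _) (by exact_mod_cast card_fm_le _ _ _ _)
    (Int.natCast_nonneg _) (by exact_mod_cast card_fm_le _ _ _ _)
    (Int.natCast_nonneg _) (by exact_mod_cast card_fn_le _ _ _)
    (Int.natCast_nonneg _) (by exact_mod_cast card_fn_le _ _ _)
    (Int.natCast_nonneg _) (by exact_mod_cast on1_le _ _ _)
    (Int.natCast_nonneg _) (by exact_mod_cast SS_le _ _ _)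
    (Int.natCast_nonneg _) (by exact_mod_cast CC_le _ _) (h1'.trans h2')
  exact ⟨by exact_mod_cast e1, by exact_mod_cast e2, by exact_mod_cast e3, by exact_mod_cast e4,
    by exact_mod_cast e5, by exact_mod_cast e6⟩

lemma Ctx.sync4 (h : Ctx z D ι σ ρ) {μ : ℕ} (hμ : μ = 2 ∨ μ = 3) {t : ℕ}
    (h1 : FF z D ι σ ρ 4 t = t) (h2 : FF z D ι σ ρ μ t = t) : Sync4 z (eT z D ι σ) ρ μ t := by
  rw [h.FF4] at h1
  have h2' := h.FF23 hμ t
  rw [h2] at h2'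
  have h1' := congrArg (Nat.cast (R := ℤ)) h1
  have hz := h.hz
  have h41 : ((4 * z - 1 : ℕ) : ℤ) = 4 * z - 1 := by omega
  simp only [Nat.cast_add, Nat.cast_mul, Nat.cast_pow, Nat.cast_ofNat, h41] at h1'
  obtain ⟨e1, e2, e3, e4, e5, e6⟩ := arith4 z D _ _ _ _ _ _ _ _ _ _ _ _ _
    (by exact_mod_cast h.hz) (by exact_mod_cast h.Dz)
    (Int.natCast_nonneg _) (by exact_mod_cast h.part_le _ μ t)
    (Int.natCast_nonneg _) (by exact_mod_cast card_fn_le _ _ _)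
    (Int.natCast_nonneg _) (by exact_mod_cast card_fn_le _ _ _)
    (Int.natCast_nonneg _) (by exact_mod_cast card_fm_le _ _ _ _)
    (Int.natCast_nonneg _) (by exact_mod_cast card_fm_le _ _ _ _)
    (Int.natCast_nonneg _) (by exact_mod_cast card_fm_le _ _ _ _)
    (Int.natCast_nonneg _) (by exact_mod_cast card_fm_le _ _ _ _)
    (Int.natCast_nonneg _) (by exact_mod_cast card_fn_le _ _ _)
    (Int.natCast_nonneg _) (by exact_mod_cast card_fn_le _ _ _)
    (Int.natCast_nonneg _) (by exact_mod_cast on1_le _ _ _)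
    (Int.natCast_nonneg _) (by exact_mod_cast SS_le _ _ _)
    (Int.natCast_nonneg _) (by exact_mod_cast CC_le _ _) (h1'.trans h2')
  exact ⟨by exact_mod_cast e1, by exact_mod_cast e2, by exact_mod_cast e3, by exact_mod_cast e4,
    by exact_mod_cast e5, by exact_mod_cast e6⟩

lemma Ctx.syncc (h : Ctx z D ι σ ρ) (i : Fin (z+1)) :
    (fm (eT z D ι σ) ρ 2 .Ja (σ (.Jc i))).card + (fm (eT z D ι σ) ρ 2 .Jb (σ (.Jc i))).card =
    (fm (eT z D ι σ) ρ 3 .Ja (σ (.Jc i))).card + (fm (eT z D ι σ) ρ 3 .Jb (σ (.Jc i))).card := by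
  have f2 := h.noidle (.Jc i) (h.mb (Or.inl rfl) _ trivial)
  have f3 := h.noidle (.Jc i) (h.mb (Or.inr rfl) _ trivial)
  have g2 := h.FF23 (Or.inl rfl) (σ (.Jc i))
  have g3 := h.FF23 (Or.inr rfl) (σ (.Jc i))
  rw [f2] at g2
  rw [f3] at g3
  have := arithc z D _ _ _ _ _ _ _ _ _ _ _ _ _ _ _ _
    (by exact_mod_cast h.hz) (by exact_mod_cast h.Dz)
    (Int.natCast_nonneg _) (by exact_mod_cast card_fn_le _ _ _)
    (Int.natCast_nonneg _) (by exact_mod_cast CC_le _ _)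
    (Int.natCast_nonneg _) (by exact_mod_cast h.part_le _ 2 _)
    (Int.natCast_nonneg _) (by exact_mod_cast card_fm_le _ _ _ _)
    (Int.natCast_nonneg _) (by exact_mod_cast card_fm_le _ _ _ _)
    (Int.natCast_nonneg _) (by exact_mod_cast card_fm_le _ _ _ _)
    (Int.natCast_nonneg _) (by exact_mod_cast card_fm_le _ _ _ _)
    (Int.natCast_nonneg _) (by exact_mod_cast SS_le _ _ _)
    (Int.natCast_nonneg _) (by exact_mod_cast h.part_le _ 3 _)
    (Int.natCast_nonneg _) (by exact_mod_cast card_fm_le _ _ _ _)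
    (Int.natCast_nonneg _) (by exact_mod_cast card_fm_le _ _ _ _)
    (Int.natCast_nonneg _) (by exact_mod_cast card_fm_le _ _ _ _)
    (Int.natCast_nonneg _) (by exact_mod_cast card_fm_le _ _ _ _)
    (Int.natCast_nonneg _) (by exact_mod_cast SS_le _ _ _)
    (g2.symm.trans g3)
  exact_mod_cast this

lemma Ctx.syncA (h : Ctx z D ι σ ρ) (i : Fin (z+1)) {μ : ℕ} (hμ : μ = 2 ∨ μ = 3) :
    Sync1 z (eT z D ι σ) ρ μ (σ (.JA i)) :=
  h.sync1 hμ (h.noidle _ ((h.m1 _).2 trivial)) (h.noidle _ (h.mb hμ _ trivial))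

lemma Ctx.syncB (h : Ctx z D ι σ ρ) (i : Fin (z+1)) {μ : ℕ} (hμ : μ = 2 ∨ μ = 3) :
    Sync4 z (eT z D ι σ) ρ μ (σ (.JB i)) :=
  h.sync4 hμ (h.noidle _ ((h.m4 _).2 trivial)) (h.noidle _ (h.mb hμ _ trivial))

lemma Ctx.synca (h : Ctx z D ι σ ρ) (i : Fin z) {μ : ℕ} (hμ : μ = 2 ∨ μ = 3)
    (hi : μ ∈ ρ (.Ja i)) : Sync1 z (eT z D ι σ) ρ μ (σ (.Ja i)) :=
  h.sync1 hμ (h.noidle _ ((h.m1 _).2 trivial)) (h.noidle _ hi)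

lemma Ctx.syncb (h : Ctx z D ι σ ρ) (i : Fin z) {μ : ℕ} (hμ : μ = 2 ∨ μ = 3)
    (hi : μ ∈ ρ (.Jb i)) : Sync4 z (eT z D ι σ) ρ μ (σ (.Jb i)) :=
  h.sync4 hμ (h.noidle _ ((h.m4 _).2 trivial)) (h.noidle _ hi)
end

section
variable {z D : ℕ} {ι : Fin (3*z) → ℕ} {σ : Job z → ℕ} {ρ : Job z → Finset ℕ}

lemma fn_mono {k : ℕ} (e : Job z → ℕ) (f : Fin k → Job z) {t t' : ℕ} (h : t ≤ t') :
    fn e f t ⊆ fn e f t' := by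
  intro i; simp only [fn, Finset.mem_filter, Finset.mem_univ, true_and]; omega

lemma fm_mono {k : ℕ} (e : Job z → ℕ) (μ : ℕ) (f : Fin k → Job z) {t t' : ℕ} (h : t ≤ t') :
    fm e ρ μ f t ⊆ fm e ρ μ f t' := by
  intro i; simp only [fm, Finset.mem_filter, Finset.mem_univ, true_and]
  rintro ⟨a, b⟩; exact ⟨a, by omega⟩

lemma fnc {k : ℕ} (e : Job z → ℕ) (f : Fin k → Job z) {t t' : ℕ} (h : t ≤ t') :
    (fn e f t).card ≤ (fn e f t').card := Finset.card_le_card (fn_mono e f h)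

lemma fmc {k : ℕ} (e : Job z → ℕ) (μ : ℕ) (f : Fin k → Job z) {t t' : ℕ} (h : t ≤ t') :
    (fm e ρ μ f t).card ≤ (fm e ρ μ f t').card := Finset.card_le_card (fm_mono e μ f h)

lemma on1_mono (e : Job z → ℕ) (j : Job z) {t t' : ℕ} (h : t ≤ t') : on1 e j t ≤ on1 e j t' := by
  unfold on1; split <;> split <;> omega

lemma mem_fn {k : ℕ} {e : Job z → ℕ} {f : Fin k → Job z} {t : ℕ} {i : Fin k} :
    i ∈ fn e f t ↔ e (f i) ≤ t := by simp [fn]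

lemma mem_fm {k : ℕ} {e : Job z → ℕ} {μ : ℕ} {f : Fin k → Job z} {t : ℕ} {i : Fin k} :
    i ∈ fm e ρ μ f t ↔ μ ∈ ρ (f i) ∧ e (f i) ≤ t := by simp [fm]

lemma fn_lt {k : ℕ} {e : Job z → ℕ} {f : Fin k → Job z} {t t' : ℕ} (h : t ≤ t') (i : Fin k)
    (h1 : ¬ e (f i) ≤ t) (h2 : e (f i) ≤ t') : (fn e f t).card < (fn e f t').card := by
  apply Finset.card_lt_card
  refine ⟨fn_mono e f h, fun hs => h1 ?_⟩
  exact mem_fn.1 (hs (mem_fn.2 h2))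

lemma fm_lt {k : ℕ} {e : Job z → ℕ} {μ : ℕ} {f : Fin k → Job z} {t t' : ℕ} (h : t ≤ t')
    (i : Fin k) (h0 : μ ∈ ρ (f i))
    (h1 : ¬ e (f i) ≤ t) (h2 : e (f i) ≤ t') : (fm e ρ μ f t).card < (fm e ρ μ f t').card := by
  apply Finset.card_lt_card
  refine ⟨fm_mono e μ f h, fun hs => h1 ?_⟩
  exact (mem_fm.1 (hs (mem_fm.2 ⟨h0, h2⟩))).2

lemma fn_eq {k : ℕ} {e : Job z → ℕ} {f : Fin k → Job z} {t t' : ℕ} (h : t ≤ t')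
    (hc : (fn e f t).card = (fn e f t').card) : fn e f t = fn e f t' :=
  Finset.eq_of_subset_of_card_le (fn_mono e f h) hc.ge

lemma fm_of_fn {k : ℕ} {e : Job z → ℕ} {f : Fin k → Job z} {t t' : ℕ}
    (hc : fn e f t = fn e f t') (μ : ℕ) : fm e ρ μ f t = fm e ρ μ f t' := by
  ext i
  have := Finset.ext_iff.1 hc i
  rw [mem_fn, mem_fn] at this
  rw [mem_fm, mem_fm, this]

lemma Ctx.lt_e (h : Ctx z D ι σ ρ) (j : Job z) : σ j < eT z D ι σ j := by
  have := h.ppos j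
  unfold eT; omega

lemma Ctx.sepB (h : Ctx z D ι σ ρ) {j j0 : Job z} (h0 : BothM23 j0) (hj : BothM23 j ∨ OneM23 j)
    (hne : j ≠ j0) : eT z D ι σ j ≤ σ j0 ∨ eT z D ι σ j0 ≤ σ j := by
  rcases h.two_or_three hj with h' | h'
  · exact h.sep hne h' (h.mb (Or.inl rfl) _ h0)
  · exact h.sep hne h' (h.mb (Or.inr rfl) _ h0)

lemma Ctx.geB (h : Ctx z D ι σ ρ) {j j0 : Job z} (h0 : BothM23 j0) (hj : BothM23 j ∨ OneM23 j)
    (hn : ¬ eT z D ι σ j ≤ σ j0) : σ j0 ≤ σ j := by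
  by_cases hne : j = j0
  · rw [hne]
  · rcases h.sepB h0 hj hne with h' | h'
    · exact absurd h' hn
    · have := h.lt_e j0; omega

lemma Ctx.next (h : Ctx z D ι σ ρ) {k : ℕ} (f : Fin k → Job z) (j0 : Job z) (h0 : BothM23 j0)
    (hf : ∀ i, BothM23 (f i) ∨ OneM23 (f i)) (hc : (fn (eT z D ι σ) f (σ j0)).card < k) :
    ∃ i, σ j0 ≤ σ (f i) ∧ (fn (eT z D ι σ) f (σ (f i))).card = (fn (eT z D ι σ) f (σ j0)).card := by
  have hne : (Finset.univ.filter fun i => ¬ eT z D ι σ (f i) ≤ σ j0).Nonempty := by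
    by_contra hcon
    rw [Finset.not_nonempty_iff_eq_empty, Finset.filter_eq_empty_iff] at hcon
    have : fn (eT z D ι σ) f (σ j0) = Finset.univ := by
      ext i
      have := hcon (Finset.mem_univ i)
      simp only [not_not] at this
      simp [mem_fn, this]
    rw [this] at hc
    simp at hc
  obtain ⟨i, hi, hmin⟩ := Finset.exists_min_image _ (fun i => σ (f i)) hne
  simp only [Finset.mem_filter, Finset.mem_univ, true_and] at hi hmin
  have hle := h.geB h0 (hf i) hi
  refine ⟨i, hle, ?_⟩
  congr 1
  apply Finset.Subset.antisymm _ (fn_mono _ _ hle)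
  intro i' hi'
  rw [mem_fn] at hi' ⊢
  by_contra hcon
  have := hmin i' hcon
  have := h.lt_e (f i')
  omega

lemma Ctx.noBetween (h : Ctx z D ι σ ρ) (f g : Fin z → Job z) (j0 : Job z) (t1 ν : ℕ)
    (h0 : BothM23 j0) (hf : ∀ i, OneM23 (f i)) (hg : ∀ i, OneM23 (g i)) (hinj : Function.Injective f)
    (hfν : ∀ i, ν ∈ ρ (f i)) (ht : σ j0 ≤ t1)
    (Hf : ∀ i μ μ', (μ = 2 ∧ μ' = 3 ∨ μ = 3 ∧ μ' = 2) → μ ∈ ρ (f i) → σ j0 ≤ σ (f i) →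
      σ (f i) < t1 → (fn (eT z D ι σ) .Jc (σ (f i))).card = (fn (eT z D ι σ) .Jc (σ j0)).card ∧
        (fm (eT z D ι σ) ρ μ' f (σ (f i))).card = (fm (eT z D ι σ) ρ μ' f (σ j0)).card)
    (Hg : ∀ i, σ j0 ≤ σ (g i) → σ (g i) < t1 →
      (fn (eT z D ι σ) .Jc (σ j0)).card < (fn (eT z D ι σ) .Jc (σ (g i))).card)
    (hbal : (fm (eT z D ι σ) ρ 2 f (σ j0)).card + (fm (eT z D ι σ) ρ 2 g (σ j0)).card =
      (fm (eT z D ι σ) ρ 3 f (σ j0)).card + (fm (eT z D ι σ) ρ 3 g (σ j0)).card)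
    (hcbal : ∀ i, (fm (eT z D ι σ) ρ 2 f (σ (.Jc i))).card + (fm (eT z D ι σ) ρ 2 g (σ (.Jc i))).card =
      (fm (eT z D ι σ) ρ 3 f (σ (.Jc i))).card + (fm (eT z D ι σ) ρ 3 g (σ (.Jc i))).card)
    (hc : (fn (eT z D ι σ) .Jc (σ j0)).card < (fn (eT z D ι σ) .Jc t1).card) :
    (fn (eT z D ι σ) f t1).card = (fn (eT z D ι σ) f (σ j0)).card := by
  set e := eT z D ι σ with he
  obtain ⟨ic, hle, hceq⟩ := h.next .Jc j0 h0 (fun _ => Or.inl trivial)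
    (lt_of_lt_of_le hc (card_fn_le _ _ _))
  rw [← he] at hceq
  set tc := σ (.Jc ic) with htc
  have htc1 : tc < t1 := by
    by_contra hcon
    have := fnc e .Jc (show t1 ≤ tc by omega)
    omega
  have hgeq : fn e g (σ j0) = fn e g tc := by
    apply Finset.Subset.antisymm (fn_mono _ _ hle)
    intro i hi
    rw [mem_fn] at hi ⊢
    by_contra hcon
    have h1 := h.geB h0 (Or.inr (hg i)) hcon
    have h2 : σ (g i) < e (g i) := h.lt_e (g i)
    have h3 := Hg i h1 (by omega)
    have h4 := fnc e .Jc (show σ (g i) ≤ tc by omega)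
    omega
  have g2 := congrArg Finset.card (fm_of_fn (ρ := ρ) hgeq 2)
  have g3 := congrArg Finset.card (fm_of_fn (ρ := ρ) hgeq 3)
  have hb := hcbal ic
  rw [← htc] at hb
  have m2 := fmc (ρ := ρ) e 2 f hle
  have m3 := fmc (ρ := ρ) e 3 f hle
  have key : (fm e ρ 2 f tc).card = (fm e ρ 2 f (σ j0)).card := by
    by_contra hcon
    have l2 : (fm e ρ 2 f (σ j0)).card < (fm e ρ 2 f tc).card := by omega
    have l3 : (fm e ρ 3 f (σ j0)).card < (fm e ρ 3 f tc).card := by omega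
    obtain ⟨i2, hi2, hn2⟩ := Finset.exists_mem_notMem_of_card_lt_card l2
    obtain ⟨i3, hi3, hn3⟩ := Finset.exists_mem_notMem_of_card_lt_card l3
    rw [mem_fm] at hi2 hn2 hi3 hn3
    have n2 : ¬ e (f i2) ≤ σ j0 := fun hh => hn2 ⟨hi2.1, hh⟩
    have n3 : ¬ e (f i3) ≤ σ j0 := fun hh => hn3 ⟨hi3.1, hh⟩
    have s2 := h.geB h0 (Or.inr (hf i2)) n2
    have s3 := h.geB h0 (Or.inr (hf i3)) n3
    have q2 : σ (f i2) < e (f i2) := h.lt_e _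
    have q3 : σ (f i3) < e (f i3) := h.lt_e _
    have hne : i2 ≠ i3 := by
      rintro rfl
      exact (h.nf.2.2.2 _ (hf i2)).1 hi2.1 hi3.1
    rcases h.sep (fun hh => hne (hinj hh)) (hfν i2) (hfν i3) with hs | hs
    · have := (Hf i3 3 2 (Or.inr ⟨rfl, rfl⟩) hi3.1 s3 (by omega)).2
      have := fm_lt (ρ := ρ) s3 i2 hi2.1 n2 hs
      omega
    · have := (Hf i2 2 3 (Or.inl ⟨rfl, rfl⟩) hi2.1 s2 (by omega)).2
      have := fm_lt (ρ := ρ) s2 i3 hi3.1 n3 hs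
      omega
  have key3 : (fm e ρ 3 f tc).card = (fm e ρ 3 f (σ j0)).card := by omega
  have k1 := h.splitc e f hf tc
  have k2 := h.splitc e f hf (σ j0)
  have hfeq : fn e f (σ j0) = fn e f tc := fn_eq hle (by omega)
  congr 1
  apply Finset.Subset.antisymm _ (fn_mono _ _ ht)
  intro i hi
  by_contra hcon
  rw [mem_fn] at hi
  have hcon' := hcon
  rw [mem_fn] at hcon
  have h1 := h.geB h0 (Or.inr (hf i)) hcon
  have q : σ (f i) < e (f i) := h.lt_e _
  have hcc : (fn e .Jc (σ (f i))).card = (fn e .Jc (σ j0)).card := by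
    rcases h.two_or_three (Or.inr (hf i)) with hm | hm
    · exact (Hf i 2 3 (Or.inl ⟨rfl, rfl⟩) hm h1 (by omega)).1
    · exact (Hf i 3 2 (Or.inr ⟨rfl, rfl⟩) hm h1 (by omega)).1
  have hne : f i ≠ .Jc ic := by
    intro hh
    have := hf i
    rw [hh] at this
    exact this
  rcases h.sepB (j0 := .Jc ic) trivial (Or.inr (hf i)) hne with hs | hs
  · exact hcon' (hfeq ▸ mem_fn.2 hs)
  · have q' : tc < e (.Jc ic) := h.lt_e _
    have := fn_lt (e := e) (f := .Jc) h1 ic (by omega) hs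
    omega

lemma low_sum (s : Finset (Fin z)) : s.card * (s.card + 1) ≤ 2 * ∑ i ∈ s, (i.val + 1) := by
  induction s using Finset.induction_on_max with
  | empty => simp
  | insert a s hlt ih =>
    have hna : a ∉ s := fun hh => lt_irrefl _ (hlt a hh)
    rw [Finset.sum_insert hna, Finset.card_insert_of_notMem hna]
    have : s.card ≤ a.val := by
      have hsub : s ⊆ Finset.Iio a := fun x hx => Finset.mem_Iio.2 (hlt x hx)
      have := Finset.card_le_card hsub
      simpa using this
    nlinarith

lemma Ctx.Slow (h : Ctx z D ι σ ρ) (e : Job z → ℕ) (t : ℕ) :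
    (fn e .Jγ t).card * ((fn e .Jγ t).card + 1) + (fn e .Jδ t).card * ((fn e .Jδ t).card + 1) ≤
      2 * (SS e ρ 2 t + SS e ρ 3 t) := by
  have h1 := h.split e .Jγ (fun _ => trivial) t (fun i => i.val + 1)
  have h2 := h.split e .Jδ (fun _ => trivial) t (fun i => i.val + 1)
  have h3 := low_sum (fn e .Jγ t)
  have h4 := low_sum (fn e .Jδ t)
  unfold SS
  omega

lemma quad1 (r d m : ℕ) (h : r + d = 2 * m) (h2 : r * (r+1) + d * (d+1) ≤ 2 * (m * (m+1))) :
    r = m := by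
  zify at *
  have hd : (d:ℤ) = 2 * m - r := by linarith
  rw [hd] at h2
  have : ((r:ℤ) - m)^2 ≤ 0 := by nlinarith
  have : (r:ℤ) - m = 0 := by
    have := sq_nonneg ((r:ℤ) - m)
    exact pow_eq_zero_iff (two_ne_zero) |>.1 (by linarith)
  linarith

lemma quad2 (r d m : ℕ) (h : r + d = 2 * m) : 2 * (m * (m+1)) ≤ r * (r+1) + d * (d+1) := by
  zify at *
  have hd : (d:ℤ) = 2 * m - r := by linarith
  rw [hd]
  nlinarith [sq_nonneg ((r:ℤ) - m)]

structure KK (z : ℕ) (e : Job z → ℕ) (n t : ℕ) : Prop where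
  cA : (fn e .JA t).card = n
  cB : (fn e .JB t).card = n
  cc : (fn e .Jc t).card = n
  cβ : (fn e .Jβ t).card = n
  l2 : on1 e .Jl2 t = 0
  ca : (fn e .Ja t).card = n
  cb : (fn e .Jb t).card = n
  cg : (fn e .Jγ t).card = n
  cd : (fn e .Jδ t).card = n
  C : 2 * CC e t + n = n * n
  l1 : 1 ≤ n → on1 e .Jl1 t = 1

structure LL (z : ℕ) (e : Job z → ℕ) (n t : ℕ) : Prop where
  cA : (fn e .JA t).card = n
  cB : (fn e .JB t).card = n + 1
  cc : (fn e .Jc t).card = n + 1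
  cα : (fn e .Jα t).card = n
  l1 : on1 e .Jl1 t = 1
  ca : (fn e .Ja t).card = n
  cb : (fn e .Jb t).card = n
  cg : (fn e .Jγ t).card = n
  cd : (fn e .Jδ t).card = n
  C : 2 * CC e t = n * n + n

set_option maxHeartbeats 4000000 in
lemma Ctx.stepKL (h : Ctx z D ι σ ρ) (n : ℕ) (hn : n ≤ z) (ib : Fin (z+1))
    (K : KK z (eT z D ι σ) n (σ (.JB ib))) :
    ∃ ia, LL z (eT z D ι σ) n (σ (.JA ia)) ∧
      ∃ ic : Fin (z+1), ic.val = n ∧ σ (.Jc ic) = σ (.JB ib) + D^3 ∧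
        σ (.Jc ic) + pJob z D ι (.Jc ic) = σ (.JA ia) := by
  obtain ⟨ia, hle, hA⟩ := h.next .JA (.JB ib) trivial (fun _ => Or.inl trivial)
    (by rw [K.cA]; omega)
  set e := eT z D ι σ with he
  rw [K.cA] at hA
  have sB2 := h.syncB ib (Or.inl rfl)
  have sB3 := h.syncB ib (Or.inr rfl)
  have sA2 := h.syncA ia (Or.inl rfl)
  have sA3 := h.syncA ia (Or.inr rfl)
  rw [← he] at sB2 sB3 sA2 sA3
  have eB : σ (.JB ib) < e (.JB ib) := h.lt_e _
  have eBA : e (.JB ib) ≤ σ (.JA ia) := by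
    rcases h.sepB (j0 := .JB ib) (j := .JA ia) trivial (Or.inl trivial) (by simp) with hs | hs
    · have := h.lt_e (.JA ia); omega
    · exact hs
  have nB1 := fn_lt (e := e) (f := .JB) hle ib (by omega) eBA
  have K1 := K.cB
  have K2 := K.cc
  have K3 := K.cA
  have K4 := K.cβ
  have K5 := K.cb
  have K6 := K.ca
  have K7 := K.l2
  have a0 := h.splitc e .Ja (fun _ => trivial) (σ (.JB ib))
  have b0 := h.splitc e .Jb (fun _ => trivial) (σ (.JB ib))
  have g0 := h.splitc e .Jγ (fun _ => trivial) (σ (.JB ib))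
  have d0 := h.splitc e .Jδ (fun _ => trivial) (σ (.JB ib))
  have a1 := h.splitc e .Ja (fun _ => trivial) (σ (.JA ia))
  have b1 := h.splitc e .Jb (fun _ => trivial) (σ (.JA ia))
  have g1 := h.splitc e .Jγ (fun _ => trivial) (σ (.JA ia))
  have d1 := h.splitc e .Jδ (fun _ => trivial) (σ (.JA ia))
  have nbb : (fn e .Jb (σ (.JA ia))).card = (fn e .Jb (σ (.JB ib))).card := by
    apply h.noBetween .Jb .Ja (.JB ib) _ 4 trivial (fun _ => trivial) (fun _ => trivial)
      (fun _ _ hh => by simpa using hh) (fun i => (h.m4 _).2 trivial) hle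
    · intro i μ μ' hμ hi h1 h2
      rw [← he]
      have hμ2 : μ = 2 ∨ μ = 3 := by omega
      have s := h.syncb i hμ2 hi
      have sB := h.syncB ib hμ2
      rw [← he] at s sB
      have m1 := fnc e .JA h1
      have m2 := fnc e .JA h2.le
      have m3 := fnc e .Jβ h1
      have m4 := fmc (ρ := ρ) e μ .Ja h1
      have m5 := fmc (ρ := ρ) e μ .Jδ h1
      have m6 := h.splitc e .Jb (fun _ => trivial) (σ (.Jb i))
      have := s.hA
      have := s.hβ
      have := s.h4
      have := s.h6
      have := sB.h4
      have := sB.h6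
      refine ⟨by omega, ?_⟩
      rcases hμ with ⟨rfl, rfl⟩ | ⟨rfl, rfl⟩ <;> omega
    · intro i h1 h2
      rw [← he]
      have hB : e (.JB ib) ≤ σ (.Ja i) := by
        rcases h.sepB (j0 := .JB ib) (j := .Ja i) trivial (Or.inr trivial) (by simp) with hs | hs
        · have := h.lt_e (.Ja i); omega
        · exact hs
      have := fn_lt (e := e) (f := .JB) h1 ib (by omega) hB
      have hBc : (fn e .JB (σ (.Ja i))).card = (fn e .Jc (σ (.Ja i))).card := by
        rcases h.two_or_three (j := .Ja i) (Or.inr trivial) with hm | hm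
        · exact (h.synca i (Or.inl rfl) hm).hB
        · exact (h.synca i (Or.inr rfl) hm).hB
      omega
    · rw [← he]
      have := sB2.h6
      have := sB3.h6
      omega
    · intro i
      have := h.syncc i
      rw [← he] at this ⊢
      omega
    · rw [← he]
      have := sA2.hB
      omega
  have x1 := sA2.hB
  have x2 := sA2.hα
  have x3 := sA2.h4
  have x4 := sA2.h5
  have x5 := sA2.h6
  have y3 := sA3.h4
  have y4 := sA3.h5
  have y5 := sA3.h6
  have ol := on1_le e .Jl1 (σ (.JA ia))
  have hα : (fn e .Jα (σ (.JA ia))).card = n ∧ on1 e .Jl1 (σ (.JA ia)) = 1 := by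
    rcases Nat.lt_or_ge n z with hlt | hge
    · obtain ⟨i, hle2, hb⟩ := h.next .Jb (.JA ia) trivial (fun _ => Or.inr trivial)
        (by rw [← he, nbb, K.cb]; exact hlt)
      rw [← he] at hb
      have : (fn e .Jα (σ (.JA ia))).card ≤ n := by
        rcases h.two_or_three (j := .Jb i) (Or.inr trivial) with hm | hm
        · have s := (h.syncb i (Or.inl rfl) hm).h5
          rw [← he] at s
          have := fmc (ρ := ρ) e 2 .Jb hle2
          have := fmc (ρ := ρ) e 2 .Jγ hle2
          omega
        · have s := (h.syncb i (Or.inr rfl) hm).h5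
          rw [← he] at s
          have := fmc (ρ := ρ) e 3 .Jb hle2
          have := fmc (ρ := ρ) e 3 .Jγ hle2
          omega
      omega
    · have := card_fn_le e .JB (σ (.JA ia))
      have hz := h.hz
      have := K.l1 (by omega)
      have := on1_mono e .Jl1 hle
      omega
  obtain ⟨hα, hl⟩ := hα
  have ca : (fn e .Ja (σ (.JA ia))).card = n := by omega
  have cb : (fn e .Jb (σ (.JA ia))).card = n := by omega
  have cg : (fn e .Jγ (σ (.JA ia))).card = n := by omega
  have cd : (fn e .Jδ (σ (.JA ia))).card = n := by omega
  have cc : (fn e .Jc (σ (.JA ia))).card = n + 1 := by omega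
  have hSS : SS e ρ 2 (σ (.JB ib)) = SS e ρ 2 (σ (.JA ia)) := by
    unfold SS
    rw [fm_of_fn (fn_eq hle (by rw [K.cg, cg])) 2, fm_of_fn (fn_eq hle (by rw [K.cd, cd])) 2]
  have hC1 : CC e (σ (.JA ia)) = CC e (σ (.JB ib)) + n := by
    have := sB2.hS
    have := sA2.hS
    rw [K7] at *
    omega
  have KC := K.C
  refine ⟨ia, ⟨hA, by omega, cc, hα, hl, ca, cb, cg, cd, by omega⟩, ?_⟩
  obtain ⟨ic, hic, hins⟩ := Finset.exists_eq_insert_iff.2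
    ⟨fn_mono e .Jc hle, show (fn e .Jc (σ (.JB ib))).card + 1 = _ by omega⟩
  have hicn : ic.val = n := by
    unfold CC at hC1
    rw [← hins, Finset.sum_insert hic] at hC1
    omega
  have hmem : e (.Jc ic) ≤ σ (.JA ia) := by
    rw [← mem_fn (f := Job.Jc), ← hins]
    exact Finset.mem_insert_self _ _
  have hBc : e (.JB ib) ≤ σ (.Jc ic) := by
    rcases h.sepB (j0 := .JB ib) (j := .Jc ic) trivial (Or.inl trivial) (by simp) with hs | hs
    · exact absurd (mem_fn.2 hs) hic
    · exact hs
  have f1 := h.FF1 (σ (.JA ia))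
  have f4 := h.FF4 (σ (.JB ib))
  rw [h.noidle (.JA ia) ((h.m1 (.JA ia)).2 trivial), ← he, hA, ca, hα, hl] at f1
  rw [h.noidle (.JB ib) ((h.m4 (.JB ib)).2 trivial), ← he, K.cB, K.cb, K.cβ, K.l2] at f4
  have hdiff : σ (.JA ia) = σ (.JB ib) + D^3 + ((z + n) * D^7 + D^8) := by
    rw [f1, f4]
    obtain ⟨y, rfl⟩ : ∃ y, z = y + 1 := ⟨z - 1, by have := h.hz; omega⟩
    have : 4 * (y+1) - 1 = 4 * y + 3 := by omega
    rw [this]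
    ring
  have e1 : e (.Jc ic) = σ (.Jc ic) + ((z + n) * D^7 + D^8) := by
    rw [he, eT, pJob, hicn]
  have e2 : e (.JB ib) = σ (.JB ib) + D^3 := by rw [he, eT, pJob]
  refine ⟨ic, hicn, by omega, ?_⟩
  rw [pJob, hicn]
  omega

lemma CC_eq {e : Job z → ℕ} {t t' : ℕ} (h : t ≤ t')
    (hc : (fn e .Jc t).card = (fn e .Jc t').card) : CC e t = CC e t' := by
  unfold CC
  rw [fn_eq h hc]

set_option maxHeartbeats 4000000 in
lemma Ctx.stepLK (h : Ctx z D ι σ ρ) (n : ℕ) (hn : n < z) (ia : Fin (z+1))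
    (L : LL z (eT z D ι σ) n (σ (.JA ia))) :
    ∃ ib, KK z (eT z D ι σ) (n+1) (σ (.JB ib)) := by
  obtain ⟨ib, hle, hB⟩ := h.next .JB (.JA ia) trivial (fun _ => Or.inl trivial)
    (by rw [L.cB]; omega)
  set e := eT z D ι σ with he
  rw [L.cB] at hB
  refine ⟨ib, ?_⟩
  have sB2 := h.syncB ib (Or.inl rfl)
  have sB3 := h.syncB ib (Or.inr rfl)
  rw [← he] at sB2 sB3
  have eA : σ (.JA ia) < e (.JA ia) := h.lt_e _
  have eAB : e (.JA ia) ≤ σ (.JB ib) := by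
    rcases h.sepB (j0 := .JA ia) (j := .JB ib) trivial (Or.inl trivial) (by simp) with hs | hs
    · have := h.lt_e (.JB ib); omega
    · exact hs
  have nA1 := fn_lt (e := e) (f := .JA) hle ia (by omega) eAB
  have a1 := h.splitc e .Ja (fun _ => trivial) (σ (.JB ib))
  have b1 := h.splitc e .Jb (fun _ => trivial) (σ (.JB ib))
  have g1 := h.splitc e .Jγ (fun _ => trivial) (σ (.JB ib))
  have d1 := h.splitc e .Jδ (fun _ => trivial) (σ (.JB ib))
  have x1 := sB2.hA
  have x2 := sB2.hβ
  have x3 := sB2.h4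
  have x4 := sB2.h5
  have x5 := sB2.h6
  have y3 := sB3.h4
  have y4 := sB3.h5
  have y5 := sB3.h6
  have x6 := sB2.hS
  have y6 := sB3.hS
  have L1 := L.cA
  have L2 := L.cc
  have L3 := L.C
  have L4 := L.cB
  have L5 := L.l1
  have ol := on1_le e .Jl2 (σ (.JB ib))
  have ol1 := on1_le e .Jl1 (σ (.JB ib))
  have om1 := on1_mono e .Jl1 hle
  rcases Nat.lt_or_ge (n+1) (fn e .Jc (σ (.JB ib))).card with hlt | hge
  · exfalso
    have hcard : 1 < (fn e .JA (σ (.JB ib)) \ fn e .JA (σ (.JA ia))).card := by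
      have := Finset.card_sdiff_add_card_eq_card (fn_mono e .JA hle)
      omega
    obtain ⟨ia', hmem, hne⟩ := Finset.exists_mem_ne hcard ia
    rw [Finset.mem_sdiff, mem_fn, mem_fn] at hmem
    have t01 : e (.JA ia) ≤ σ (.JA ia') := by
      rcases h.sepB (j0 := .JA ia) (j := .JA ia') trivial (Or.inl trivial)
        (by simpa using hne) with hs | hs
      · exact absurd hs hmem.2
      · exact hs
    have eA' : σ (.JA ia') < e (.JA ia') := h.lt_e _
    have hle0 : σ (.JA ia) ≤ σ (.JA ia') := by omega
    have hle1 : σ (.JA ia') ≤ σ (.JB ib) := by omega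
    have nA' := fn_lt (e := e) (f := .JA) hle0 ia (by omega) t01
    have sA2 := h.syncA ia' (Or.inl rfl)
    have sA3 := h.syncA ia' (Or.inr rfl)
    rw [← he] at sA2 sA3
    have nB0 := fnc e .JB hle0
    have nB1 := fnc e .JB hle1
    have u1 := sA2.hB
    have u2 := sA2.hα
    have u3 := sA2.h4
    have u4 := sA2.h5
    have u5 := sA2.h6
    have u6 := sA2.hS
    have v3 := sA3.h4
    have v4 := sA3.h5
    have v5 := sA3.h6
    have v6 := sA3.hS
    have a0 := h.splitc e .Ja (fun _ => trivial) (σ (.JA ia'))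
    have b0 := h.splitc e .Jb (fun _ => trivial) (σ (.JA ia'))
    have g0 := h.splitc e .Jγ (fun _ => trivial) (σ (.JA ia'))
    have d0 := h.splitc e .Jδ (fun _ => trivial) (σ (.JA ia'))
    have om2 := on1_mono e .Jl1 hle0
    have om3 := on1_mono e .Jl1 hle1
    have hC := CC_eq hle0 (show (fn e .Jc (σ (.JA ia))).card = _ by omega)
    have hr : (fn e .Jδ (σ (.JA ia'))).card = n := by
      have hs := h.Slow e (σ (.JA ia'))
      apply quad1 _ (fn e .Jγ (σ (.JA ia'))).card n (by omega)
      have : n * (n+1) = n * n + n := by ring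
      omega
    have naa : (fn e .Ja (σ (.JB ib))).card = (fn e .Ja (σ (.JA ia'))).card := by
      apply h.noBetween .Ja .Jb (.JA ia') _ 1 trivial (fun _ => trivial) (fun _ => trivial)
        (fun _ _ hh => by simpa using hh) (fun i => (h.m1 _).2 trivial) hle1
      · intro i μ μ' hμ hi h1 h2
        rw [← he]
        have hμ2 : μ = 2 ∨ μ = 3 := by omega
        have s := h.synca i hμ2 hi
        have sA := h.syncA ia' hμ2
        rw [← he] at s sA
        have m1 := fnc e .JB h1
        have m2 := fnc e .JB h2.le
        have m3 := on1_mono e .Jl1 h1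
        have m7 := on1_mono e .Jl1 h2.le
        have m4 := fmc (ρ := ρ) e μ .Jb h1
        have m5 := fmc (ρ := ρ) e μ .Jγ h1
        have m6 := h.splitc e .Ja (fun _ => trivial) (σ (.Ja i))
        have := s.hB
        have := s.hα
        have := s.h5
        have := s.h6
        have := sA.h5
        have := sA.h6
        refine ⟨by omega, ?_⟩
        rcases hμ with ⟨rfl, rfl⟩ | ⟨rfl, rfl⟩ <;> omega
      · intro i h1 h2
        rw [← he]
        have hB : e (.JA ia') ≤ σ (.Jb i) := by
          rcases h.sepB (j0 := .JA ia') (j := .Jb i) trivial (Or.inr trivial) (by simp) with hs | hs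
          · have := h.lt_e (.Jb i); omega
          · exact hs
        have := fn_lt (e := e) (f := .JA) h1 ia' (by omega) hB
        have hBc : (fn e .JA (σ (.Jb i))).card = (fn e .Jc (σ (.Jb i))).card := by
          rcases h.two_or_three (j := .Jb i) (Or.inr trivial) with hm | hm
          · exact (h.syncb i (Or.inl rfl) hm).hA
          · exact (h.syncb i (Or.inr rfl) hm).hA
        omega
      · rw [← he]
        omega
      · intro i
        exact h.syncc i
      · rw [← he]
        omega
    obtain ⟨i, hle2, hb⟩ := h.next .Ja (.JB ib) trivial (fun _ => Or.inr trivial)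
      (by rw [← he]; omega)
    rw [← he] at hb
    rcases h.two_or_three (j := .Ja i) (Or.inr trivial) with hm | hm
    · have s := (h.synca i (Or.inl rfl) hm).h4
      rw [← he] at s
      have := fmc (ρ := ρ) e 2 .Ja hle2
      have := fmc (ρ := ρ) e 2 .Jδ hle2
      omega
    · have s := (h.synca i (Or.inr rfl) hm).h4
      rw [← he] at s
      have := fmc (ρ := ρ) e 3 .Ja hle2
      have := fmc (ρ := ρ) e 3 .Jδ hle2
      omega
  · have hcc : (fn e .Jc (σ (.JB ib))).card = n + 1 := by omega
    have hC := CC_eq hle (show (fn e .Jc (σ (.JA ia))).card = _ by omega)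
    have hs := h.Slow e (σ (.JB ib))
    have hnn : n * (n+1) = n * n + n := by ring
    have hnn1 : (n+1) * (n+1+1) = n * n + 3 * n + 2 := by ring
    have hnn2 : (n+1) * (n+1) = n * n + 2 * n + 1 := by ring
    have hl2 : on1 e .Jl2 (σ (.JB ib)) = 0 := by
      by_contra hcon
      have hl : on1 e .Jl2 (σ (.JB ib)) = 1 := by omega
      rw [hl] at x6 y6
      have := quad2 (fn e .Jγ (σ (.JB ib))).card (fn e .Jδ (σ (.JB ib))).card n (by omega)
      omega
    rw [hl2] at x6 y6
    have hr : (fn e .Jγ (σ (.JB ib))).card = n + 1 := by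
      apply quad1 _ (fn e .Jδ (σ (.JB ib))).card (n+1) (by omega)
      omega
    exact ⟨by omega, hB, hcc, by omega, hl2, by omega, by omega, hr, by omega, by omega,
      fun _ => by omega⟩

lemma Ctx.base (h : Ctx z D ι σ ρ) (ib : Fin (z+1)) (h0 : σ (.JB ib) = 0) :
    KK z (eT z D ι σ) 0 (σ (.JB ib)) := by
  rw [h0]
  have hpos : ∀ j, ¬ eT z D ι σ j ≤ 0 := fun j => by have := h.lt_e j; omega
  have hempty : ∀ (k : ℕ) (f : Fin k → Job z), fn (eT z D ι σ) f 0 = ∅ := by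
    intro k f; ext i; simp only [mem_fn, hpos]; simp
  constructor <;> simp [hempty, on1, hpos, CC]

lemma Ctx.main (h : Ctx z D ι σ ρ) (ib : Fin (z+1)) (h0 : σ (.JB ib) = 0) (n : ℕ) (hn : n ≤ z) :
    ∃ ib, KK z (eT z D ι σ) n (σ (.JB ib)) := by
  induction n with
  | zero => exact ⟨ib, h.base ib h0⟩
  | succ n ih =>
    obtain ⟨jb, K⟩ := ih (by omega)
    obtain ⟨ia, L, _⟩ := h.stepKL n (by omega) jb K
    exact h.stepLK n (by omega) ia L

lemma Ctx.enum (h : Ctx z D ι σ ρ) (F : Fin (z+1) → Job z) (hF : ∀ i, BothM23 (F i))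
    (E : Fin (z+1) → Job z) (hE : ∀ i, E i ∈ Finset.univ.image F) (hinj : Function.Injective E)
    (hmono : Monotone fun i => σ (E i)) (hFinj : Function.Injective F) (i m : Fin (z+1))
    (hc : (fn (eT z D ι σ) F (σ (F i))).card = m.val) : E m = F i := by
  have hsurj : ∀ k, ∃ l, E l = F k := by
    intro k
    have himg : Finset.univ.image E = Finset.univ.image F := by
      apply Finset.eq_of_subset_of_card_le
      · intro x hx
        obtain ⟨l, _, rfl⟩ := Finset.mem_image.1 hx
        exact hE l
      · rw [Finset.card_image_of_injective _ hinj, Finset.card_image_of_injective _ hFinj]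
    have : F k ∈ Finset.univ.image E := by
      rw [himg]; exact Finset.mem_image_of_mem _ (Finset.mem_univ k)
    obtain ⟨l, _, hl⟩ := Finset.mem_image.1 this
    exact ⟨l, hl⟩
  obtain ⟨l, hl⟩ := hsurj i
  suffices hml : m = l by rw [hml, hl]
  have hB : ∀ k, BothM23 (E k) := by
    intro k
    obtain ⟨x, _, hx⟩ := Finset.mem_image.1 (hE k)
    rw [← hx]; exact hF x
  have h1 : (fn (eT z D ι σ) F (σ (F i))).image F = (Finset.Iio l).image E := by
    ext x
    simp only [Finset.mem_image, mem_fn, Finset.mem_Iio]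
    constructor
    · rintro ⟨k, hk, rfl⟩
      obtain ⟨k', hk'⟩ := hsurj k
      refine ⟨k', ?_, hk'⟩
      by_contra hcon
      have := hmono (not_lt.1 hcon)
      simp only [hl, hk'] at this
      have := h.lt_e (F k)
      omega
    · rintro ⟨k, hk, rfl⟩
      obtain ⟨x, _, hx⟩ := Finset.mem_image.1 (hE k)
      refine ⟨x, ?_, hx⟩
      rw [hx, ← hl]
      rcases h.sepB (hB l) (Or.inl (hB k)) (fun hh => hk.ne (hinj hh)) with hs | hs
      · exact hs
      · have h5 := hmono hk.le
        have := h.lt_e (E l)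
        simp only at h5
        omega
  have h2 := congrArg Finset.card h1
  rw [Finset.card_image_of_injective _ hFinj, Finset.card_image_of_injective _ hinj, hc] at h2
  simp at h2
  exact Fin.ext h2
end

/-- For every `j ∈ {0,…,z}`, the job `c_j` is scheduled exactly in the gap between
`B_j` and `A_j`: `σ(c_j) = σ(B_j) + D³` and `σ(c_j) + p(c_j) = σ(A_j)`. -/
theorem c_jobs_in_gaps
    (z D : ℕ) (ι : Fin (3*z) → ℕ)
    (hz : 0 < z) (hDpos : 0 < D)
    (hιpos : ∀ i, 0 < ι i)
    (hsum : ∑ i, ι i = z * D)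
    (hlow : ∀ i, D < 4 * ι i)
    (hhigh : ∀ i, 2 * ι i < D)
    (hD : 4*z*(7*z+1) < D)
    (σ : Job z → ℕ) (ρ : Job z → Finset ℕ)
    (hfeas : Feasible 4 (pJob z D ι) (qJob z) σ ρ)
    (hmk : makespan (pJob z D ι) σ = Wval z D)
    (hnf : NormalForm ρ)
    (Aenum : Fin (z+1) → Job z)
    (hAmem : ∀ i, Aenum i ∈ sA z)
    (hAinj : Function.Injective Aenum)
    (hAmono : Monotone fun i => σ (Aenum i))
    (Benum : Fin (z+1) → Job z)
    (hBmem : ∀ i, Benum i ∈ sB z)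
    (hBinj : Function.Injective Benum)
    (hBmono : Monotone fun i => σ (Benum i))
    (hfirst : ∃ j ∈ sB z, 2 ∈ ρ j ∧ σ j = 0) :
    ∀ j : Fin (z+1),
      σ (Job.Jc j) = σ (Benum j) + D^3 ∧
      σ (Job.Jc j) + pJob z D ι (Job.Jc j) = σ (Aenum j) := by
  have h : Ctx z D ι σ ρ := ⟨hz, hsum, hιpos, hD, hfeas, hmk, hnf⟩
  intro j
  obtain ⟨jb, hjb, _, h0⟩ := hfirst
  obtain ⟨i0, _, rfl⟩ := Finset.mem_image.1 hjb
  obtain ⟨ib, K⟩ := h.main i0 h0 j.val (by have := j.isLt; omega)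
  obtain ⟨ia, L, ic, hic, h1, h2⟩ := h.stepKL j.val (by have := j.isLt; omega) ib K
  have hj : ic = j := Fin.ext hic
  subst hj
  have hA := h.enum .JA (fun _ => trivial) Aenum hAmem hAinj hAmono
    (fun _ _ hh => by simpa using hh) ia ic L.cA
  have hB := h.enum .JB (fun _ => trivial) Benum hBmem hBinj hBmono
    (fun _ _ hh => by simpa using hh) ib ic K.cB
  rw [hA, hB]
  exact ⟨h1, h2⟩
end

section
/- If the constructed instance admits a normal-form feasible schedule with makespan W in which the job processed on machine 2 with start time 0 belongs to B, then (i) the 3-Partition instance is a Yes-instance, and (ii) the constructed instance admits a feasible schedule with makespan W in which every job is assigned a contiguous (consecutive) set of machines. -/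
namespace NF

open Classical in
noncomputable def N {J : Type} [Fintype J] (e : J → ℕ) (P : J → Prop) (t : ℕ) : ℕ :=
  (Finset.univ.filter fun j => P j ∧ e j ≤ t).card

section core
variable {J : Type} [Fintype J] {e : J → ℕ}

lemma N_mono (P : J → Prop) {t t' : ℕ} (h : t ≤ t') : N e P t ≤ N e P t' := by
  unfold N
  apply Finset.card_le_card
  intro j; simp only [Finset.mem_filter, Finset.mem_univ, true_and]
  rintro ⟨h1, h2⟩; exact ⟨h1, h2.trans h⟩

lemma N_lt {P : J → Prop} {t t' : ℕ} {j : J} (hj : P j) (h : t < e j) (h' : e j ≤ t') :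
    N e P t < N e P t' := by
  unfold N
  apply Finset.card_lt_card
  rw [Finset.ssubset_iff_of_subset]
  · exact ⟨j, by simp [hj, h'], by simp [h]⟩
  · intro j; simp only [Finset.mem_filter, Finset.mem_univ, true_and]
    rintro ⟨h1, h2⟩; exact ⟨h1, by omega⟩

lemma N_ex {P : J → Prop} {t t' : ℕ} (h : N e P t < N e P t') :
    ∃ j, P j ∧ t < e j ∧ e j ≤ t' := by
  by_contra hc
  push Not at hc
  have : N e P t' ≤ N e P t := by
    unfold N
    apply Finset.card_le_card
    intro j; simp only [Finset.mem_filter, Finset.mem_univ, true_and]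
    rintro ⟨h1, h2⟩
    refine ⟨h1, ?_⟩
    by_contra h3
    have := hc j h1 (by omega)
    omega
  omega

lemma N_eq {P : J → Prop} {t t' : ℕ} (h : t ≤ t') (hn : ∀ j, P j → t < e j → e j ≤ t' → False) :
    N e P t' = N e P t := by
  have h1 := N_mono (e := e) P h
  by_contra h2
  obtain ⟨j, h3, h4, h5⟩ := N_ex (e := e) (P := P) (t := t) (t' := t') (by omega)
  exact hn j h3 h4 h5

structure Sys (s e : J → ℕ) (W : ℕ) (A B c a2 a3 b2 b3 g2 g3 d2 d3 l1 l2 : J → Prop) : Prop where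
  pos : ∀ j, s j < e j
  bd : ∀ j, e j ≤ W
  full : ∀ j j', (A j ∨ B j ∨ c j) → (A j' ∨ B j' ∨ c j' ∨ a2 j' ∨ a3 j' ∨ b2 j' ∨ b3 j') →
    j ≠ j' → e j ≤ s j' ∨ e j' ≤ s j
  ca : ∀ j j', (a2 j ∨ a3 j) → (a2 j' ∨ a3 j') → j ≠ j' → e j ≤ s j' ∨ e j' ≤ s j
  cb : ∀ j j', (b2 j ∨ b3 j) → (b2 j' ∨ b3 j') → j ≠ j' → e j ≤ s j' ∨ e j' ≤ s j
  dAB : ∀ j, A j → B j → False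
  da : ∀ j, a2 j → a3 j → False
  db : ∀ j, b2 j → b3 j → False
  dca : ∀ j, c j → (a2 j ∨ a3 j) → False
  dcb : ∀ j, c j → (b2 j ∨ b3 j) → False
  dAa : ∀ j, A j → (a2 j ∨ a3 j) → False
  dBb : ∀ j, B j → (b2 j ∨ b3 j) → False
  dAb : ∀ j, A j → (b2 j ∨ b3 j) → False
  dBa : ∀ j, B j → (a2 j ∨ a3 j) → False
  G12 : ∀ t, (t = W ∨ ∃ j, (A j ∨ a2 j) ∧ s j = t) →
    N e c t = N e B t ∧ N e B t = N e b2 t + N e g2 t + N e l1 t ∧ N e d2 t = N e a3 t ∧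
      N e b2 t = N e a3 t
  G13 : ∀ t, (t = W ∨ ∃ j, (A j ∨ a3 j) ∧ s j = t) →
    N e c t = N e B t ∧ N e B t = N e b3 t + N e g3 t + N e l1 t ∧ N e d3 t = N e a2 t ∧
      N e b3 t = N e a2 t
  G42 : ∀ t, (t = W ∨ ∃ j, (B j ∨ b2 j) ∧ s j = t) →
    N e c t = N e A t ∧ N e A t = N e a2 t + N e d2 t + N e l2 t ∧ N e g2 t = N e b3 t ∧
      N e a2 t = N e b3 t
  G43 : ∀ t, (t = W ∨ ∃ j, (B j ∨ b3 j) ∧ s j = t) →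
    N e c t = N e A t ∧ N e A t = N e a3 t + N e d3 t + N e l2 t ∧ N e g3 t = N e b2 t ∧
      N e a3 t = N e b2 t
  G23 : ∀ j, c j → N e a2 (s j) + N e b2 (s j) = N e a3 (s j) + N e b3 (s j)
  hl1 : ∀ t, N e l1 t ≤ 1
  hl2 : ∀ t, N e l2 t ≤ 1

variable {s : J → ℕ} {W : ℕ} {A B c a2 a3 b2 b3 g2 g3 d2 d3 l1 l2 : J → Prop}

lemma Sys.swap (S : Sys s e W A B c a2 a3 b2 b3 g2 g3 d2 d3 l1 l2) :
    Sys s e W B A c b2 b3 a2 a3 d2 d3 g2 g3 l2 l1 where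
  pos := S.pos
  bd := S.bd
  full := fun j j' h h' => S.full j j' (by tauto) (by tauto)
  ca := S.cb
  cb := S.ca
  dAB := fun j h h' => S.dAB j h' h
  da := S.db
  db := S.da
  dca := S.dcb
  dcb := S.dca
  dAa := S.dBb
  dBb := S.dAa
  dAb := S.dBa
  dBa := S.dAb
  G12 := S.G42
  G13 := S.G43
  G42 := S.G12
  G43 := S.G13
  G23 := fun j h => by have := S.G23 j h; omega
  hl1 := S.hl2
  hl2 := S.hl1

lemma Sys.after (S : Sys s e W A B c a2 a3 b2 b3 g2 g3 d2 d3 l1 l2) {x j : J}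
    (hx : A x ∨ B x ∨ c x) (hj : A j ∨ B j ∨ c j ∨ a2 j ∨ a3 j ∨ b2 j ∨ b3 j)
    (h : s x < e j) : s x ≤ s j := by
  by_cases hxj : x = j
  · rw [hxj]
  · have := S.full x j hx hj hxj
    have := S.pos x
    omega

/-- no B jobs between an A start and the next A/B start -/
lemma Sys.Bconst (S : Sys s e W A B c a2 a3 b2 b3 g2 g3 d2 d3 l1 l2) {x : J} (hx : A x) {t' : ℕ}
    (hle : s x ≤ t') (hno : ∀ j, (A j ∨ B j) → s x < s j → s j < t' → False) :
    N e B t' = N e B (s x) := by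
  apply N_eq hle
  intro j hj h1 h2
  have h3 := S.after (Or.inl hx) (Or.inr (Or.inl hj)) h1
  have h4 := S.pos j
  have h6 := S.pos x
  rcases h3.lt_or_eq with h5 | h5
  · exact hno j (Or.inr hj) h5 (by omega)
  · by_cases hxj : x = j
    · subst hxj; exact S.dAB _ hx hj
    · have := S.full x j (Or.inl hx) (Or.inr (Or.inl hj)) hxj
      omega

lemma Sys.AA (S : Sys s e W A B c a2 a3 b2 b3 g2 g3 d2 d3 l1 l2) {x : J} (hx : A x) {t' : ℕ}
    (hle : s x ≤ t') (hno : ∀ j, (A j ∨ B j) → s x < s j → s j < t' → False)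
    (ht : t' = W ∨ ∃ j, A j ∧ s j = t') :
    N e a2 t' + N e a3 t' = N e a2 (s x) + N e a3 (s x) := by
  have h0 := S.Bconst hx hle hno
  have h1 := S.G12 (s x) (Or.inr ⟨x, Or.inl hx, rfl⟩)
  have h2 := S.G13 (s x) (Or.inr ⟨x, Or.inl hx, rfl⟩)
  have h3 := S.G12 t' (ht.imp id (fun ⟨j, h, h'⟩ => ⟨j, Or.inl h, h'⟩))
  have h4 := S.G13 t' (ht.imp id (fun ⟨j, h, h'⟩ => ⟨j, Or.inl h, h'⟩))
  have m1 := N_mono (e := e) b2 hle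
  have m2 := N_mono (e := e) b3 hle
  have m3 := N_mono (e := e) g2 hle
  have m4 := N_mono (e := e) g3 hle
  have m5 := N_mono (e := e) l1 hle
  omega

lemma Sys.H1 (S : Sys s e W A B c a2 a3 b2 b3 g2 g3 d2 d3 l1 l2) {x : J} (hx : A x) {t' : ℕ}
    (hle : s x ≤ t') (hB : N e B t' = N e B (s x)) :
    N e a2 t' = N e a2 (s x) ∨ N e a3 t' = N e a3 (s x) := by
  by_contra hc
  push Not at hc
  obtain ⟨j2, p2, q2, r2⟩ := N_ex (e := e) (P := a2) (t := s x) (t' := t')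
    (by have := N_mono (e := e) a2 hle; omega)
  obtain ⟨j3, p3, q3, r3⟩ := N_ex (e := e) (P := a3) (t := s x) (t' := t')
    (by have := N_mono (e := e) a3 hle; omega)
  have hne : j2 ≠ j3 := by rintro rfl; exact S.da _ p2 p3
  have k2 := S.after (j := j2) (Or.inl hx) (by tauto) q2
  have k3 := S.after (j := j3) (Or.inl hx) (by tauto) q3
  have w2 := S.pos j2
  have w3 := S.pos j3
  have e1 := S.G12 (s x) (Or.inr ⟨x, Or.inl hx, rfl⟩)
  have e2 := S.G13 (s x) (Or.inr ⟨x, Or.inl hx, rfl⟩)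
  rcases S.ca j2 j3 (Or.inl p2) (Or.inr p3) hne with h | h
  · have e3 := S.G13 (s j3) (Or.inr ⟨j3, Or.inr p3, rfl⟩)
    have := N_lt (e := e) p2 q2 h
    have m1 := N_mono (e := e) b3 k3
    have m2 := N_mono (e := e) g3 k3
    have m3 := N_mono (e := e) l1 k3
    have m4 := N_mono (e := e) B k3
    have m5 := N_mono (e := e) B (show s j3 ≤ t' by omega)
    omega
  · have e3 := S.G12 (s j2) (Or.inr ⟨j2, Or.inr p2, rfl⟩)
    have := N_lt (e := e) p3 q3 h
    have m1 := N_mono (e := e) b2 k2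
    have m2 := N_mono (e := e) g2 k2
    have m3 := N_mono (e := e) l1 k2
    have m4 := N_mono (e := e) B k2
    have m5 := N_mono (e := e) B (show s j2 ≤ t' by omega)
    omega

lemma Sys.H2 (S : Sys s e W A B c a2 a3 b2 b3 g2 g3 d2 d3 l1 l2) {x w : J} (hx : A x) (hw : B w)
    (hle : s x ≤ s w) (hno : ∀ j, (A j ∨ B j) → s x < s j → s j < s w → False)
    (hB : N e B (s w) = N e B (s x)) (hc : N e c (s w) ≠ N e c (s x)) :
    N e a2 (s w) + N e a3 (s x) = N e a3 (s w) + N e a2 (s x) := by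
  obtain ⟨y, py, qy, ry⟩ := N_ex (e := e) (P := c) (t := s x) (t' := s w)
    (by have := N_mono (e := e) c hle; omega)
  have ky := S.after (j := y) (Or.inl hx) (by tauto) qy
  have wy := S.pos y
  have e1 := S.G12 (s x) (Or.inr ⟨x, Or.inl hx, rfl⟩)
  have e2 := S.G13 (s x) (Or.inr ⟨x, Or.inl hx, rfl⟩)
  have e3 := S.G42 (s w) (Or.inr ⟨w, Or.inl hw, rfl⟩)
  have key : ∀ j, (a2 j ∨ a3 j) → s y < e j → e j ≤ s w → False := by
    intro j hj h1 h2
    have hne : y ≠ j := by rintro rfl; exact S.dca _ py hj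
    rcases S.full y j (by tauto) (by tauto) hne with h | h
    · have g : N e c (s j) = N e B (s j) := by
        rcases hj with hj | hj
        · exact (S.G12 (s j) (Or.inr ⟨j, Or.inr hj, rfl⟩)).1
        · exact (S.G13 (s j) (Or.inr ⟨j, Or.inr hj, rfl⟩)).1
      have := N_lt (e := e) py qy h
      have := S.pos j
      have m5 := N_mono (e := e) B (show s j ≤ s w by omega)
      omega
    · omega
  have keyb : ∀ j, (b2 j ∨ b3 j) → s x < e j → e j ≤ s y → False := by
    intro j hj h1 h2
    have kj := S.after (j := j) (Or.inl hx) (by tauto) h1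
    have pj := S.pos j
    have hne : x ≠ j := by rintro rfl; exact S.dAb _ hx hj
    have hxj : e x ≤ s j := by
      have := S.full x j (Or.inl hx) (by tauto) hne
      omega
    have g : N e c (s j) = N e A (s j) := by
      rcases hj with hj | hj
      · exact (S.G42 (s j) (Or.inr ⟨j, Or.inr hj, rfl⟩)).1
      · exact (S.G43 (s j) (Or.inr ⟨j, Or.inr hj, rfl⟩)).1
    have hA : N e A (s w) = N e A (s j) := by
      apply N_eq (by omega)
      intro v hv v1 v2
      have kv := S.after (j := v) (Or.inl hx) (by tauto) (by omega)
      have pv := S.pos v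
      rcases kv.lt_or_eq with h5 | h5
      · exact hno v (Or.inl hv) h5 (by omega)
      · by_cases hxv : x = v
        · subst hxv; omega
        · have := S.full x v (Or.inl hx) (by tauto) hxv
          have := S.pos x
          omega
    have := N_lt (e := e) (t := s j) py (by omega) ry
    omega
  have r1 := N_eq (e := e) (P := a2) (show s y ≤ s w by omega) (fun j h => key j (Or.inl h))
  have r2 := N_eq (e := e) (P := a3) (show s y ≤ s w by omega) (fun j h => key j (Or.inr h))
  have r3 := N_eq (e := e) (P := b2) ky (fun j h => keyb j (Or.inl h))
  have r4 := N_eq (e := e) (P := b3) ky (fun j h => keyb j (Or.inr h))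
  have := S.G23 y py
  omega

lemma Sys.AB (S : Sys s e W A B c a2 a3 b2 b3 g2 g3 d2 d3 l1 l2) {x w : J} (hx : A x) (hw : B w)
    (hle : s x ≤ s w) (hno : ∀ j, (A j ∨ B j) → s x < s j → s j < s w → False) :
    N e a2 (s w) + N e a3 (s w) ≤ N e a2 (s x) + N e a3 (s x) + 1 ∧
    (N e a2 (s x) + N e a3 (s x) < N e a2 (s w) + N e a3 (s w) → N e A (s w) = N e B (s w)) := by
  have hB := S.Bconst hx hle hno
  have h1 := S.H1 hx hle hB
  have h2 := S.H2 hx hw hle hno hB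
  have e1 := S.G12 (s x) (Or.inr ⟨x, Or.inl hx, rfl⟩)
  have e2 := S.G13 (s x) (Or.inr ⟨x, Or.inl hx, rfl⟩)
  have e3 := S.G42 (s w) (Or.inr ⟨w, Or.inl hw, rfl⟩)
  have e4 := S.G43 (s w) (Or.inr ⟨w, Or.inl hw, rfl⟩)
  have m1 := N_mono (e := e) g2 hle
  have m2 := N_mono (e := e) g3 hle
  have m3 := N_mono (e := e) d2 hle
  have m4 := N_mono (e := e) d3 hle
  have m5 := N_mono (e := e) a2 hle
  have m6 := N_mono (e := e) a3 hle
  have m7 := S.hl1 (s x)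
  have m8 := S.hl2 (s w)
  by_cases hc : N e c (s w) = N e c (s x)
  · omega
  · have := h2 hc
    omega

lemma Sys.eqab (S : Sys s e W A B c a2 a3 b2 b3 g2 g3 d2 d3 l1 l2) {t : ℕ}
    (ht : t = W ∨ ∃ j, (A j ∨ B j) ∧ s j = t) :
    N e a2 t + N e a3 t = N e b2 t + N e b3 t := by
  rcases ht with ht | ⟨j, hj | hj, ht⟩
  · have := S.G12 t (Or.inl ht)
    have := S.G13 t (Or.inl ht)
    omega
  · have := S.G12 t (Or.inr ⟨j, Or.inl hj, ht⟩)
    have := S.G13 t (Or.inr ⟨j, Or.inl hj, ht⟩)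
    omega
  · have := S.G42 t (Or.inr ⟨j, Or.inl hj, ht⟩)
    have := S.G43 t (Or.inr ⟨j, Or.inl hj, ht⟩)
    omega

lemma Sys.interval (S : Sys s e W A B c a2 a3 b2 b3 g2 g3 d2 d3 l1 l2)
    {x0 : J} (hx0 : B x0) (hs0 : s x0 = 0) {x : J} (hx : a2 x ∨ a3 x) :
    ∃ t0 w, t0 ≤ s x ∧ e x ≤ s w ∧ (A w ∨ B w) ∧
      N e a2 (s w) + N e a3 (s w) ≤ N e a2 t0 + N e a3 t0 + 1 ∧
      N e A (s w) = N e B (s w) ∧ N e A (s x) = N e A (s w) ∧ N e B (s x) = N e B (s w) := by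
  classical
  -- t0
  obtain ⟨y, hy, hymax⟩ := Finset.exists_max_image
    (Finset.univ.filter fun j => (A j ∨ B j) ∧ s j ≤ s x) s ⟨x0, by simp [hx0, hs0]⟩
  simp only [Finset.mem_filter, Finset.mem_univ, true_and] at hy hymax
  obtain ⟨hyAB, hyle⟩ := hy
  have hpx := S.pos x
  have hcx : ∀ j, (A j ∨ B j) → e j ≤ s x ∨ e x ≤ s j := by
    intro j hj
    apply S.full j x (by tauto) (by tauto)
    rintro rfl
    rcases hj with h | h
    · exact S.dAa _ h hx
    · exact S.dBa _ h hx
  have strict : ∀ t t', t < e x → e x ≤ t' →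
      N e a2 t + N e a3 t < N e a2 t' + N e a3 t' := by
    intro t t' h h'
    have m5 := N_mono (e := e) a2 (show t ≤ t' by omega)
    have m6 := N_mono (e := e) a3 (show t ≤ t' by omega)
    rcases hx with hx | hx
    · have := N_lt (e := e) hx h h'; omega
    · have := N_lt (e := e) hx h h'; omega
  by_cases hex : ∃ j, (A j ∨ B j) ∧ s x < s j
  · obtain ⟨w, hw, hwmin⟩ := Finset.exists_min_image
      (Finset.univ.filter fun j => (A j ∨ B j) ∧ s x < s j) s
      (by obtain ⟨j, hj⟩ := hex; exact ⟨j, by simpa using hj⟩)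
    simp only [Finset.mem_filter, Finset.mem_univ, true_and] at hw hwmin
    obtain ⟨hwAB, hwlt⟩ := hw
    have hpw := S.pos w
    have hxw : e x ≤ s w := by have := hcx w hwAB; omega
    have hle : s y ≤ s w := by omega
    have hno : ∀ j, (A j ∨ B j) → s y < s j → s j < s w → False := by
      intro j hj h1 h2
      by_cases h3 : s j ≤ s x
      · have := hymax j ⟨hj, h3⟩; omega
      · have := hwmin j ⟨hj, by omega⟩; omega
    have hAB : ∀ j, (A j ∨ B j) → s x < e j → e j ≤ s w → False := by
      intro j hj h1 h2
      have := hcx j hj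
      have := S.pos j
      exact hno j hj (by omega) (by omega)
    have hst := strict (s y) (s w) (by omega) hxw
    have hq1 := S.eqab (t := s y) (Or.inr ⟨y, hyAB, rfl⟩)
    have hq2 := S.eqab (t := s w) (Or.inr ⟨w, hwAB, rfl⟩)
    have f1 := N_eq (e := e) (P := A) (show s x ≤ s w by omega) (fun j h => hAB j (Or.inl h))
    have f2 := N_eq (e := e) (P := B) (show s x ≤ s w by omega) (fun j h => hAB j (Or.inr h))
    refine ⟨s y, w, hyle, hxw, hwAB, ?_, ?_, f1.symm, f2.symm⟩ <;>
    · rcases hyAB with hA | hB <;> rcases hwAB with hA' | hB'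
      · have := S.AA hA hle hno (Or.inr ⟨w, hA', rfl⟩); omega
      · have := S.AB hA hB' hle hno; omega
      · have := S.swap.AB hB hA' hle (fun j h => hno j h.symm); omega
      · have := S.swap.AA hB hle (fun j h => hno j h.symm) (Or.inr ⟨w, hB', rfl⟩); omega
  · exfalso
    have hle : s y ≤ W := by have := S.bd x; omega
    have hno : ∀ j, (A j ∨ B j) → s y < s j → s j < W → False := by
      intro j hj h1 h2
      by_cases h3 : s j ≤ s x
      · have := hymax j ⟨hj, h3⟩; omega
      · exact hex ⟨j, hj, by omega⟩
    have hst := strict (s y) W (by omega) (S.bd x)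
    have hq1 := S.eqab (t := s y) (Or.inr ⟨y, hyAB, rfl⟩)
    have hq2 := S.eqab (t := W) (Or.inl rfl)
    rcases hyAB with hA | hB
    · have := S.AA hA hle hno (Or.inl rfl); omega
    · have := S.swap.AA hB hle (fun j h => hno j h.symm) (Or.inl rfl); omega

lemma Sys.rangeB (S : Sys s e W A B c a2 a3 b2 b3 g2 g3 d2 d3 l1 l2)
    {x0 : J} (hx0 : B x0) (hs0 : s x0 = 0) {z : ℕ} (hA : N e A W = z + 1) (hB : N e B W = z + 1)
    {x : J} (hx : a2 x ∨ a3 x) : 1 ≤ N e B (s x) ∧ N e B (s x) ≤ z := by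
  constructor
  · have hpx := S.pos x
    have hpx0 := S.pos x0
    have := S.full x0 x (by tauto) (by tauto) (by rintro rfl; exact S.dBa _ hx0 hx)
    have := N_lt (e := e) hx0 hpx0 (show e x0 ≤ s x by omega)
    omega
  · obtain ⟨t0, w, h1, h2, h3, h4, h5, h6, h7⟩ := S.interval hx0 hs0 hx
    rcases h3 with h3 | h3
    · have := N_lt (e := e) h3 (S.pos w) (S.bd w); omega
    · have := N_lt (e := e) h3 (S.pos w) (S.bd w); omega

lemma Sys.inj (S : Sys s e W A B c a2 a3 b2 b3 g2 g3 d2 d3 l1 l2)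
    {x0 : J} (hx0 : B x0) (hs0 : s x0 = 0) {x y : J} (hx : a2 x ∨ a3 x) (hy : a2 y ∨ a3 y)
    (hne : x ≠ y) (heq : N e B (s x) = N e B (s y)) : False := by
  wlog hxy : e x ≤ s y generalizing x y
  · exact this hy hx hne.symm heq.symm (by have := S.ca x y hx hy hne; omega)
  obtain ⟨t0, w, h1, h2, h3, h4, h5, h6, h7⟩ := S.interval hx0 hs0 hx
  obtain ⟨t0', w', h1', h2', h3', h4', h5', h6', h7'⟩ := S.interval hx0 hs0 hy
  have px := S.pos x
  have py := S.pos y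
  have pw := S.pos w
  have hyw : e y ≤ s w := by
    have hwy : w ≠ y := by
      rintro rfl
      rcases h3 with h | h
      · exact S.dAa _ h hy
      · exact S.dBa _ h hy
    rcases S.full w y (by tauto) (by tauto) hwy with h | h
    · exfalso
      rcases h3 with h3 | h3
      · have := N_lt (e := e) (t := s x) h3 (by omega) h; omega
      · have := N_lt (e := e) (t := s x) h3 (by omega) h; omega
    · exact h
  have m1 := N_mono (e := e) a2 (show t0 ≤ s y by omega)
  have m2 := N_mono (e := e) a3 (show t0 ≤ s y by omega)
  have m3 := N_mono (e := e) a2 (show s y ≤ s w by omega)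
  have m4 := N_mono (e := e) a3 (show s y ≤ s w by omega)
  rcases hx with hx | hx <;> rcases hy with hy | hy
  all_goals
    have i1 := N_lt (e := e) (t := t0) hx (by omega) hxy
    have i2 := N_lt (e := e) (t := s y) hy (by omega) hyw
    omega

end core

section core2
variable {J : Type} [Fintype J] {e : J → ℕ}
variable {s : J → ℕ} {W : ℕ} {A B c a2 a3 b2 b3 g2 g3 d2 d3 l1 l2 : J → Prop}

lemma Sys.count (S : Sys s e W A B c a2 a3 b2 b3 g2 g3 d2 d3 l1 l2)
    {x0 : J} (hx0 : B x0) (hs0 : s x0 = 0) {z : ℕ} (hA : N e A W = z + 1) (hB : N e B W = z + 1)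
    (ha : N e a2 W + N e a3 W = z) {f : J} (hf : B f) :
    N e a2 (s f) + N e a3 (s f) = N e B (s f) := by
  classical
  have hsum : ∀ t, N e a2 t + N e a3 t =
      (Finset.univ.filter fun j => (a2 j ∨ a3 j) ∧ e j ≤ t).card := by
    intro t
    unfold N
    rw [← Finset.card_union_of_disjoint]
    · congr 1; ext j
      simp only [Finset.mem_union, Finset.mem_filter, Finset.mem_univ, true_and]; tauto
    · rw [Finset.disjoint_left]
      intro j
      simp only [Finset.mem_filter, Finset.mem_univ, true_and]
      intro h1 h2
      exact S.da j h1.1 h2.1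
  have hW : (Finset.univ.filter fun j => (a2 j ∨ a3 j)).card = z := by
    rw [← ha, hsum]
    congr 1; ext j
    simp [S.bd j]
  have hinj : Set.InjOn (fun j => N e B (s j)) (Finset.univ.filter fun j => (a2 j ∨ a3 j) : Finset J) := by
    intro x hx y hy hxy
    simp only [Finset.coe_filter, Finset.mem_univ, true_and, Set.mem_ofPred_eq] at hx hy
    by_contra hne
    exact S.inj hx0 hs0 hx hy hne hxy
  have himg : (Finset.univ.filter fun j => (a2 j ∨ a3 j)).image (fun j => N e B (s j))
      = Finset.Icc 1 z := by
    apply Finset.eq_of_subset_of_card_le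
    · intro m hm
      simp only [Finset.mem_image, Finset.mem_filter, Finset.mem_univ, true_and] at hm
      obtain ⟨j, hj, rfl⟩ := hm
      exact Finset.mem_Icc.2 (S.rangeB hx0 hs0 hA hB hj)
    · rw [Finset.card_image_of_injOn hinj, hW]; simp
  have hM : N e B (s f) ≤ z := by
    have := N_lt (e := e) hf (S.pos f) (S.bd f); omega
  rw [hsum]
  have hmem : ∀ j, (a2 j ∨ a3 j) → (e j ≤ s f ↔ N e B (s j) ≤ N e B (s f)) := by
    intro j hj
    have pj := S.pos j
    constructor
    · intro h; exact N_mono B (by omega)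
    · intro h
      rcases S.full f j (by tauto) (by tauto) (by rintro rfl; exact S.dBa _ hf hj) with h' | h'
      · have := N_lt (e := e) hf (S.pos f) h'; omega
      · exact h'
  have hset : (Finset.univ.filter fun j => (a2 j ∨ a3 j) ∧ e j ≤ s f) =
      (Finset.univ.filter fun j => (a2 j ∨ a3 j)).filter
        (fun j => N e B (s j) ≤ N e B (s f)) := by
    ext j
    simp only [Finset.mem_filter, Finset.mem_univ, true_and]
    constructor
    · rintro ⟨h1, h2⟩; exact ⟨h1, (hmem j h1).1 h2⟩
    · rintro ⟨h1, h2⟩; exact ⟨h1, (hmem j h1).2 h2⟩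
  rw [hset, ← Finset.card_image_of_injOn (f := fun j => N e B (s j))
    (hinj.mono (by intro j; simp only [Finset.coe_filter, Finset.mem_filter, Finset.mem_univ,
      true_and, Set.mem_ofPred_eq]; tauto))]
  have : ((Finset.univ.filter fun j => (a2 j ∨ a3 j)).filter
        (fun j => N e B (s j) ≤ N e B (s f))).image (fun j => N e B (s j))
      = Finset.Icc 1 (N e B (s f)) := by
    ext m
    have hm : m ∈ (Finset.univ.filter fun j => (a2 j ∨ a3 j)).image (fun j => N e B (s j)) ↔
      m ∈ Finset.Icc 1 z := by rw [himg]
    simp only [Finset.mem_image, Finset.mem_filter, Finset.mem_univ, true_and,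
      Finset.mem_Icc] at hm ⊢
    constructor
    · rintro ⟨j, ⟨h1, h2⟩, rfl⟩
      have := hm.1 ⟨j, h1, rfl⟩
      omega
    · rintro ⟨h1, h2⟩
      obtain ⟨j, hj, rfl⟩ := hm.2 ⟨h1, by omega⟩
      exact ⟨j, ⟨hj, h2⟩, rfl⟩
  rw [this]; simp

lemma sum_le_of_disjoint (S : Finset J) (s p : J → ℕ) (lo hi : ℕ)
    (hdis : ∀ j ∈ S, ∀ j' ∈ S, j ≠ j' → s j + p j ≤ s j' ∨ s j' + p j' ≤ s j)
    (hlo : ∀ j ∈ S, lo ≤ s j) (hhi : ∀ j ∈ S, s j + p j ≤ hi) :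
    ∑ j ∈ S, p j ≤ hi - lo := by
  classical
  have h1 : ∑ j ∈ S, p j = (S.biUnion fun j => Finset.Ico (s j) (s j + p j)).card := by
    rw [Finset.card_biUnion]
    · simp
    · intro j hj j' hj' hne
      rw [Function.onFun, Finset.disjoint_left]
      intro a ha ha'
      simp only [Finset.mem_Ico] at ha ha'
      have := hdis j hj j' hj' hne
      omega
  rw [h1, ← Nat.card_Ico]
  apply Finset.card_le_card
  intro a
  simp only [Finset.mem_biUnion, Finset.mem_Ico]
  rintro ⟨j, hj, h⟩
  have := hlo j hj
  have := hhi j hj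
  omega

lemma good_of_mem (S : Finset J) (s p : J → ℕ) (W : ℕ) (hp : ∀ j, 0 < p j)
    (hdis : ∀ j ∈ S, ∀ j' ∈ S, j ≠ j' → s j + p j ≤ s j' ∨ s j' + p j' ≤ s j)
    (hhi : ∀ j ∈ S, s j + p j ≤ W) (htot : ∑ j ∈ S, p j = W) {x : J} (hx : x ∈ S) :
    ∑ j ∈ S with s j + p j ≤ s x, p j = s x := by
  have h1 := sum_le_of_disjoint (S.filter fun j => s j + p j ≤ s x) s p 0 (s x)
    (fun j hj j' hj' => hdis j (Finset.mem_filter.1 hj).1 j' (Finset.mem_filter.1 hj').1)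
    (fun j _ => Nat.zero_le _) (fun j hj => (Finset.mem_filter.1 hj).2)
  have h2 := sum_le_of_disjoint (S.filter fun j => ¬ s j + p j ≤ s x) s p (s x) W
    (fun j hj j' hj' => hdis j (Finset.mem_filter.1 hj).1 j' (Finset.mem_filter.1 hj').1)
    (fun j hj => by
      have ⟨h3, h4⟩ := Finset.mem_filter.1 hj
      by_cases hne : j = x
      · rw [hne]
      · have := hdis j h3 x hx hne
        have := hp x
        omega) (fun j hj => hhi j (Finset.mem_filter.1 hj).1)
  have h3 := Finset.sum_filter_add_sum_filter_not S (fun j => s j + p j ≤ s x) p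
  have := hhi x hx
  omega

lemma N_eq_sum (P : J → Prop) [DecidablePred P] (t : ℕ) :
    N e P t = ∑ j, if P j ∧ e j ≤ t then 1 else 0 := by
  unfold N
  rw [Finset.card_filter]
  apply Finset.sum_congr rfl
  intro j _
  congr

end core2

lemma dig1 {D a b a' b' : ℕ} (h : a + D * b = a' + D * b') (ha : a < D) (ha' : a' < D) :
    a = a' ∧ b = b' := by
  have h1 : a = a' := by
    have := congrArg (· % D) h
    simpa [Nat.add_mul_mod_self_left, Nat.mod_eq_of_lt ha, Nat.mod_eq_of_lt ha'] using this
  subst h1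
  have h2 : D * b = D * b' := by omega
  exact ⟨rfl, Nat.eq_of_mul_eq_mul_left (by omega) h2⟩

lemma digits {D r x2 x3 x4 x5 x6 x7 x8 r' y2 y3 y4 y5 y6 y7 y8 : ℕ}
    (h : r + D^2*x2 + D^3*x3 + D^4*x4 + D^5*x5 + D^6*x6 + D^7*x7 + D^8*x8 =
      r' + D^2*y2 + D^3*y3 + D^4*y4 + D^5*y5 + D^6*y6 + D^7*y7 + D^8*y8)
    (hr : r < D^2) (hr' : r' < D^2) (h2 : x2 < D) (h3 : x3 < D) (h4 : x4 < D) (h5 : x5 < D)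
    (h6 : x6 < D) (h7 : x7 < D) (k2 : y2 < D) (k3 : y3 < D) (k4 : y4 < D) (k5 : y5 < D)
    (k6 : y6 < D) (k7 : y7 < D) :
    r = r' ∧ x2 = y2 ∧ x3 = y3 ∧ x4 = y4 ∧ x5 = y5 ∧ x6 = y6 ∧ x8 = y8 := by
  have e1 : r + D^2*(x2 + D*(x3 + D*(x4 + D*(x5+D*(x6+D*(x7+D*x8)))))) =
     r' + D^2*(y2 + D*(y3 + D*(y4 + D*(y5+D*(y6+D*(y7+D*y8)))))) := by
    linear_combination h
  obtain ⟨q1, e2⟩ := dig1 e1 hr hr'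
  obtain ⟨q2, e3⟩ := dig1 e2 h2 k2
  obtain ⟨q3, e4⟩ := dig1 e3 h3 k3
  obtain ⟨q4, e5⟩ := dig1 e4 h4 k4
  obtain ⟨q5, e6⟩ := dig1 e5 h5 k5
  obtain ⟨q6, e7⟩ := dig1 e6 h6 k6
  obtain ⟨q7, e8⟩ := dig1 e7 h7 k7
  exact ⟨q1, q2, q3, q4, q5, q6, e8⟩


section conc

lemma sum_job {z : ℕ} (F : Job z → ℕ) : ∑ j, F j =
    ∑ i, F (.JA i) + ∑ i, F (.JB i) + ∑ i, F (.Ja i) + ∑ i, F (.Jb i) + ∑ i, F (.Jc i)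
    + ∑ i, F (.Jα i) + ∑ i, F (.Jβ i) + ∑ i, F (.Jγ i) + ∑ i, F (.Jδ i) + F .Jl1 + F .Jl2
    + ∑ i, F (.Jpart i) := by
  let g : (Fin (z+1) ⊕ Fin (z+1) ⊕ Fin z ⊕ Fin z ⊕ Fin (z+1) ⊕ Fin z ⊕ Fin z ⊕ Fin z ⊕ Fin z ⊕
      Unit ⊕ Unit ⊕ Fin (3*z)) ≃ Job z :=
    { toFun := Sum.elim .JA (Sum.elim .JB (Sum.elim .Ja (Sum.elim .Jb (Sum.elim .Jc (Sum.elim .Jα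
        (Sum.elim .Jβ (Sum.elim .Jγ (Sum.elim .Jδ (Sum.elim (fun _ => .Jl1) (Sum.elim (fun _ => .Jl2)
          .Jpart))))))))))
      invFun := fun j => match j with
        | .JA i => .inl i
        | .JB i => .inr (.inl i)
        | .Ja i => .inr (.inr (.inl i))
        | .Jb i => .inr (.inr (.inr (.inl i)))
        | .Jc i => .inr (.inr (.inr (.inr (.inl i))))
        | .Jα i => .inr (.inr (.inr (.inr (.inr (.inl i)))))
        | .Jβ i => .inr (.inr (.inr (.inr (.inr (.inr (.inl i))))))
        | .Jγ i => .inr (.inr (.inr (.inr (.inr (.inr (.inr (.inl i)))))))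
        | .Jδ i => .inr (.inr (.inr (.inr (.inr (.inr (.inr (.inr (.inl i))))))))
        | .Jl1 => .inr (.inr (.inr (.inr (.inr (.inr (.inr (.inr (.inr (.inl ())))))))))
        | .Jl2 => .inr (.inr (.inr (.inr (.inr (.inr (.inr (.inr (.inr (.inr (.inl ()))))))))))
        | .Jpart i => .inr (.inr (.inr (.inr (.inr (.inr (.inr (.inr (.inr (.inr (.inr i))))))))))
      left_inv := by
        rintro (i|i|i|i|i|i|i|i|i|i|i|i) <;> rfl
      right_inv := by rintro (i|i|i|i|i|i|i|i|i|_|_|i) <;> rfl }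
  rw [← g.sum_comp]
  simp only [Fintype.sum_sum_type, Finset.univ_unique, Finset.sum_singleton]
  simp only [g, Equiv.coe_fn_mk, Sum.elim_inl, Sum.elim_inr]
  ring

def tg {z : ℕ} : Job z → ℕ
  | .JA _ => 0
  | .JB _ => 1
  | .Ja _ => 2
  | .Jb _ => 3
  | .Jc _ => 4
  | .Jα _ => 5
  | .Jβ _ => 6
  | .Jγ _ => 7
  | .Jδ _ => 8
  | .Jl1 => 9
  | .Jl2 => 10
  | .Jpart _ => 11

def c7 {z : ℕ} : Job z → ℕ
  | .Ja _ => 3*z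
  | .Jb _ => 3*z
  | .Jc j => z + j.val
  | .Jα _ => 4*z
  | .Jβ _ => 4*z-1
  | .Jγ j => 3*z - (j.val+1)
  | .Jδ j => 3*z - (j.val+1)
  | .Jl1 => z
  | .Jl2 => 2*z
  | _ => 0

lemma sum_fin_val (n : ℕ) : 2 * ∑ i : Fin (n+1), i.val = n * (n+1) := by
  rw [Fin.sum_univ_eq_sum_range (fun i => i) (n+1)]
  have := Finset.sum_range_id_mul_two (n+1)
  simp only [Nat.add_sub_cancel] at this
  linarith

lemma sum_fin_sub (z : ℕ) : 2 * ∑ i : Fin z, (3*z - (i.val+1)) + z * (z+1) = 6*z*z := by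
  have h : ∑ i : Fin z, (3*z - (i.val+1)) + ∑ i : Fin z, (i.val+1) = 3*z*z := by
    rw [← Finset.sum_add_distrib]
    rw [Finset.sum_congr rfl (g := fun _ => 3*z)]
    · simp; ring
    · intro i _; have := i.isLt; omega
  have h2 : 2 * ∑ i : Fin z, (i.val+1) = z*(z+1) := by
    rw [Fin.sum_univ_eq_sum_range (fun i => i+1) z]
    have := Finset.sum_range_id_mul_two (z+1)
    rw [Finset.sum_range_succ'] at this
    simp only [Nat.add_sub_cancel] at this
    linarith
  nlinarith

variable {z D : ℕ} {ι : Fin (3*z) → ℕ} {σ : Job z → ℕ} {ρ : Job z → Finset ℕ}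

structure Ctx (z D : ℕ) (ι : Fin (3*z) → ℕ) (σ : Job z → ℕ) (ρ : Job z → Finset ℕ) : Prop where
  hz : 0 < z
  hιpos : ∀ i, 0 < ι i
  hsum : ∑ i, ι i = z * D
  hD : 4*z*(7*z+1) < D
  hf : Feasible 4 (pJob z D ι) (qJob z) σ ρ
  hm : makespan (pJob z D ι) σ = Wval z D
  hn : NormalForm ρ

def load (p σ : Job z → ℕ) (ρ : Job z → Finset ℕ) (M t : ℕ) : ℕ :=
  ∑ j, if M ∈ ρ j ∧ σ j + p j ≤ t then p j else 0

def lsum (p σ : Job z → ℕ) (ρ : Job z → Finset ℕ) (M t : ℕ) : ℕ :=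
  ∑ j, if (tg j = 11 ∧ M ∈ ρ j) ∧ σ j + p j ≤ t then p j else 0

def C7 (p σ : Job z → ℕ) (ρ : Job z → Finset ℕ) (M t : ℕ) : ℕ :=
  ∑ j : Job z, if M ∈ ρ j ∧ σ j + p j ≤ t then c7 j else 0

/-- membership facts -/
lemma Ctx.one {C : Ctx z D ι σ ρ} {j : Job z} (hq : qJob z j = 1) {k M : ℕ} (h : k ∈ ρ j)
    (hM : M ≠ k) : M ∉ ρ j := by
  have h1 := C.hf.2.1 j
  rw [hq, Finset.card_eq_one] at h1
  obtain ⟨x, hx⟩ := h1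
  rw [hx] at h ⊢
  simp at h ⊢
  omega

lemma Ctx.memα (C : Ctx z D ι σ ρ) (i) {M : ℕ} (hM : M ≠ 1) : M ∉ ρ (.Jα i) :=
  Ctx.one (C := C) rfl ((C.hn.1 _).2 trivial) hM
lemma Ctx.meml1 (C : Ctx z D ι σ ρ) {M : ℕ} (hM : M ≠ 1) : M ∉ ρ (.Jl1) :=
  Ctx.one (C := C) rfl ((C.hn.1 _).2 trivial) hM
lemma Ctx.memβ (C : Ctx z D ι σ ρ) (i) {M : ℕ} (hM : M ≠ 4) : M ∉ ρ (.Jβ i) :=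
  Ctx.one (C := C) rfl ((C.hn.2.1 _).2 trivial) hM
lemma Ctx.meml2 (C : Ctx z D ι σ ρ) {M : ℕ} (hM : M ≠ 4) : M ∉ ρ (.Jl2) :=
  Ctx.one (C := C) rfl ((C.hn.2.1 _).2 trivial) hM

lemma Ctx.both (C : Ctx z D ι σ ρ) {j : Job z} (h : BothM23 j) {M : ℕ} (hM : M = 2 ∨ M = 3) :
    M ∈ ρ j := by
  have := C.hn.2.2.1 j h
  rcases hM with rfl | rfl
  · exact this.1
  · exact this.2

lemma Ctx.mem1 (C : Ctx z D ι σ ρ) (j : Job z) :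
    1 ∈ ρ j ↔ (tg j = 0 ∨ tg j = 2 ∨ tg j = 5 ∨ tg j = 9) := by
  rw [C.hn.1]; cases j <;> simp [tg, M1Jobs]

lemma Ctx.mem4 (C : Ctx z D ι σ ρ) (j : Job z) :
    4 ∈ ρ j ↔ (tg j = 1 ∨ tg j = 3 ∨ tg j = 6 ∨ tg j = 10) := by
  rw [C.hn.2.1]; cases j <;> simp [tg, M4Jobs]

lemma Ctx.D2 (C : Ctx z D ι σ ρ) : 32 * z < D := by
  have := C.hD
  have := C.hz
  nlinarith

lemma Ctx.ppos (C : Ctx z D ι σ ρ) (j : Job z) : 0 < pJob z D ι j := by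
  have h1 := C.D2
  have h0 := C.hz
  have hD : 0 < D := by omega
  have hk : ∀ k, 0 < D^k := fun k => Nat.pow_pos hD
  have := hk 2
  have := hk 3
  have := hk 4
  have := hk 5
  have := hk 8
  have h5 : D < D^5 := by
    calc D = D^1 := (pow_one D).symm
      _ < D^5 := Nat.pow_lt_pow_right (by omega) (by omega)
  cases j <;> simp only [pJob] <;> first | omega | exact C.hιpos _

lemma load23 (C : Ctx z D ι σ ρ) {M : ℕ} (hM : M = 2 ∨ M = 3) (t : ℕ) (e : Job z → ℕ)
    (he : e = fun j => σ j + pJob z D ι j) :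
    D * N e (fun j => tg j = 7 ∧ M ∈ ρ j) t + load (pJob z D ι) σ ρ M t =
    lsum (pJob z D ι) σ ρ M t + D^2 * N e (fun j => tg j = 0) t + D^3 * N e (fun j => tg j = 1) t
    + D^4 * (N e (fun j => tg j = 2 ∧ M ∈ ρ j) t + N e (fun j => tg j = 8 ∧ M ∈ ρ j) t)
    + D^5 * (N e (fun j => tg j = 3 ∧ M ∈ ρ j) t + N e (fun j => tg j = 7 ∧ M ∈ ρ j) t)
    + D^6 * (N e (fun j => tg j = 2 ∧ M ∈ ρ j) t + N e (fun j => tg j = 3 ∧ M ∈ ρ j) t)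
    + D^7 * C7 (pJob z D ι) σ ρ M t
    + D^8 * N e (fun j => tg j = 4) t := by
  simp only [N_eq_sum, load, lsum, C7, ← Finset.sum_add_distrib, Finset.mul_sum]
  apply Finset.sum_congr rfl
  intro j _
  subst he
  have hM1 : M ≠ 1 := by omega
  have hM4 : M ≠ 4 := by omega
  have hD5 : D ≤ D^5 := by
    calc D = D^1 := (pow_one D).symm
      _ ≤ D^5 := Nat.pow_le_pow_right (by have := C.D2; omega) (by omega)
  by_cases ht : σ j + pJob z D ι j ≤ t
  · simp only [ht, and_true]
    cases j with
    | JA i => simp [tg, c7, pJob, C.both (j := .JA i) trivial hM]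
    | JB i => simp [tg, c7, pJob, C.both (j := .JB i) trivial hM]
    | Jc i => simp [tg, c7, pJob, C.both (j := .Jc i) trivial hM]; ring
    | Jα i => simp [tg, C.memα i hM1]
    | Jβ i => simp [tg, C.memβ i hM4]
    | Jl1 => simp [tg, C.meml1 hM1]
    | Jl2 => simp [tg, C.meml2 hM4]
    | Ja i => by_cases h : M ∈ ρ (.Ja i) <;> simp [tg, h, c7, pJob]; ring
    | Jb i => by_cases h : M ∈ ρ (.Jb i) <;> simp [tg, h, c7, pJob]; ring
    | Jδ i => by_cases h : M ∈ ρ (.Jδ i) <;> simp [tg, h, c7, pJob]; ring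
    | Jpart i => by_cases h : M ∈ ρ (.Jpart i) <;> simp [tg, h, c7, pJob]
    | Jγ i =>
      by_cases h : M ∈ ρ (.Jγ i) <;> simp [tg, h, c7, pJob]
      rw [mul_comm (D^7)]
      omega
  · simp [ht]

lemma load1 (C : Ctx z D ι σ ρ) (t : ℕ) (e : Job z → ℕ)
    (he : e = fun j => σ j + pJob z D ι j) :
    load (pJob z D ι) σ ρ 1 t =
    D^2 * N e (fun j => tg j = 0) t + D^3 * (N e (fun j => tg j = 5) t + N e (fun j => tg j = 9) t)
    + D^4 * N e (fun j => tg j = 2) t + D^5 * N e (fun j => tg j = 5) t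
    + D^6 * N e (fun j => tg j = 2) t + D^7 * C7 (pJob z D ι) σ ρ 1 t
    + D^8 * (N e (fun j => tg j = 5) t + N e (fun j => tg j = 9) t) := by
  simp only [N_eq_sum, load, C7, ← Finset.sum_add_distrib, Finset.mul_sum]
  apply Finset.sum_congr rfl
  intro j _
  subst he
  have h1 := C.mem1 j
  by_cases ht : σ j + pJob z D ι j ≤ t
  · simp only [ht, and_true]
    cases j <;> simp [tg] at h1 <;> simp [tg, c7, pJob, h1] <;> ring
  · simp [ht]

lemma load4 (C : Ctx z D ι σ ρ) (t : ℕ) (e : Job z → ℕ)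
    (he : e = fun j => σ j + pJob z D ι j) :
    load (pJob z D ι) σ ρ 4 t =
    D^2 * (N e (fun j => tg j = 6) t + N e (fun j => tg j = 10) t) + D^3 * N e (fun j => tg j = 1) t
    + D^4 * N e (fun j => tg j = 6) t + D^5 * N e (fun j => tg j = 3) t
    + D^6 * N e (fun j => tg j = 3) t + D^7 * C7 (pJob z D ι) σ ρ 4 t
    + D^8 * (N e (fun j => tg j = 6) t + N e (fun j => tg j = 10) t) := by
  simp only [N_eq_sum, load, C7, ← Finset.sum_add_distrib, Finset.mul_sum]
  apply Finset.sum_congr rfl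
  intro j _
  subst he
  have h1 := C.mem4 j
  by_cases ht : σ j + pJob z D ι j ≤ t
  · simp only [ht, and_true]
    cases j <;> simp [tg] at h1 <;> simp [tg, c7, pJob, h1] <;> ring
  · simp [ht]

lemma tot1 (C : Ctx z D ι σ ρ) : ∑ j, (if 1 ∈ ρ j then pJob z D ι j else 0) = Wval z D := by
  rw [Finset.sum_congr rfl (fun j _ => if_congr (C.mem1 j) rfl rfl), sum_job]
  simp [tg, pJob, Wval]
  ring

lemma tot4 (C : Ctx z D ι σ ρ) : ∑ j, (if 4 ∈ ρ j then pJob z D ι j else 0) = Wval z D := by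
  rw [Finset.sum_congr rfl (fun j _ => if_congr (C.mem4 j) rfl rfl), sum_job]
  simp [tg, pJob, Wval]
  obtain ⟨w, hw⟩ : ∃ w, z = w + 1 := ⟨z - 1, by have := C.hz; omega⟩
  have : 4 * z - 1 = 4*w+3 := by omega
  rw [this]
  subst hw
  ring

lemma tot23 (C : Ctx z D ι σ ρ) : ∑ j, (if 2 ∈ ρ j then pJob z D ι j else 0) +
    ∑ j, (if 3 ∈ ρ j then pJob z D ι j else 0) = 2 * Wval z D := by
  classical
  have h : ∀ j, ((if 2 ∈ ρ j then pJob z D ι j else 0) + (if 3 ∈ ρ j then pJob z D ι j else 0)) =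
      (if tg j = 0 ∨ tg j = 1 ∨ tg j = 4 then 2 * pJob z D ι j else
        if tg j = 2 ∨ tg j = 3 ∨ tg j = 7 ∨ tg j = 8 ∨ tg j = 11 then pJob z D ι j else 0) := by
    intro j
    by_cases hb : BothM23 j
    · have := C.hn.2.2.1 j hb
      cases j <;> simp [BothM23] at hb <;> simp [this, tg] <;> ring
    · by_cases ho : OneM23 j
      · have := C.hn.2.2.2 j ho
        by_cases h3 : 3 ∈ ρ j <;> cases j <;> simp [OneM23] at ho <;> simp [this, tg, h3]
      · cases j <;> simp [BothM23, OneM23] at hb ho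
        · simp [C.memα, tg]
        · simp [C.memβ, tg]
        · simp [C.meml1, tg]
        · simp [C.meml2, tg]
  rw [← Finset.sum_add_distrib, Finset.sum_congr rfl (fun j _ => h j), sum_job]
  simp only [tg, pJob]
  norm_num
  have hD5 : D ≤ D^5 := by
    calc D = D^1 := (pow_one D).symm
      _ ≤ D^5 := Nat.pow_le_pow_right (by have := C.D2; omega) (by omega)
  have hγ : ∑ j : Fin z, (D^5 + (3*z - (j.val+1))*D^7 - D) + z * D =
      z * D^5 + (∑ i : Fin z, (3*z - (i.val+1))) * D^7 := by
    rw [Finset.sum_mul]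
    have : ∑ j : Fin z, (D^5 + (3*z - (j.val+1))*D^7 - D) + ∑ j : Fin z, D =
      ∑ j : Fin z, (D^5 + (3*z - (j.val+1))*D^7) := by
      rw [← Finset.sum_add_distrib]
      apply Finset.sum_congr rfl
      intro i _; omega
    simpa [Finset.sum_add_distrib] using this
  have hs1 := sum_fin_val z
  have hs2 := sum_fin_sub z
  simp only [Finset.sum_const, Finset.card_univ, Fintype.card_fin, smul_eq_mul,
    Finset.sum_add_distrib, ← Finset.sum_mul, ← Finset.mul_sum, Wval, C.hsum, Finset.sum_const_zero]
  zify at *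
  linear_combination hγ + (D:ℤ)^7 * hs1 + (D:ℤ)^7 * hs2

lemma Ctx.end_le (C : Ctx z D ι σ ρ) (j : Job z) : σ j + pJob z D ι j ≤ Wval z D := by
  rw [← C.hm]
  exact Finset.le_sup (f := fun j => σ j + pJob z D ι j) (Finset.mem_univ j)

lemma Ctx.tot (C : Ctx z D ι σ ρ) {M : ℕ} (hM : M = 1 ∨ M = 2 ∨ M = 3 ∨ M = 4) :
    ∑ j, (if M ∈ ρ j then pJob z D ι j else 0) = Wval z D := by
  have hle : ∀ M, ∑ j, (if M ∈ ρ j then pJob z D ι j else 0) ≤ Wval z D := by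
    intro M
    rw [← Finset.sum_filter]
    have := sum_le_of_disjoint (Finset.univ.filter fun j => M ∈ ρ j) σ (pJob z D ι) 0 (Wval z D)
      (by
        intro j hj j' hj' hne
        simp only [Finset.mem_filter, Finset.mem_univ, true_and] at hj hj'
        exact C.hf.2.2 j j' hne ⟨M, by simp [hj, hj']⟩)
      (fun _ _ => Nat.zero_le _) (fun j _ => C.end_le j)
    simpa using this
  rcases hM with rfl | rfl | rfl | rfl
  · exact tot1 C
  · have := tot23 C; have := hle 2; have := hle 3; omega
  · have := tot23 C; have := hle 2; have := hle 3; omega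
  · exact tot4 C

lemma Ctx.good (C : Ctx z D ι σ ρ) {M : ℕ} (hM : M = 1 ∨ M = 2 ∨ M = 3 ∨ M = 4) {t : ℕ}
    (ht : t = Wval z D ∨ ∃ j, M ∈ ρ j ∧ σ j = t) : load (pJob z D ι) σ ρ M t = t := by
  have h := C.tot hM
  rcases ht with rfl | ⟨x, hx, rfl⟩
  · unfold load
    simp only [C.end_le, and_true]
    exact h
  · unfold load
    rw [← Finset.sum_filter, ← Finset.filter_filter]
    apply good_of_mem _ σ (pJob z D ι) (Wval z D) C.ppos
    · intro j hj j' hj' hne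
      simp only [Finset.mem_filter, Finset.mem_univ, true_and] at hj hj'
      exact C.hf.2.2 j j' hne ⟨M, by simp [hj, hj']⟩
    · exact fun j _ => C.end_le j
    · rw [Finset.sum_filter]; exact h
    · simpa using hx

lemma C7_lt (C : Ctx z D ι σ ρ) {M : ℕ} (hM : M = 1 ∨ M = 2 ∨ M = 3 ∨ M = 4) (t : ℕ) :
    C7 (pJob z D ι) σ ρ M t < D := by
  have hs1 := sum_fin_val z
  have hs2 := sum_fin_sub z
  have hD := C.hD
  have hz := C.hz
  have key : C7 (pJob z D ι) σ ρ M t ≤ ∑ j : Job z, if M ∈ ρ j then c7 j else 0 := by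
    unfold C7
    apply Finset.sum_le_sum
    intro j _
    by_cases h : M ∈ ρ j <;> simp [h]
    split_ifs <;> simp
  have h14 : M = 1 ∨ M = 4 ∨ (M = 2 ∨ M = 3) := by omega
  rcases h14 with rfl | rfl | hM
  · rw [Finset.sum_congr rfl (fun j _ => if_congr (C.mem1 j) rfl rfl)] at key
    replace key := key.trans_eq (sum_job _)
    simp [tg, c7] at key
    nlinarith
  · rw [Finset.sum_congr rfl (fun j _ => if_congr (C.mem4 j) rfl rfl)] at key
    replace key := key.trans_eq (sum_job _)
    simp [tg, c7] at key
    have : z * (4 * z - 1) ≤ z * (4*z) := Nat.mul_le_mul_left _ (by omega)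
    nlinarith
  · have k2 : ∑ j : Job z, (if M ∈ ρ j then c7 j else 0) ≤
       ∑ j : Job z, (if (tg j = 5 ∨ tg j = 6 ∨ tg j = 9 ∨ tg j = 10) then 0 else c7 j) := by
      apply Finset.sum_le_sum
      intro j _
      have hM1 : M ≠ 1 := by omega
      have hM4 : M ≠ 4 := by omega
      cases j <;> simp [tg, C.memα _ hM1, C.memβ _ hM4, C.meml1 hM1, C.meml2 hM4] <;>
        split_ifs <;> simp
    replace k2 := key.trans (k2.trans_eq (sum_job _))
    simp [tg, c7, Finset.sum_add_distrib] at k2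
    nlinarith

lemma N_tg_le (C : Ctx z D ι σ ρ) (e : Job z → ℕ) (P : Job z → Prop) (k : ℕ) (hk : k < 11)
    (hP : ∀ j, P j → tg j = k) (t : ℕ) :
    N e P t ≤ if k = 9 ∨ k = 10 then 1 else if k = 0 ∨ k = 1 ∨ k = 4 then z+1 else z := by
  classical
  have : N e P t ≤ ∑ j : Job z, if tg j = k then 1 else 0 := by
    rw [N_eq_sum]
    apply Finset.sum_le_sum
    intro j _
    by_cases h : P j
    · simp [h, hP j h]; split_ifs <;> simp
    · simp [h]
  refine this.trans ?_
  rw [sum_job]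
  interval_cases k <;> simp [tg]

lemma N_tot (C : Ctx z D ι σ ρ) (e : Job z → ℕ)
    (he : e = fun j => σ j + pJob z D ι j) (k : ℕ) (hk : k < 11) :
    N e (fun j => tg j = k) (Wval z D) =
      if k = 9 ∨ k = 10 then 1 else if k = 0 ∨ k = 1 ∨ k = 4 then z+1 else z := by
  rw [N_eq_sum]
  subst he
  simp only [C.end_le, and_true]
  rw [sum_job]
  interval_cases k <;> simp [tg]

lemma lsum_add (C : Ctx z D ι σ ρ) (t : ℕ) : lsum (pJob z D ι) σ ρ 2 t + lsum (pJob z D ι) σ ρ 3 t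
    = ∑ i, if σ (.Jpart i) + ι i ≤ t then ι i else 0 := by
  have : ∀ M, lsum (pJob z D ι) σ ρ M t =
     ∑ i, if M ∈ ρ (.Jpart i) ∧ σ (.Jpart i) + ι i ≤ t then ι i else 0 := by
    intro M
    unfold lsum
    rw [sum_job]
    simp [tg, pJob]
  rw [this, this, ← Finset.sum_add_distrib]
  apply Finset.sum_congr rfl
  intro i _
  have := C.hn.2.2.2 (.Jpart i) trivial
  by_cases h3 : 3 ∈ ρ (.Jpart i) <;> simp [this, h3]

lemma lsum_le (C : Ctx z D ι σ ρ) (t : ℕ) :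
    lsum (pJob z D ι) σ ρ 2 t + lsum (pJob z D ι) σ ρ 3 t ≤ z * D := by
  rw [lsum_add C, ← C.hsum]
  apply Finset.sum_le_sum
  intro i _
  split_ifs <;> simp

lemma N_split (C : Ctx z D ι σ ρ) (e : Job z → ℕ) (k : ℕ) (hk : k = 2 ∨ k = 3) (t : ℕ) :
    N e (fun j => tg j = k) t = N e (fun j => tg j = k ∧ 2 ∈ ρ j) t +
      N e (fun j => tg j = k ∧ 3 ∈ ρ j) t := by
  simp only [N_eq_sum]
  rw [← Finset.sum_add_distrib]
  apply Finset.sum_congr rfl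
  intro j _
  by_cases hj : tg j = k
  · have := C.hn.2.2.2 j (by rcases hk with rfl | rfl <;> cases j <;> simp [tg] at hj <;> trivial)
    by_cases h3 : 3 ∈ ρ j <;> simp [this, h3]
  · simp [hj]

end conc

section sys
variable {z D : ℕ} {ι : Fin (3*z) → ℕ} {σ : Job z → ℕ} {ρ : Job z → Finset ℕ}

lemma dig1M (C : Ctx z D ι σ ρ) {M : ℕ} (hM : M = 2 ∨ M = 3) (t : ℕ) (e : Job z → ℕ)
    (he : e = fun j => σ j + pJob z D ι j) (g1 : load (pJob z D ι) σ ρ 1 t = t)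
    (gM : load (pJob z D ι) σ ρ M t = t) :
    lsum (pJob z D ι) σ ρ M t = D * N e (fun j => tg j = 7 ∧ M ∈ ρ j) t ∧
    N e (fun j => tg j = 4) t = N e (fun j => tg j = 1) t ∧
    N e (fun j => tg j = 1) t = N e (fun j => tg j = 3 ∧ M ∈ ρ j) t +
      N e (fun j => tg j = 7 ∧ M ∈ ρ j) t + N e (fun j => tg j = 9) t ∧
    N e (fun j => tg j = 2) t = N e (fun j => tg j = 2 ∧ M ∈ ρ j) t +
      N e (fun j => tg j = 8 ∧ M ∈ ρ j) t ∧
    N e (fun j => tg j = 2) t = N e (fun j => tg j = 2 ∧ M ∈ ρ j) t +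
      N e (fun j => tg j = 3 ∧ M ∈ ρ j) t := by
  have L1 := load1 C t e he
  have LM := load23 C hM t e he
  rw [g1] at L1
  rw [gM] at LM
  have hz := C.hz
  have hD2 := C.D2
  have n7 := N_tg_le C e (fun j => tg j = 7 ∧ M ∈ ρ j) 7 (by omega) (fun j h => h.1) t
  have n2 := N_tg_le C e (fun j => tg j = 2 ∧ M ∈ ρ j) 2 (by omega) (fun j h => h.1) t
  have n3 := N_tg_le C e (fun j => tg j = 3 ∧ M ∈ ρ j) 3 (by omega) (fun j h => h.1) t
  have n8 := N_tg_le C e (fun j => tg j = 8 ∧ M ∈ ρ j) 8 (by omega) (fun j h => h.1) t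
  have m0 := N_tg_le C e (fun j => tg j = 0) 0 (by omega) (fun j h => h) t
  have m1 := N_tg_le C e (fun j => tg j = 1) 1 (by omega) (fun j h => h) t
  have m2 := N_tg_le C e (fun j => tg j = 2) 2 (by omega) (fun j h => h) t
  have m5 := N_tg_le C e (fun j => tg j = 5) 5 (by omega) (fun j h => h) t
  have m9 := N_tg_le C e (fun j => tg j = 9) 9 (by omega) (fun j h => h) t
  have c1 := C7_lt C (M := 1) (by omega) t
  have cM := C7_lt C (M := M) (by omega) t
  have ls := lsum_le C t
  norm_num at n7 n2 n3 n8 m0 m1 m2 m5 m9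
  have lsM : lsum (pJob z D ι) σ ρ M t ≤ z * D := by rcases hM with rfl | rfl <;> omega
  have hzD : z * D < D^2 := by nlinarith
  have hg : D * N e (fun j => tg j = 7 ∧ M ∈ ρ j) t < D^2 := by nlinarith
  obtain ⟨q1, q2, q3, q4, q5, q6, q8⟩ := digits (D := D)
    (r := D * N e (fun j => tg j = 7 ∧ M ∈ ρ j) t) (r' := lsum (pJob z D ι) σ ρ M t)
    (x2 := N e (fun j => tg j = 0) t) (x3 := N e (fun j => tg j = 5) t + N e (fun j => tg j = 9) t)
    (x4 := N e (fun j => tg j = 2) t) (x5 := N e (fun j => tg j = 5) t)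
    (x6 := N e (fun j => tg j = 2) t) (x7 := C7 (pJob z D ι) σ ρ 1 t)
    (x8 := N e (fun j => tg j = 5) t + N e (fun j => tg j = 9) t)
    (y2 := N e (fun j => tg j = 0) t) (y3 := N e (fun j => tg j = 1) t)
    (y4 := N e (fun j => tg j = 2 ∧ M ∈ ρ j) t + N e (fun j => tg j = 8 ∧ M ∈ ρ j) t)
    (y5 := N e (fun j => tg j = 3 ∧ M ∈ ρ j) t + N e (fun j => tg j = 7 ∧ M ∈ ρ j) t)
    (y6 := N e (fun j => tg j = 2 ∧ M ∈ ρ j) t + N e (fun j => tg j = 3 ∧ M ∈ ρ j) t)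
    (y8 := N e (fun j => tg j = 4) t)
    (h := by linear_combination LM - L1) (hr := hg) (hr' := by omega) (by omega) (by omega) (by omega)
      (by omega) (by omega) c1 (by omega) (by omega) (by omega) (by omega) (by omega) cM
  refine ⟨q1.symm, ?_, ?_, ?_, ?_⟩ <;> omega

lemma dig4M (C : Ctx z D ι σ ρ) {M : ℕ} (hM : M = 2 ∨ M = 3) (t : ℕ) (e : Job z → ℕ)
    (he : e = fun j => σ j + pJob z D ι j) (g1 : load (pJob z D ι) σ ρ 4 t = t)
    (gM : load (pJob z D ι) σ ρ M t = t) :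
    lsum (pJob z D ι) σ ρ M t = D * N e (fun j => tg j = 7 ∧ M ∈ ρ j) t ∧
    N e (fun j => tg j = 4) t = N e (fun j => tg j = 0) t ∧
    N e (fun j => tg j = 0) t = N e (fun j => tg j = 2 ∧ M ∈ ρ j) t +
      N e (fun j => tg j = 8 ∧ M ∈ ρ j) t + N e (fun j => tg j = 10) t ∧
    N e (fun j => tg j = 3) t = N e (fun j => tg j = 3 ∧ M ∈ ρ j) t +
      N e (fun j => tg j = 7 ∧ M ∈ ρ j) t ∧
    N e (fun j => tg j = 3) t = N e (fun j => tg j = 2 ∧ M ∈ ρ j) t +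
      N e (fun j => tg j = 3 ∧ M ∈ ρ j) t := by
  have L1 := load4 C t e he
  have LM := load23 C hM t e he
  rw [g1] at L1
  rw [gM] at LM
  have hz := C.hz
  have hD2 := C.D2
  have n7 := N_tg_le C e (fun j => tg j = 7 ∧ M ∈ ρ j) 7 (by omega) (fun j h => h.1) t
  have n2 := N_tg_le C e (fun j => tg j = 2 ∧ M ∈ ρ j) 2 (by omega) (fun j h => h.1) t
  have n3 := N_tg_le C e (fun j => tg j = 3 ∧ M ∈ ρ j) 3 (by omega) (fun j h => h.1) t
  have n8 := N_tg_le C e (fun j => tg j = 8 ∧ M ∈ ρ j) 8 (by omega) (fun j h => h.1) t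
  have m0 := N_tg_le C e (fun j => tg j = 0) 0 (by omega) (fun j h => h) t
  have m1 := N_tg_le C e (fun j => tg j = 1) 1 (by omega) (fun j h => h) t
  have m3 := N_tg_le C e (fun j => tg j = 3) 3 (by omega) (fun j h => h) t
  have m6 := N_tg_le C e (fun j => tg j = 6) 6 (by omega) (fun j h => h) t
  have m10 := N_tg_le C e (fun j => tg j = 10) 10 (by omega) (fun j h => h) t
  have c1 := C7_lt C (M := 4) (by omega) t
  have cM := C7_lt C (M := M) (by omega) t
  have ls := lsum_le C t
  norm_num at n7 n2 n3 n8 m0 m1 m3 m6 m10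
  have lsM : lsum (pJob z D ι) σ ρ M t ≤ z * D := by rcases hM with rfl | rfl <;> omega
  have hzD : z * D < D^2 := by nlinarith
  have hg : D * N e (fun j => tg j = 7 ∧ M ∈ ρ j) t < D^2 := by nlinarith
  obtain ⟨q1, q2, q3, q4, q5, q6, q8⟩ := digits (D := D)
    (r := D * N e (fun j => tg j = 7 ∧ M ∈ ρ j) t) (r' := lsum (pJob z D ι) σ ρ M t)
    (x2 := N e (fun j => tg j = 6) t + N e (fun j => tg j = 10) t) (x3 := N e (fun j => tg j = 1) t)
    (x4 := N e (fun j => tg j = 6) t) (x5 := N e (fun j => tg j = 3) t)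
    (x6 := N e (fun j => tg j = 3) t) (x7 := C7 (pJob z D ι) σ ρ 4 t)
    (x8 := N e (fun j => tg j = 6) t + N e (fun j => tg j = 10) t)
    (y2 := N e (fun j => tg j = 0) t) (y3 := N e (fun j => tg j = 1) t)
    (y4 := N e (fun j => tg j = 2 ∧ M ∈ ρ j) t + N e (fun j => tg j = 8 ∧ M ∈ ρ j) t)
    (y5 := N e (fun j => tg j = 3 ∧ M ∈ ρ j) t + N e (fun j => tg j = 7 ∧ M ∈ ρ j) t)
    (y6 := N e (fun j => tg j = 2 ∧ M ∈ ρ j) t + N e (fun j => tg j = 3 ∧ M ∈ ρ j) t)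
    (y8 := N e (fun j => tg j = 4) t)
    (h := by linear_combination LM - L1) (hr := hg) (hr' := by omega) (by omega) (by omega) (by omega)
      (by omega) (by omega) c1 (by omega) (by omega) (by omega) (by omega) (by omega) cM
  refine ⟨q1.symm, ?_, ?_, ?_, ?_⟩ <;> omega

set_option maxHeartbeats 2000000 in
lemma dig23 (C : Ctx z D ι σ ρ) (t : ℕ) (e : Job z → ℕ)
    (he : e = fun j => σ j + pJob z D ι j) (g2 : load (pJob z D ι) σ ρ 2 t = t)
    (g3 : load (pJob z D ι) σ ρ 3 t = t) :
    N e (fun j => tg j = 2 ∧ 2 ∈ ρ j) t + N e (fun j => tg j = 3 ∧ 2 ∈ ρ j) t =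
    N e (fun j => tg j = 2 ∧ 3 ∈ ρ j) t + N e (fun j => tg j = 3 ∧ 3 ∈ ρ j) t := by
  have L2 := load23 C (M := 2) (Or.inl rfl) t e he
  have L3 := load23 C (M := 3) (Or.inr rfl) t e he
  rw [g2] at L2
  rw [g3] at L3
  have hz := C.hz
  have hD2 := C.D2
  have nn : ∀ M k, k = 2 ∨ k = 3 ∨ k = 7 ∨ k = 8 → N e (fun j => tg j = k ∧ M ∈ ρ j) t ≤ z := by
    intro M k hk
    have := N_tg_le C e (fun j => tg j = k ∧ M ∈ ρ j) k (by omega) (fun j h => h.1) t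
    rcases hk with rfl | rfl | rfl | rfl <;> simpa using this
  have n7 := nn 2 7 (by omega)
  have n2 := nn 2 2 (by omega)
  have n3 := nn 2 3 (by omega)
  have n8 := nn 2 8 (by omega)
  have k7 := nn 3 7 (by omega)
  have k2 := nn 3 2 (by omega)
  have k3 := nn 3 3 (by omega)
  have k8 := nn 3 8 (by omega)
  have m0 := N_tg_le C e (fun j => tg j = 0) 0 (by omega) (fun j h => h) t
  have m1 := N_tg_le C e (fun j => tg j = 1) 1 (by omega) (fun j h => h) t
  have c2 := C7_lt C (M := 2) (by omega) t
  have c3 := C7_lt C (M := 3) (by omega) t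
  have ls := lsum_le C t
  norm_num at m0 m1
  have hzD : 2 * (z * D) < D^2 := by nlinarith
  have h7 : D * N e (fun j => tg j = 7 ∧ 2 ∈ ρ j) t ≤ z * D := by nlinarith
  have h7' : D * N e (fun j => tg j = 7 ∧ 3 ∈ ρ j) t ≤ z * D := by nlinarith
  obtain ⟨q1, q2, q3, q4, q5, q6, q8⟩ := digits (D := D)
    (r := lsum (pJob z D ι) σ ρ 2 t + D * N e (fun j => tg j = 7 ∧ 3 ∈ ρ j) t)
    (r' := lsum (pJob z D ι) σ ρ 3 t + D * N e (fun j => tg j = 7 ∧ 2 ∈ ρ j) t)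
    (x2 := N e (fun j => tg j = 0) t) (x3 := N e (fun j => tg j = 1) t)
    (y2 := N e (fun j => tg j = 0) t) (y3 := N e (fun j => tg j = 1) t)
    (x4 := N e (fun j => tg j = 2 ∧ 2 ∈ ρ j) t + N e (fun j => tg j = 8 ∧ 2 ∈ ρ j) t)
    (x5 := N e (fun j => tg j = 3 ∧ 2 ∈ ρ j) t + N e (fun j => tg j = 7 ∧ 2 ∈ ρ j) t)
    (x6 := N e (fun j => tg j = 2 ∧ 2 ∈ ρ j) t + N e (fun j => tg j = 3 ∧ 2 ∈ ρ j) t)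
    (y4 := N e (fun j => tg j = 2 ∧ 3 ∈ ρ j) t + N e (fun j => tg j = 8 ∧ 3 ∈ ρ j) t)
    (y5 := N e (fun j => tg j = 3 ∧ 3 ∈ ρ j) t + N e (fun j => tg j = 7 ∧ 3 ∈ ρ j) t)
    (y6 := N e (fun j => tg j = 2 ∧ 3 ∈ ρ j) t + N e (fun j => tg j = 3 ∧ 3 ∈ ρ j) t)
    (x8 := N e (fun j => tg j = 4) t) (y8 := N e (fun j => tg j = 4) t)
    (x7 := C7 (pJob z D ι) σ ρ 2 t) (y7 := C7 (pJob z D ι) σ ρ 3 t)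
    (h := by linear_combination L3 - L2) (hr := by omega) (hr' := by omega)
    (by omega) (by omega) (by omega)
      (by omega) (by omega) c2 (by omega) (by omega) (by omega) (by omega) (by omega) c3
  exact q6

lemma mk_sys (C : Ctx z D ι σ ρ) (e : Job z → ℕ) (he : e = fun j => σ j + pJob z D ι j) :
    Sys σ e (Wval z D) (fun j => tg j = 0) (fun j => tg j = 1) (fun j => tg j = 4)
      (fun j => tg j = 2 ∧ 2 ∈ ρ j) (fun j => tg j = 2 ∧ 3 ∈ ρ j)
      (fun j => tg j = 3 ∧ 2 ∈ ρ j) (fun j => tg j = 3 ∧ 3 ∈ ρ j)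
      (fun j => tg j = 7 ∧ 2 ∈ ρ j) (fun j => tg j = 7 ∧ 3 ∈ ρ j)
      (fun j => tg j = 8 ∧ 2 ∈ ρ j) (fun j => tg j = 8 ∧ 3 ∈ ρ j)
      (fun j => tg j = 9) (fun j => tg j = 10) := by
  have hb : ∀ j, (tg j = 0 ∨ tg j = 1 ∨ tg j = 4) → 2 ∈ ρ j ∧ 3 ∈ ρ j := by
    intro j hj
    apply C.hn.2.2.1 j
    cases j <;> simp [tg] at hj <;> trivial
  have hx : ∀ M j j', M ∈ ρ j → M ∈ ρ j' → j ≠ j' → e j ≤ σ j' ∨ e j' ≤ σ j := by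
    intro M j j' h h' hne
    subst he
    exact C.hf.2.2 j j' hne ⟨M, by simp [h, h']⟩
  have hnb : ∀ j, (tg j = 2 ∨ tg j = 3) → 2 ∈ ρ j → 3 ∈ ρ j → False := by
    intro j hj h2 h3
    have := C.hn.2.2.2 j (by cases j <;> simp [tg] at hj <;> trivial)
    exact this.1 h2 h3
  have m1 := C.mem1
  have m4 := C.mem4
  have s2 := N_split C e 2 (by omega)
  have s3 := N_split C e 3 (by omega)
  constructor
  · intro j; have := C.ppos j; simp only [he]; omega
  · intro j; rw [he]; exact C.end_le j
  · intro j j' h h' hne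
    have h1 := hb j h
    have : 2 ∈ ρ j' ∨ 3 ∈ ρ j' := by
      rcases h' with h' | h' | h' | h' | h' | h' | h'
      · exact Or.inl (hb j' (by omega)).1
      · exact Or.inl (hb j' (by omega)).1
      · exact Or.inl (hb j' (by omega)).1
      all_goals first | exact Or.inl h'.2 | exact Or.inr h'.2
    rcases this with h2 | h2
    · exact hx 2 j j' h1.1 h2 hne
    · exact hx 3 j j' h1.2 h2 hne
  · intro j j' h h' hne
    exact hx 1 j j' ((m1 j).2 (by omega)) ((m1 j').2 (by omega)) hne
  · intro j j' h h' hne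
    exact hx 4 j j' ((m4 j).2 (by omega)) ((m4 j').2 (by omega)) hne
  · intro j h h'; omega
  · intro j h h'; exact hnb j (by omega) h.2 h'.2
  · intro j h h'; exact hnb j (by omega) h.2 h'.2
  · intro j h h'; omega
  · intro j h h'; omega
  · intro j h h'; omega
  · intro j h h'; omega
  · intro j h h'; omega
  · intro j h h'; omega
  · intro t ht
    have g1 := C.good (M := 1) (by omega) (t := t) (by
      rcases ht with ht | ⟨j, hj, ht⟩
      · exact Or.inl ht
      · exact Or.inr ⟨j, (m1 j).2 (by omega), ht⟩)
    have g2 := C.good (M := 2) (by omega) (t := t) (by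
      rcases ht with ht | ⟨j, hj | hj, ht⟩
      · exact Or.inl ht
      · exact Or.inr ⟨j, (hb j (by omega)).1, ht⟩
      · exact Or.inr ⟨j, hj.2, ht⟩)
    have := dig1M C (M := 2) (by omega) t e he g1 g2
    have := s2 t
    omega
  · intro t ht
    have g1 := C.good (M := 1) (by omega) (t := t) (by
      rcases ht with ht | ⟨j, hj, ht⟩
      · exact Or.inl ht
      · exact Or.inr ⟨j, (m1 j).2 (by omega), ht⟩)
    have g2 := C.good (M := 3) (by omega) (t := t) (by
      rcases ht with ht | ⟨j, hj | hj, ht⟩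
      · exact Or.inl ht
      · exact Or.inr ⟨j, (hb j (by omega)).2, ht⟩
      · exact Or.inr ⟨j, hj.2, ht⟩)
    have := dig1M C (M := 3) (by omega) t e he g1 g2
    have := s2 t
    omega
  · intro t ht
    have g1 := C.good (M := 4) (by omega) (t := t) (by
      rcases ht with ht | ⟨j, hj, ht⟩
      · exact Or.inl ht
      · exact Or.inr ⟨j, (m4 j).2 (by omega), ht⟩)
    have g2 := C.good (M := 2) (by omega) (t := t) (by
      rcases ht with ht | ⟨j, hj | hj, ht⟩
      · exact Or.inl ht
      · exact Or.inr ⟨j, (hb j (by omega)).1, ht⟩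
      · exact Or.inr ⟨j, hj.2, ht⟩)
    have := dig4M C (M := 2) (by omega) t e he g1 g2
    have := s3 t
    omega
  · intro t ht
    have g1 := C.good (M := 4) (by omega) (t := t) (by
      rcases ht with ht | ⟨j, hj, ht⟩
      · exact Or.inl ht
      · exact Or.inr ⟨j, (m4 j).2 (by omega), ht⟩)
    have g2 := C.good (M := 3) (by omega) (t := t) (by
      rcases ht with ht | ⟨j, hj | hj, ht⟩
      · exact Or.inl ht
      · exact Or.inr ⟨j, (hb j (by omega)).2, ht⟩
      · exact Or.inr ⟨j, hj.2, ht⟩)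
    have := dig4M C (M := 3) (by omega) t e he g1 g2
    have := s3 t
    omega
  · intro j hj
    have h := hb j (by omega)
    exact dig23 C (σ j) e he (C.good (by omega) (Or.inr ⟨j, h.1, rfl⟩))
      (C.good (by omega) (Or.inr ⟨j, h.2, rfl⟩))
  · intro t
    simpa using N_tg_le C e (fun j => tg j = 9) 9 (by omega) (fun j h => h) t
  · intro t
    simpa using N_tg_le C e (fun j => tg j = 10) 10 (by omega) (fun j h => h) t

/-- Partition mass finished by the start of a `B` job. -/
lemma psum (C : Ctx z D ι σ ρ) (e : Job z → ℕ) (he : e = fun j => σ j + pJob z D ι j)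
    {x0 f : Job z} (hx0 : tg x0 = 1) (hs0 : σ x0 = 0) (hf : tg f = 1) :
    (∑ i, if σ (.Jpart i) + ι i ≤ σ f then ι i else 0) = D * N e (fun j => tg j = 1) (σ f) := by
  have S := mk_sys C e he
  have h0 := N_tot C e he 0 (by omega)
  have h1 := N_tot C e he 1 (by omega)
  have h2 := N_tot C e he 2 (by omega)
  rw [N_split C e 2 (by omega)] at h2
  norm_num at h0 h1 h2
  have hc := S.count (z := z) (x0 := x0) (f := f) hx0 hs0 h0 h1 h2 hf
  have hb := C.hn.2.2.1 f (by cases f <;> simp [tg] at hf; trivial)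
  have g4 := C.good (M := 4) (by omega) (Or.inr ⟨f, (C.mem4 f).2 (by omega), rfl⟩)
  have g2 := C.good (M := 2) (by omega) (Or.inr ⟨f, hb.1, rfl⟩)
  have g3 := C.good (M := 3) (by omega) (Or.inr ⟨f, hb.2, rfl⟩)
  have k2 := dig4M C (M := 2) (by omega) (σ f) e he g4 g2
  have k3 := dig4M C (M := 3) (by omega) (σ f) e he g4 g3
  rw [← lsum_add C, k2.1, k3.1, ← mul_add]
  congr 1
  omega
end sys

section yes
variable {z D : ℕ} {ι : Fin (3*z) → ℕ} {σ : Job z → ℕ} {ρ : Job z → Finset ℕ}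

lemma yes_of_prefix (n : Fin (3*z) → ℕ) (hιpos : ∀ i, 0 < ι i) (hsum : ∑ i, ι i = z * D)
    (h : ∀ k, k ≤ z → (∑ i, if n i ≤ k then ι i else 0) = D * k) : IsYes z D ι := by
  have h1 : ∀ i, 1 ≤ n i := by
    intro i
    by_contra hc
    have h0 := h 0 (by omega)
    rw [mul_zero, Finset.sum_eq_zero_iff] at h0
    have := h0 i (Finset.mem_univ i)
    rw [if_pos (by omega)] at this
    have := hιpos i
    omega
  have h2 : ∀ i, n i ≤ z := by
    intro i
    by_contra hc
    have hz := h z le_rfl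
    have : (∑ i, if n i ≤ z then ι i else 0) < ∑ i, ι i := by
      apply Finset.sum_lt_sum
      · intro i _; split_ifs <;> simp
      · exact ⟨i, Finset.mem_univ i, by rw [if_neg hc]; exact hιpos i⟩
    rw [hsum, hz, mul_comm] at this
    omega
  refine ⟨fun i => ⟨n i - 1, by have := h1 i; have := h2 i; omega⟩, ?_⟩
  intro k
  have e1 := h k.val (by omega)
  have e2 := h (k.val+1) (by omega)
  have e3 : (∑ i, if n i ≤ k.val + 1 then ι i else 0) = (∑ i, if n i ≤ k.val then ι i else 0) +
      ∑ i, if n i = k.val + 1 then ι i else 0 := by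
    rw [← Finset.sum_add_distrib]
    apply Finset.sum_congr rfl
    intro i _
    rcases lt_trichotomy (n i) (k.val+1) with hh | hh | hh
    · rw [if_pos (by omega), if_pos (by omega), if_neg (by omega), add_zero]
    · rw [if_pos (by omega), if_neg (by omega), if_pos (by omega), zero_add]
    · rw [if_neg (by omega), if_neg (by omega), if_neg (by omega)]
  rw [Finset.sum_filter]
  have e4 : (∑ i, if (⟨n i - 1, by have := h1 i; have := h2 i; omega⟩ : Fin z) = k then ι i else 0)
     = ∑ i, if n i = k.val + 1 then ι i else 0 := by
    apply Finset.sum_congr rfl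
    intro i _
    apply if_congr _ rfl rfl
    rw [Fin.ext_iff]
    have := h1 i
    simp only
    omega
  rw [e4]
  rw [e1, e2, mul_add] at e3
  omega

lemma yes (C : Ctx z D ι σ ρ) {x0 : Job z} (hx0 : tg x0 = 1) (hs0 : σ x0 = 0) : IsYes z D ι := by
  obtain ⟨e, he⟩ : ∃ e : Job z → ℕ, e = fun j => σ j + pJob z D ι j := ⟨_, rfl⟩
  have hpos : ∀ j, σ j < e j := by intro j; have := C.ppos j; simp only [he]; omega
  have hle : ∀ j, e j ≤ Wval z D := by intro j; rw [he]; exact C.end_le j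
  have hb : ∀ i, 2 ∈ ρ (.JB i) ∧ 3 ∈ ρ (.JB i) := fun i => C.hn.2.2.1 (.JB i) trivial
  have hx : ∀ M j j', M ∈ ρ j → M ∈ ρ j' → j ≠ j' → e j ≤ σ j' ∨ e j' ≤ σ j := by
    intro M j j' h h' hne
    subst he
    exact C.hf.2.2 j j' hne ⟨M, by simp [h, h']⟩
  have hW := N_tot C e he 1 (by omega)
  norm_num at hW
  have hlt : ∀ i : Fin (z+1), N e (fun j => tg j = 1) (σ (.JB i)) < z + 1 := by
    intro i
    rw [← hW]
    exact N_lt (j := .JB i) rfl (hpos _) (hle _)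
  let g : Fin (z+1) → Fin (z+1) := fun i => ⟨_, hlt i⟩
  have ginj : Function.Injective g := by
    intro i i' h
    by_contra hne
    have hh : N e (fun j => tg j = 1) (σ (.JB i)) = N e (fun j => tg j = 1) (σ (.JB i')) :=
      congrArg Fin.val h
    rcases hx 2 (.JB i) (.JB i') (hb i).1 (hb i').1 (by simpa using hne) with h1 | h1
    · have := N_lt (P := fun j => tg j = 1) (j := Job.JB i) rfl (hpos _) h1
      omega
    · have := N_lt (P := fun j => tg j = 1) (j := Job.JB i') rfl (hpos _) h1
      omega
  have gsurj := Finite.injective_iff_surjective.1 ginj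
  apply yes_of_prefix (fun i => N e (fun j => tg j = 1) (σ (.Jpart i))) C.hιpos C.hsum
  intro k hk
  obtain ⟨i, hi⟩ := gsurj ⟨k, by omega⟩
  have hi' : N e (fun j => tg j = 1) (σ (.JB i)) = k := congrArg Fin.val hi
  have hp := psum C e he hx0 hs0 (f := .JB i) rfl
  rw [hi'] at hp
  rw [← hp]
  apply Finset.sum_congr rfl
  intro l _
  apply if_congr _ rfl rfl
  have hd : e (.Jpart l) ≤ σ (.JB i) ∨ e (.JB i) ≤ σ (.Jpart l) := by
    have h3 := C.hn.2.2.2 (.Jpart l) trivial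
    by_cases h : 3 ∈ ρ (.Jpart l)
    · exact hx 3 _ _ h (hb i).2 (by simp)
    · exact hx 2 _ _ (h3.2 h) (hb i).1 (by simp)
  have hel : σ (.Jpart l) + ι l = e (.Jpart l) := by rw [he]; rfl
  rw [hel]
  constructor
  · intro h
    rcases hd with h1 | h1
    · exact h1
    · have := N_lt (P := fun j => tg j = 1) (j := Job.JB i) rfl (hpos _) h1
      omega
  · intro h
    rw [← hi']
    exact N_mono _ ((hpos _).le.trans h)
end yes

section cst

lemma lex {J : Type} (S : J → Prop) (σ e bl sl : J → ℕ) (n nb : ℕ) (U : ℕ → ℕ → ℕ)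
    (hU : ∀ k ≤ nb, ∀ s, U k s ≤ U k (s+1)) (hn : ∀ k < nb, U k n ≤ U (k+1) 0)
    (hc : ∀ j, S j → bl j ≤ nb ∧ sl j < n ∧ U (bl j) (sl j) ≤ σ j ∧ e j ≤ U (bl j) (sl j + 1))
    (j j' : J) (hj : S j) (hj' : S j') :
    e j ≤ σ j' ∨ e j' ≤ σ j ∨ (bl j = bl j' ∧ sl j = sl j') := by
  have hm : ∀ k ≤ nb, Monotone (U k) := fun k hk => monotone_nat_of_le_succ (hU k hk)
  have h0 : ∀ k k', k ≤ k' → k' ≤ nb → U k 0 ≤ U k' 0 := by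
    intro k k' hkk
    induction k', hkk using Nat.le_induction with
    | base => intro _; exact le_rfl
    | succ m hm' ih =>
      intro h
      have h1 := ih (by omega)
      have h2 := hn m (by omega)
      have h3 := hm m (by omega) (Nat.zero_le n)
      omega
  have key : ∀ j j', S j → S j' → (bl j < bl j' ∨ (bl j = bl j' ∧ sl j < sl j')) → e j ≤ σ j' := by
    intro j j' hj hj' h
    obtain ⟨a1, a2, a3, a4⟩ := hc j hj
    obtain ⟨b1, b2, b3, b4⟩ := hc j' hj'
    rcases h with h | ⟨h, h'⟩
    · have h1 := hm _ a1 (show sl j + 1 ≤ n by omega)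
      have h2 := hn _ (show bl j < nb by omega)
      have h3 := h0 _ _ (show bl j + 1 ≤ bl j' by omega) b1
      have h4 := hm _ b1 (Nat.zero_le (sl j'))
      omega
    · rw [h] at a4
      have h1 := hm _ b1 (show sl j + 1 ≤ sl j' by omega)
      omega
  have k1 := key j j' hj hj'
  have k2 := key j' j hj' hj
  omega

def Kb (z D : ℕ) : ℕ := D^2 + D^3 + D^4 + D^5 + D^6 + (7*z-1)*D^7 + D^8
def Ast (z D k : ℕ) : ℕ := k * Kb z D + D^3 + (z+k)*D^7 + D^8
def pa (z D : ℕ) : ℕ := D^4 + D^6 + 3*z*D^7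
def gam (z D k : ℕ) : ℕ := D^5 + (3*z - (k+1))*D^7 - D
def del (z D k : ℕ) : ℕ := D^4 + (3*z - (k+1))*D^7

lemma facts {z D k : ℕ} (hz : 0 < z) (hD : 0 < D) (hk : k ≤ z) :
    3*z*D^7 = 3*(z*D^7) ∧ 4*z*D^7 = 4*(z*D^7) ∧ (4*z-1)*D^7 + D^7 = 4*(z*D^7) ∧
    2*z*D^7 = 2*(z*D^7) ∧ (z+k)*D^7 = z*D^7 + k*D^7 ∧ (z+(k+1))*D^7 = z*D^7 + k*D^7 + D^7 ∧
    (3*z - (k+1))*D^7 + k*D^7 + D^7 = 3*(z*D^7) ∧ (k+1)*Kb z D = k*Kb z D + Kb z D ∧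
    Kb z D + D^7 = D^2 + D^3 + D^4 + D^5 + D^6 + 7*(z*D^7) + D^8 ∧
    D ≤ D^5 ∧ D^7 ≤ z*D^7 ∧ k*D^7 ≤ z*D^7 ∧ k*Kb z D ≤ z*Kb z D ∧
    (z+z)*D^7 = 2*(z*D^7) := by
  refine ⟨by ring, by ring, ?_, by ring, by ring, by ring, ?_, by ring, ?_, ?_, ?_, ?_, ?_, by ring⟩
  · obtain ⟨w, hw⟩ : ∃ w, 4*z = w + 1 := ⟨4*z-1, by omega⟩
    have : 4 * (z * D^7) = 4*z*D^7 := by ring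
    rw [this, hw, Nat.add_sub_cancel]; ring
  · have : 3 * (z*D^7) = (3*z)*D^7 := by ring
    rw [this, ← add_mul]
    have h2 : 3*z = (3*z - (k+1) + k) + 1 := by omega
    have h3 : (3*z - (k+1) + k + 1) * D^7 = 3*z*D^7 := congrArg (· * D^7) h2.symm
    rw [← h3]; ring
  · unfold Kb
    obtain ⟨w, hw⟩ : ∃ w, 7*z = w + 1 := ⟨7*z-1, by omega⟩
    have : 7 * (z * D^7) = 7*z*D^7 := by ring
    rw [this, hw, Nat.add_sub_cancel]; ring
  · calc D = D^1 := (pow_one D).symm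
      _ ≤ D^5 := Nat.pow_le_pow_right hD (by omega)
  · exact Nat.le_mul_of_pos_left _ hz
  · exact Nat.mul_le_mul_right _ hk
  · exact Nat.mul_le_mul_right _ hk

lemma Wv (z D : ℕ) (hz : 0 < z) : Wval z D = Ast z D z + D^2 := by
  unfold Wval Ast Kb
  obtain ⟨w, hw⟩ : ∃ w, 7*z = w + 1 := ⟨7*z-1, by omega⟩
  rw [hw, Nat.add_sub_cancel]
  have : z * (w+1+1) * D^7 = z * w * D^7 + (z+z)*D^7 := by ring
  rw [this]; ring

def U1 (z D : ℕ) : ℕ → ℕ → ℕ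
  | 0, 0 => 0
  | 0, _+1 => Ast z D 0
  | k+1, 0 => Ast z D k
  | k+1, 1 => Ast z D k + D^2
  | k+1, 2 => Ast z D k + D^2 + pa z D
  | k+1, _+3 => Ast z D (k+1)

def U2 (z D k : ℕ) : ℕ → ℕ
  | 0 => k * Kb z D
  | 1 => k * Kb z D + D^3
  | 2 => Ast z D k
  | 3 => Ast z D k + D^2
  | 4 => Ast z D k + D^2 + pa z D
  | 5 => Ast z D k + D^2 + pa z D + gam z D k
  | _+6 => (k+1) * Kb z D

def U3 (z D k : ℕ) : ℕ → ℕ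
  | 0 => k * Kb z D
  | 1 => k * Kb z D + D^3
  | 2 => Ast z D k
  | 3 => Ast z D k + D^2
  | 4 => Ast z D k + D^2 + del z D k
  | _+5 => (k+1) * Kb z D

def U4 (z D k : ℕ) : ℕ → ℕ
  | 0 => k * Kb z D
  | 1 => k * Kb z D + D^3
  | 2 => Ast z D k + D^2 + del z D k
  | _+3 => (k+1) * Kb z D

variable {z : ℕ}

def bl (f : Fin (3*z) → Fin z) : Job z → ℕ
  | .JA i => i.val
  | .JB i => i.val
  | .Ja i => i.val
  | .Jb i => i.val
  | .Jc i => i.val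
  | .Jα i => i.val
  | .Jβ i => i.val
  | .Jγ i => i.val
  | .Jδ i => i.val
  | .Jl1 => 0
  | .Jl2 => z
  | .Jpart i => (f i).val

def bl1 : Job z → ℕ
  | .JA i => i.val + 1
  | .Ja i => i.val + 1
  | .Jα i => i.val + 1
  | _ => 0

def sl1 : Job z → ℕ
  | .Ja _ => 1
  | .Jα _ => 2
  | _ => 0

def sl2 : Job z → ℕ
  | .Jc _ => 1
  | .JA _ => 2
  | .Ja _ => 3
  | .Jγ _ => 4
  | .Jpart _ => 5
  | _ => 0

def sl3 : Job z → ℕ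
  | .Jc _ => 1
  | .JA _ => 2
  | .Jδ _ => 3
  | .Jb _ => 4
  | _ => 0

def sl4 : Job z → ℕ
  | .Jβ _ => 1
  | .Jl2 => 1
  | .Jb _ => 2
  | _ => 0

def pre (ι : Fin (3*z) → ℕ) (f : Fin (3*z) → Fin z) (l : Fin (3*z)) : ℕ :=
  ∑ i ∈ Finset.univ.filter (fun i => f i = f l ∧ i < l), ι i

def sg (D : ℕ) (ι : Fin (3*z) → ℕ) (f : Fin (3*z) → Fin z) : Job z → ℕ
  | .JA i => Ast z D i.val
  | .JB i => i.val * Kb z D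
  | .Ja i => Ast z D i.val + D^2
  | .Jb i => Ast z D i.val + D^2 + del z D i.val
  | .Jc i => i.val * Kb z D + D^3
  | .Jα i => Ast z D i.val + D^2 + pa z D
  | .Jβ i => i.val * Kb z D + D^3
  | .Jγ i => Ast z D i.val + D^2 + pa z D
  | .Jδ i => Ast z D i.val + D^2
  | .Jl1 => 0
  | .Jl2 => z * Kb z D + D^3
  | .Jpart l => Ast z D (f l).val + D^2 + pa z D + gam z D (f l).val + pre ι f l

def lo : Job z → ℕ
  | .JA _ => 1
  | .JB _ => 2
  | .Ja _ => 1
  | .Jb _ => 3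
  | .Jc _ => 2
  | .Jα _ => 1
  | .Jβ _ => 4
  | .Jγ _ => 2
  | .Jδ _ => 3
  | .Jl1 => 1
  | .Jl2 => 4
  | .Jpart _ => 2

def hi : Job z → ℕ
  | .JA _ => 3
  | .JB _ => 4
  | .Ja _ => 2
  | .Jb _ => 4
  | .Jc _ => 3
  | .Jα _ => 1
  | .Jβ _ => 4
  | .Jγ _ => 2
  | .Jδ _ => 3
  | .Jl1 => 1
  | .Jl2 => 4
  | .Jpart _ => 2

variable {D : ℕ} {ι : Fin (3*z) → ℕ} {f : Fin (3*z) → Fin z}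

lemma pre_add (l : Fin (3*z)) : pre ι f l + ι l =
    ∑ i ∈ Finset.univ.filter (fun i => f i = f l ∧ i ≤ l), ι i := by
  have : Finset.univ.filter (fun i => f i = f l ∧ i ≤ l) =
      insert l (Finset.univ.filter (fun i => f i = f l ∧ i < l)) := by
    ext i
    simp only [Finset.mem_filter, Finset.mem_univ, true_and, Finset.mem_insert]
    constructor
    · rintro ⟨h1, h2⟩
      rcases h2.lt_or_eq with h | h
      · exact Or.inr ⟨h1, h⟩
      · exact Or.inl h
    · rintro (h | h)
      · subst h; exact ⟨rfl, le_rfl⟩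
      · exact ⟨h.1, h.2.le⟩
  rw [this, Finset.sum_insert (by simp), add_comm, pre]

lemma pre_le (hf : ∀ k : Fin z, ∑ i ∈ Finset.univ.filter (fun i => f i = k), ι i = D)
    (l : Fin (3*z)) : pre ι f l + ι l ≤ D := by
  rw [pre_add, ← hf (f l)]
  apply Finset.sum_le_sum_of_subset
  intro i
  simp only [Finset.mem_filter, Finset.mem_univ, true_and]
  exact fun h => h.1

lemma pre_lt {l l' : Fin (3*z)} (hff : f l = f l') (h : l < l') :
    pre ι f l + ι l ≤ pre ι f l' := by
  rw [pre_add, pre]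
  apply Finset.sum_le_sum_of_subset
  intro i
  simp only [Finset.mem_filter, Finset.mem_univ, true_and]
  rintro ⟨h1, h2⟩
  exact ⟨h1.trans hff, lt_of_le_of_lt h2 h⟩

lemma m1 (hz : 0 < z) (hD : 0 < D) (j j' : Job z) (hj : 1 ∈ Finset.Icc (lo j) (hi j))
    (hj' : 1 ∈ Finset.Icc (lo j') (hi j')) (hne : j ≠ j') :
    sg D ι f j + pJob z D ι j ≤ sg D ι f j' ∨ sg D ι f j' + pJob z D ι j' ≤ sg D ι f j := by
  have := lex (fun j : Job z => 1 ∈ Finset.Icc (lo j) (hi j)) (sg D ι f)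
    (fun j => sg D ι f j + pJob z D ι j) bl1 sl1 3 (z+1) (U1 z D)
    (by
      rintro (_|k) hk (_|_|_|s) <;> simp only [U1, le_refl, Nat.zero_le, Ast, pa] <;>
        have := facts hz hD (show k ≤ z by omega) <;> omega)
    (by rintro (_|k) hk <;> simp [U1])
    (by
      intro j hj
      simp only [Finset.mem_Icc] at hj
      cases j <;> simp [lo, hi] at hj <;> simp only [bl1, sl1, U1, sg, pJob, le_refl, true_and, and_true, zero_add,
        Nat.reduceAdd]
      case JA i => have := i.isLt; omega
      case Ja i => simp only [pa]; omega
      case Jα i =>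
        have := i.isLt
        have := facts hz hD (show i.val ≤ z by omega)
        simp only [Ast, pa]; omega
      case Jl1 => simp [Ast])
    j j' hj hj'
  rcases this with h | h | ⟨h1, h2⟩
  · exact Or.inl h
  · exact Or.inr h
  · exfalso
    simp only [Finset.mem_Icc] at hj hj'
    cases j <;> simp [lo, hi] at hj <;> cases j' <;> simp [lo, hi] at hj' <;>
      simp [bl1, sl1] at h1 h2 <;> simp [Fin.ext_iff] at hne <;> omega

lemma m2 (hz : 0 < z) (hD : 0 < D)
    (hf : ∀ k : Fin z, ∑ i ∈ Finset.univ.filter (fun i => f i = k), ι i = D)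
    (j j' : Job z) (hj : 2 ∈ Finset.Icc (lo j) (hi j))
    (hj' : 2 ∈ Finset.Icc (lo j') (hi j')) (hne : j ≠ j') :
    sg D ι f j + pJob z D ι j ≤ sg D ι f j' ∨ sg D ι f j' + pJob z D ι j' ≤ sg D ι f j := by
  have := lex (fun j : Job z => 2 ∈ Finset.Icc (lo j) (hi j)) (sg D ι f)
    (fun j => sg D ι f j + pJob z D ι j) (bl f) sl2 6 z (U2 z D)
    (by
      rintro k hk (_|_|_|_|_|_|s) <;> simp only [U2, le_refl, Ast, pa, gam] <;>
        have := facts hz hD hk <;> omega)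
    (by intro k hk; simp [U2])
    (by
      intro j hj
      simp only [Finset.mem_Icc] at hj
      cases j <;> simp [lo, hi] at hj <;> simp only [bl, sl2, U2, sg, pJob, le_refl, true_and, and_true, zero_add,
        Nat.reduceAdd]
      case Jpart l =>
        have := (f l).isLt
        have := facts hz hD (show (f l).val ≤ z by omega)
        have := pre_le hf l
        simp only [Ast, pa, gam]; omega
      all_goals
        rename_i i
        have := i.isLt
        have := facts hz hD (show i.val ≤ z by omega)
        try simp only [Ast, pa, gam]
        omega)
    j j' hj hj'
  rcases this with h | h | ⟨h1, h2⟩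
  · exact Or.inl h
  · exact Or.inr h
  · simp only [Finset.mem_Icc] at hj hj'
    cases j <;> simp [lo, hi] at hj <;> cases j' <;> simp [lo, hi] at hj' <;>
      simp [bl, sl2] at h1 h2 <;> simp [Fin.ext_iff] at hne <;> try omega
    rename_i l l'
    have hff : f l = f l' := Fin.ext h1
    simp only [sg, pJob, hff]
    rcases lt_or_gt_of_ne hne with h | h
    · have := pre_lt (ι := ι) hff (Fin.lt_def.2 h); omega
    · have := pre_lt (ι := ι) hff.symm (Fin.lt_def.2 h); omega

lemma m3 (hz : 0 < z) (hD : 0 < D)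
    (j j' : Job z) (hj : 3 ∈ Finset.Icc (lo j) (hi j))
    (hj' : 3 ∈ Finset.Icc (lo j') (hi j')) (hne : j ≠ j') :
    sg D ι f j + pJob z D ι j ≤ sg D ι f j' ∨ sg D ι f j' + pJob z D ι j' ≤ sg D ι f j := by
  have := lex (fun j : Job z => 3 ∈ Finset.Icc (lo j) (hi j)) (sg D ι f)
    (fun j => sg D ι f j + pJob z D ι j) (bl f) sl3 5 z (U3 z D)
    (by
      rintro k hk (_|_|_|_|_|s) <;> simp only [U3, le_refl, Ast, del] <;>
        have := facts hz hD hk <;> omega)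
    (by intro k hk; simp [U3])
    (by
      intro j hj
      simp only [Finset.mem_Icc] at hj
      cases j <;> simp [lo, hi] at hj <;> simp only [bl, sl3, U3, sg, pJob, le_refl, true_and, and_true, zero_add,
        Nat.reduceAdd]
      all_goals
        rename_i i
        have := i.isLt
        have := facts hz hD (show i.val ≤ z by omega)
        try simp only [Ast, del]
        omega)
    j j' hj hj'
  rcases this with h | h | ⟨h1, h2⟩
  · exact Or.inl h
  · exact Or.inr h
  · exfalso
    simp only [Finset.mem_Icc] at hj hj'
    cases j <;> simp [lo, hi] at hj <;> cases j' <;> simp [lo, hi] at hj' <;>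
      simp [bl, sl3] at h1 h2 <;> simp [Fin.ext_iff] at hne <;> omega

lemma m4 (hz : 0 < z) (hD : 0 < D)
    (j j' : Job z) (hj : 4 ∈ Finset.Icc (lo j) (hi j))
    (hj' : 4 ∈ Finset.Icc (lo j') (hi j')) (hne : j ≠ j') :
    sg D ι f j + pJob z D ι j ≤ sg D ι f j' ∨ sg D ι f j' + pJob z D ι j' ≤ sg D ι f j := by
  have := lex (fun j : Job z => 4 ∈ Finset.Icc (lo j) (hi j)) (sg D ι f)
    (fun j => sg D ι f j + pJob z D ι j) (bl f) sl4 3 z (U4 z D)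
    (by
      rintro k hk (_|_|_|s) <;> simp only [U4, le_refl, Ast, del] <;>
        have := facts hz hD hk <;> omega)
    (by intro k hk; simp [U4])
    (by
      intro j hj
      simp only [Finset.mem_Icc] at hj
      cases j <;> simp [lo, hi] at hj <;> simp only [bl, sl4, U4, sg, pJob, le_refl, true_and, and_true, zero_add,
        Nat.reduceAdd]
      case Jl2 =>
        have := facts hz hD (le_refl z)
        try simp only [Ast, del]
        omega
      all_goals
        rename_i i
        have := i.isLt
        have := facts hz hD (show i.val ≤ z by omega)
        try simp only [Ast, del]
        omega)
    j j' hj hj'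
  rcases this with h | h | ⟨h1, h2⟩
  · exact Or.inl h
  · exact Or.inr h
  · exfalso
    simp only [Finset.mem_Icc] at hj hj'
    cases j <;> simp [lo, hi] at hj <;> cases j' <;> simp [lo, hi] at hj' <;>
      simp [bl, sl4] at h1 h2 <;> simp [Fin.ext_iff] at hne <;> omega

lemma ends (hz : 0 < z) (hD : 0 < D)
    (hf : ∀ k : Fin z, ∑ i ∈ Finset.univ.filter (fun i => f i = k), ι i = D) (j : Job z) :
    sg D ι f j + pJob z D ι j ≤ Wval z D := by
  rw [Wv z D hz]
  have fz := facts hz hD (le_refl z)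
  have h1 : ∀ k, k < z → (k+1) * Kb z D ≤ z * Kb z D ∧ (k+1) * D^7 ≤ z * D^7 ∧
      (k+1) * D^7 = k*D^7 + D^7 :=
    fun k hk => ⟨Nat.mul_le_mul_right _ hk, Nat.mul_le_mul_right _ hk, by ring⟩
  cases j <;> simp only [sg, pJob]
  case Jpart l =>
    have := (f l).isLt
    have := facts hz hD (show (f l).val ≤ z by omega)
    have := pre_le hf l
    have := h1 _ (f l).isLt
    simp only [Ast, pa, gam]; omega
  case Jl1 => simp only [Ast]; omega
  case Jl2 => simp only [Ast]; omega
  case JA i =>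
    have := i.isLt
    have := facts hz hD (show i.val ≤ z by omega)
    simp only [Ast]; omega
  case JB i =>
    have := i.isLt
    have := facts hz hD (show i.val ≤ z by omega)
    simp only [Ast]; omega
  case Jc i =>
    have := i.isLt
    have := facts hz hD (show i.val ≤ z by omega)
    simp only [Ast]; omega
  all_goals
    rename_i i
    have := i.isLt
    have := facts hz hD (show i.val ≤ z by omega)
    have := h1 _ i.isLt
    simp only [Ast, pa, del]; omega

lemma contig (hz : 0 < z) (hD : 0 < D) (hy : IsYes z D ι) :
    ∃ (σ : Job z → ℕ) (ρ : Job z → Finset ℕ),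
      Feasible 4 (pJob z D ι) (qJob z) σ ρ ∧
      makespan (pJob z D ι) σ = Wval z D ∧
      ∀ j, ∃ k l, ρ j = Finset.Icc k l := by
  obtain ⟨f, hf⟩ := hy
  refine ⟨sg D ι f, fun j => Finset.Icc (lo j) (hi j), ⟨?_, ?_, ?_⟩, ?_, fun j => ⟨_, _, rfl⟩⟩
  · intro j
    apply Finset.Icc_subset_Icc <;> cases j <;> simp [lo, hi]
  · intro j
    cases j <;> simp [lo, hi, qJob]
  · rintro j j' hne ⟨M, hM⟩
    rw [Finset.mem_inter] at hM
    have hM' : M = 1 ∨ M = 2 ∨ M = 3 ∨ M = 4 := by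
      have h1 := Finset.mem_Icc.1 hM.1
      have : 1 ≤ lo j ∧ hi j ≤ 4 := by cases j <;> simp [lo, hi]
      omega
    rcases hM' with rfl | rfl | rfl | rfl
    · exact m1 hz hD j j' hM.1 hM.2 hne
    · exact m2 hz hD hf j j' hM.1 hM.2 hne
    · exact m3 hz hD j j' hM.1 hM.2 hne
    · exact m4 hz hD j j' hM.1 hM.2 hne
  · apply le_antisymm
    · exact Finset.sup_le (fun j _ => ends hz hD hf j)
    · rw [Wv z D hz]
      exact Finset.le_sup (f := fun j => sg D ι f j + pJob z D ι j)
        (Finset.mem_univ (Job.JA (Fin.last z)))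

end cst

end NF

/-- If the constructed instance has a normal-form feasible schedule with makespan `W`
whose first job on machine 2 is in `B`, then the 3-Partition instance is a Yes-instance
and there is a feasible schedule with makespan `W` using only contiguous machine sets. -/
theorem normal_form_to_yes_and_contiguous
    (z D : ℕ) (ι : Fin (3*z) → ℕ)
    (hz : 0 < z) (hDpos : 0 < D)
    (hιpos : ∀ i, 0 < ι i)
    (hsum : ∑ i, ι i = z * D)
    (hlow : ∀ i, D < 4 * ι i)
    (hhigh : ∀ i, 2 * ι i < D)
    (hD : 4*z*(7*z+1) < D)
    (hexists : ∃ (σ : Job z → ℕ) (ρ : Job z → Finset ℕ),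
      Feasible 4 (pJob z D ι) (qJob z) σ ρ ∧
      makespan (pJob z D ι) σ = Wval z D ∧
      NormalForm ρ ∧
      (∃ j ∈ sB z, 2 ∈ ρ j ∧ σ j = 0)) :
    IsYes z D ι ∧
    ∃ (σ : Job z → ℕ) (ρ : Job z → Finset ℕ),
      Feasible 4 (pJob z D ι) (qJob z) σ ρ ∧
      makespan (pJob z D ι) σ = Wval z D ∧
      ∀ j, ∃ k l, ρ j = Finset.Icc k l := by
  obtain ⟨σ, ρ, hf, hm, hn, x0, hx0, -, hs0⟩ := hexists
  have hy : IsYes z D ι := by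
    have C : NF.Ctx z D ι σ ρ := ⟨hz, hιpos, hsum, hD, hf, hm, hn⟩
    have ht : NF.tg x0 = 1 := by
      simp only [sB, Finset.mem_image, Finset.mem_univ, true_and] at hx0
      obtain ⟨i, rfl⟩ := hx0
      rfl
    exact NF.yes C ht hs0
  exact ⟨hy, NF.contig hz hDpos hy⟩
end
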